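/- arXiv:2510.18024 — 3 statements merged into one kernel-verified Lean document; each statement's English description precedes it below -/
import Mathlib

section
/- For every fixed β > 0 there exists a constant C = C(β) > 0 such that for all x, y, q, a with 2 ≤ y ≤ x, 1 ≤ q ≤ min{x, y^β}, and gcd(a, q) = 1, one has |Ψ(x, y; q, a) − Ψ_q(x, y)/φ(q)| ≤ C · (Ψ_q(x, y)/φ(q)) · (log q / log y). -/
open scoped Classical

/-- `Ψ(x, y; q, a)`: the number of `y`-smooth positive integers `n ≤ x`
with `n ≡ a (mod q)`. -/
noncomputable def PsiMod (x y : ℝ) (q : ℕ) (a : ℤ) : ℕ :=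
  ((Finset.Icc 1 ⌊x⌋₊).filter
    (fun (n : ℕ) => (∀ p ∈ n.primeFactors, (p : ℝ) ≤ y) ∧ (n : ℤ) % (q : ℤ) = a % (q : ℤ))).card

/-- `Ψ_q(x, y)`: the number of `y`-smooth positive integers `n ≤ x` with `gcd(n, q) = 1`. -/
noncomputable def PsiCoprime (x y : ℝ) (q : ℕ) : ℕ :=
  ((Finset.Icc 1 ⌊x⌋₊).filter
    (fun (n : ℕ) => (∀ p ∈ n.primeFactors, (p : ℝ) ≤ y) ∧ Nat.Coprime n q)).card

open scoped ArithmeticFunction.vonMangoldt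
open Finset

/-- A function with nonnegative partial sums has nonnegative sum against any nonnegative
antitone weight. -/
lemma sum_mul_nonneg_of_antitone {a f : ℕ → ℝ} {M : ℕ}
    (ha : ∀ k, 1 ≤ k → k ≤ M → 0 ≤ ∑ m ∈ Icc 1 k, a m)
    (hf : ∀ m, 1 ≤ m → m ≤ M → 0 ≤ f m)
    (hanti : ∀ m, 1 ≤ m → m + 1 ≤ M → f (m + 1) ≤ f m) :
    0 ≤ ∑ m ∈ Icc 1 M, a m * f m := by
  have key : ∀ k, 1 ≤ k → k ≤ M →
      (∑ m ∈ Icc 1 k, a m) * f k ≤ ∑ m ∈ Icc 1 k, a m * f m := by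
    intro k hk
    induction k, hk using Nat.le_induction with
    | base => simp
    | succ k hk ih =>
      intro hkM
      rw [Finset.sum_Icc_succ_top (by omega), Finset.sum_Icc_succ_top (by omega)]
      have h1 := ih (by omega)
      have h2 := mul_le_mul_of_nonneg_left (hanti k hk hkM) (ha k hk (by omega))
      nlinarith
  rcases Nat.eq_zero_or_pos M with rfl | hM
  · simp
  · exact (mul_nonneg (ha M hM le_rfl) (hf M hM le_rfl)).trans (key M hM le_rfl)

lemma sum_mul_le_sum_mul_of_antitone {a h f : ℕ → ℝ} {M : ℕ}
    (ha : ∀ k, 1 ≤ k → k ≤ M → ∑ m ∈ Icc 1 k, a m ≤ ∑ m ∈ Icc 1 k, h m)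
    (hf : ∀ m, 1 ≤ m → m ≤ M → 0 ≤ f m)
    (hanti : ∀ m, 1 ≤ m → m + 1 ≤ M → f (m + 1) ≤ f m) :
    ∑ m ∈ Icc 1 M, a m * f m ≤ ∑ m ∈ Icc 1 M, h m * f m := by
  have := sum_mul_nonneg_of_antitone (a := fun m => h m - a m) (f := f) (M := M)
    (fun k h1 h2 => by rw [Finset.sum_sub_distrib]; linarith [ha k h1 h2]) hf hanti
  simp only [sub_mul, Finset.sum_sub_distrib] at this
  linarith

lemma abs_sum_mul_le_of_antitone {a h f : ℕ → ℝ} {M : ℕ}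
    (ha : ∀ k, 1 ≤ k → k ≤ M → |∑ m ∈ Icc 1 k, a m| ≤ ∑ m ∈ Icc 1 k, h m)
    (hf : ∀ m, 1 ≤ m → m ≤ M → 0 ≤ f m)
    (hanti : ∀ m, 1 ≤ m → m + 1 ≤ M → f (m + 1) ≤ f m) :
    |∑ m ∈ Icc 1 M, a m * f m| ≤ ∑ m ∈ Icc 1 M, h m * f m := by
  rw [abs_le]
  constructor
  · have := sum_mul_le_sum_mul_of_antitone (a := fun m => - a m) (h := h) (f := f) (M := M)
      (fun k h1 h2 => by
        rw [Finset.sum_neg_distrib]; linarith [neg_abs_le (∑ m ∈ Icc 1 k, a m), ha k h1 h2])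
      hf hanti
    simp only [neg_mul, Finset.sum_neg_distrib] at this
    linarith
  · exact sum_mul_le_sum_mul_of_antitone (fun k h1 h2 => (le_abs_self _).trans (ha k h1 h2)) hf hanti

lemma sum_divisors_eq_sum_sum (F : ℕ → ℕ → ℝ) (N : ℕ) :
    ∑ n ∈ Icc 1 N, ∑ d ∈ n.divisors, F d n =
      ∑ d ∈ Icc 1 N, ∑ m ∈ Icc 1 (N / d), F d (d * m) := by
  rw [Finset.sum_sigma', Finset.sum_sigma']
  refine Finset.sum_nbij' (fun x => ⟨x.2, x.1 / x.2⟩) (fun x => ⟨x.1 * x.2, x.1⟩) ?_ ?_ ?_ ?_ ?_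
  · rintro ⟨n, d⟩ h
    simp only [mem_sigma, mem_Icc, Nat.mem_divisors] at h ⊢
    obtain ⟨⟨h1, h2⟩, h3, h4⟩ := h
    have hd := Nat.pos_of_dvd_of_pos h3 h1
    have hdn := Nat.le_of_dvd h1 h3
    exact ⟨⟨hd, hdn.trans h2⟩, Nat.div_pos hdn hd, Nat.div_le_div_right h2⟩
  · rintro ⟨d, m⟩ h
    simp only [mem_sigma, mem_Icc, Nat.mem_divisors] at h ⊢
    obtain ⟨⟨h1, h2⟩, h3, h4⟩ := h
    have := (Nat.le_div_iff_mul_le h1).1 h4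
    have hp : 0 < d * m := Nat.mul_pos h1 h3
    exact ⟨⟨hp, by rw [mul_comm]; exact this⟩, Dvd.intro _ rfl, hp.ne'⟩
  · rintro ⟨n, d⟩ h
    simp only [mem_sigma, mem_Icc, Nat.mem_divisors] at h ⊢
    simp [Nat.mul_div_cancel' h.2.1]
  · rintro ⟨d, m⟩ h
    simp only [mem_sigma, mem_Icc] at h ⊢
    simp [Nat.mul_div_cancel_left m h.1.1]
  · rintro ⟨n, d⟩ h
    simp only [mem_sigma, mem_Icc, Nat.mem_divisors] at h ⊢
    simp [Nat.mul_div_cancel' h.2.1]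

/-- Summing against `log` through the identity `log = Λ * 1`. -/
lemma sum_log_mul_eq (W : ℕ → ℝ) (N : ℕ) :
    ∑ n ∈ Icc 1 N, Real.log n * W n =
      ∑ d ∈ Icc 1 N, Λ d * ∑ m ∈ Icc 1 (N / d), W (d * m) := by
  have := sum_divisors_eq_sum_sum (fun d n => Λ d * W n) N
  simp only [← Finset.sum_mul, ArithmeticFunction.vonMangoldt_sum, ← Finset.mul_sum] at this
  exact this

lemma Icc_one_eq_Ioc_zero (N : ℕ) : Icc 1 N = Ioc 0 N := rfl

lemma psi_eq_sum (N : ℕ) : Chebyshev.psi N = ∑ d ∈ Icc 1 N, Λ d := by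
  simp [Chebyshev.psi, Icc_one_eq_Ioc_zero]

lemma sum_vonMangoldt_le (N : ℕ) : ∑ d ∈ Icc 1 N, Λ d ≤ 6 * N := by
  rw [← psi_eq_sum]
  have h := Chebyshev.psi_le_const_mul_self (x := N) (Nat.cast_nonneg N)
  have : Real.log 4 ≤ 2 := by
    rw [show (4 : ℝ) = 2 ^ 2 by norm_num, Real.log_pow]
    have := Real.log_two_lt_d9; push_cast; linarith
  have hN : (0 : ℝ) ≤ N := Nat.cast_nonneg N
  nlinarith

lemma le_sum_vonMangoldt {N : ℕ} (hN : 20 ≤ N) : (N : ℝ) / 4 ≤ ∑ d ∈ Icc 1 N, Λ d := by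
  rw [← psi_eq_sum]
  have h := Chebyshev.psi_ge N
  have h2 := Real.log_two_gt_d9
  have hN' : (20 : ℝ) ≤ N := by exact_mod_cast hN
  have h3 : Real.log (N + 1) ≤ (N + 1) / 8 - 1 + 3 * 0.6931471808 := by
    have h8 : Real.log (N + 1) = Real.log ((N + 1) / 8) + 3 * Real.log 2 := by
      rw [Real.log_div (by positivity) (by norm_num), show (8 : ℝ) = 2 ^ 3 by norm_num,
        Real.log_pow]; push_cast; ring
    have := Real.log_le_sub_one_of_pos (x := ((N : ℝ) + 1) / 8) (by positivity)
    have := Real.log_two_lt_d9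
    linarith
  nlinarith

lemma sum_inv_le (N : ℕ) : ∑ n ∈ Icc 1 N, (1 : ℝ) / n ≤ 1 + Real.log N := by
  have := harmonic_le_one_add_log N
  rw [harmonic_eq_sum_Icc] at this
  push_cast at this
  simpa [one_div] using this

lemma log_le_sum_inv (N : ℕ) : Real.log N ≤ ∑ n ∈ Icc 1 N, (1 : ℝ) / n := by
  have := log_add_one_le_harmonic N
  rw [harmonic_eq_sum_Icc] at this
  push_cast at this
  rcases Nat.eq_zero_or_pos N with rfl | h
  · simp
  · have h2 : Real.log N ≤ Real.log (N + 1) :=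
      Real.log_le_log (by exact_mod_cast h) (by linarith)
    simpa [one_div] using h2.trans this

lemma sum_vonMangoldt_mul_le {f : ℕ → ℝ} {M : ℕ} (hf : ∀ m, 1 ≤ m → m ≤ M → 0 ≤ f m)
    (hanti : ∀ m, 1 ≤ m → m + 1 ≤ M → f (m + 1) ≤ f m) :
    ∑ d ∈ Icc 1 M, Λ d * f d ≤ 6 * ∑ d ∈ Icc 1 M, f d := by
  rw [Finset.mul_sum]
  refine sum_mul_le_sum_mul_of_antitone (h := fun _ => 6) (fun k _ _ => ?_) hf hanti
  have := sum_vonMangoldt_le k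
  simp only [sum_const, Nat.card_Icc, nsmul_eq_mul]
  simpa [mul_comm] using this

lemma sum_vonMangoldt_div_le (N : ℕ) : ∑ d ∈ Icc 1 N, Λ d / d ≤ 6 * (1 + Real.log N) := by
  have := sum_vonMangoldt_mul_le (f := fun m => (1 : ℝ) / m) (M := N)
    (fun m _ _ => by positivity) (fun m h _ => by
      have : (0 : ℝ) < m := by exact_mod_cast h
      push_cast
      exact one_div_le_one_div_of_le this (by linarith))
  simp only [mul_one_div] at this
  exact this.trans (mul_le_mul_of_nonneg_left (sum_inv_le N) (by norm_num))

lemma exists_sum_not_prime_vonMangoldt_div_le :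
    ∃ C : ℝ, 0 ≤ C ∧ ∀ N : ℕ, ∑ d ∈ Icc 1 N, (if d.Prime then 0 else Λ d) / d ≤ C := by
  obtain ⟨C₀, hC₀⟩ := Chebyshev.psi_sub_theta_le_mul_sqrt
  set C := max C₀ 0
  have hC0 : 0 ≤ C := le_max_right _ _
  have hsum : Summable fun n : ℕ => 1 / (n : ℝ) ^ (3 / 2 : ℝ) :=
    Real.summable_one_div_nat_rpow.2 (by norm_num)
  refine ⟨C * ∑' n : ℕ, 1 / (n : ℝ) ^ (3 / 2 : ℝ), mul_nonneg hC0
    (tsum_nonneg fun n => by positivity), fun N => ?_⟩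
  have h1 : ∑ d ∈ Icc 1 N, (if d.Prime then 0 else Λ d) * (1 / (d : ℝ)) ≤
      ∑ d ∈ Icc 1 N, (C * (1 / √(d : ℝ))) * (1 / (d : ℝ)) := by
    refine sum_mul_le_sum_mul_of_antitone (fun k hk _ => ?_) (fun m _ _ => by positivity)
      (fun m h _ => ?_)
    · have e : ∑ d ∈ Icc 1 k, (if d.Prime then 0 else Λ d) =
          Chebyshev.psi k - Chebyshev.theta k := by
        rw [Chebyshev.psi_sub_theta_eq_sum_not_prime]
        simp [Icc_one_eq_Ioc_zero, Finset.sum_filter]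
      rw [e]
      refine (hC₀ k).trans ((mul_le_mul_of_nonneg_right (le_max_left C₀ 0) (by positivity)).trans ?_)
      rw [← Finset.mul_sum]
      refine mul_le_mul_of_nonneg_left ?_ hC0
      have hk' : (0 : ℝ) < k := by exact_mod_cast hk
      calc √(k : ℝ) = ∑ d ∈ Icc 1 k, 1 / √(k : ℝ) := by
            have := Real.mul_self_sqrt hk'.le
            have h0 : √(k : ℝ) ≠ 0 := by positivity
            simp only [sum_const, Nat.card_Icc, nsmul_eq_mul, Nat.add_sub_cancel]
            field_simp
            nlinarith
        _ ≤ _ := by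
            refine Finset.sum_le_sum fun d hd => ?_
            rw [mem_Icc] at hd
            have : (0 : ℝ) < d := by exact_mod_cast hd.1
            refine one_div_le_one_div_of_le (by positivity) (Real.sqrt_le_sqrt ?_)
            exact_mod_cast hd.2
    · have : (0 : ℝ) < m := by exact_mod_cast h
      push_cast
      exact one_div_le_one_div_of_le this (by linarith)
  simp only [mul_one_div] at h1
  refine h1.trans ?_
  have h2 : ∀ d ∈ Icc 1 N, C / √(d : ℝ) / d = C * (1 / (d : ℝ) ^ (3 / 2 : ℝ)) := by
    intro d hd
    rw [mem_Icc] at hd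
    have : (0 : ℝ) < d := by exact_mod_cast hd.1
    rw [show (3 / 2 : ℝ) = 1 / 2 + 1 by norm_num, Real.rpow_add this, Real.rpow_one,
      ← Real.sqrt_eq_rpow, div_div, mul_one_div]
  rw [Finset.sum_congr rfl h2, ← Finset.mul_sum]
  exact mul_le_mul_of_nonneg_left (hsum.sum_le_tsum _ fun n _ => by positivity) hC0

/-- The number `n` has all its prime factors at most `q`. -/
def HasSmallFactors (q n : ℕ) : Prop := ∀ p ∈ n.primeFactors, p ≤ q

lemma hasSmallFactors_mul {q m n : ℕ} (hm : m ≠ 0) (hn : n ≠ 0) :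
    HasSmallFactors q (m * n) ↔ HasSmallFactors q m ∧ HasSmallFactors q n := by
  simp only [HasSmallFactors, Nat.primeFactors_mul hm hn, mem_union]
  exact ⟨fun h => ⟨fun p hp => h p (.inl hp), fun p hp => h p (.inr hp)⟩,
    fun h p hp => hp.elim (h.1 p) (h.2 p)⟩

lemma hasSmallFactors_of_le {q n : ℕ} (h : n ≤ q) : HasSmallFactors q n :=
  fun _ hp => (Nat.le_of_mem_primeFactors hp).trans h

lemma exists_sum_smooth_vonMangoldt_div_le :
    ∃ C : ℝ, 0 < C ∧ ∀ q N : ℕ, 2 ≤ q →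
      ∑ d ∈ Icc 1 N, (if HasSmallFactors q d then Λ d / d else 0) ≤ C * Real.log q := by
  obtain ⟨C, hC, h⟩ := exists_sum_not_prime_vonMangoldt_div_le
  refine ⟨6 + (6 + C) / Real.log 2, by have := Real.log_pos one_lt_two; positivity,
    fun q N hq => ?_⟩
  have hl2 := Real.log_pos one_lt_two
  have hlq : Real.log 2 ≤ Real.log q := Real.log_le_log (by norm_num) (by exact_mod_cast hq)
  have h1 : ∀ d ∈ Icc 1 N, (if HasSmallFactors q d then Λ d / d else 0) ≤
      (if d ≤ q then Λ d / d else 0) + (if d.Prime then 0 else Λ d) / d := by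
    intro d hd
    have h0 : 0 ≤ Λ d / d := div_nonneg ArithmeticFunction.vonMangoldt_nonneg (Nat.cast_nonneg _)
    by_cases hp : d.Prime
    · by_cases hs : HasSmallFactors q d
      · have : d ≤ q := hs d (by simp [hp])
        simp [this, hs, hp]
      · simp only [hs, hp, if_true, if_false]; split_ifs <;> simp [h0]
    · simp only [hp, if_false]
      split_ifs <;> linarith
  have h2 : ∑ d ∈ Icc 1 N, (if d ≤ q then Λ d / d else 0) ≤ ∑ d ∈ Icc 1 q, Λ d / d := by
    rw [← Finset.sum_filter]
    refine Finset.sum_le_sum_of_subset_of_nonneg ?_ fun d _ _ =>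
      div_nonneg ArithmeticFunction.vonMangoldt_nonneg (Nat.cast_nonneg _)
    intro d hd
    simp only [mem_filter, mem_Icc] at hd ⊢
    exact ⟨hd.1.1, hd.2⟩
  have h3 := Finset.sum_le_sum h1
  rw [Finset.sum_add_distrib] at h3
  have h4 := sum_vonMangoldt_div_le q
  have h5 := h N
  have h6 : 6 + C ≤ (6 + C) / Real.log 2 * Real.log q := by
    rw [div_mul_eq_mul_div, le_div_iff₀ hl2]
    exact mul_le_mul_of_nonneg_left hlq (by positivity)
  linarith

/-- The sum of the reciprocals of the `q`-smooth numbers is `O(log q)`. -/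
lemma exists_sum_smooth_inv_le :
    ∃ C : ℝ, 0 < C ∧ ∀ q N : ℕ, 2 ≤ q →
      ∑ m ∈ Icc 1 N, (if HasSmallFactors q m then (1 : ℝ) / m else 0) ≤ C * Real.log q := by
  obtain ⟨C, hC, h⟩ := exists_sum_smooth_vonMangoldt_div_le
  obtain ⟨k, hk⟩ := exists_nat_ge (2 * C)
  have hl2 := Real.log_pos one_lt_two
  refine ⟨2 * (1 / Real.log 2 + k), by positivity, fun q N hq => ?_⟩
  have hlq : Real.log 2 ≤ Real.log q := Real.log_le_log (by norm_num) (by exact_mod_cast hq)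
  have hlq0 : 0 < Real.log q := hl2.trans_le hlq
  set A := ∑ m ∈ Icc 1 N, (if HasSmallFactors q m then (1 : ℝ) / m else 0) with hA
  have hA0 : 0 ≤ A := Finset.sum_nonneg fun m _ => by split_ifs <;> positivity
  have hlog : ∑ m ∈ Icc 1 N, Real.log m * (if HasSmallFactors q m then (1 : ℝ) / m else 0) ≤
      C * Real.log q * A := by
    rw [sum_log_mul_eq]
    refine le_trans ?_ (mul_le_mul_of_nonneg_right (h q N hq) hA0)
    rw [Finset.sum_mul]
    refine Finset.sum_le_sum fun d hd => ?_
    rw [mem_Icc] at hd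
    have hd0 : d ≠ 0 := by omega
    have e : ∑ m ∈ Icc 1 (N / d), (if HasSmallFactors q (d * m) then (1 : ℝ) / (d * m : ℕ) else 0) ≤
        (if HasSmallFactors q d then (1 : ℝ) / d else 0) * A := by
      calc _ = ∑ m ∈ Icc 1 (N / d), (if HasSmallFactors q d then (1 : ℝ) / d else 0) *
            (if HasSmallFactors q m then (1 : ℝ) / m else 0) := by
            refine Finset.sum_congr rfl fun m hm => ?_
            rw [mem_Icc] at hm
            rw [hasSmallFactors_mul hd0 (by omega)]
            by_cases h1 : HasSmallFactors q d <;> by_cases h2 : HasSmallFactors q m <;>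
              simp [h1, h2, mul_comm]
        _ ≤ _ := by
            rw [← Finset.mul_sum]
            refine mul_le_mul_of_nonneg_left ?_ (by split_ifs <;> positivity)
            refine Finset.sum_le_sum_of_subset_of_nonneg ?_ fun d _ _ => by
              split_ifs <;> positivity
            exact Finset.Icc_subset_Icc le_rfl (Nat.div_le_self _ _)
    calc _ ≤ Λ d * ((if HasSmallFactors q d then (1 : ℝ) / d else 0) * A) :=
          mul_le_mul_of_nonneg_left e ArithmeticFunction.vonMangoldt_nonneg
      _ = _ := by split_ifs <;> ring
  have hsplit : A ≤ ∑ n ∈ Icc 1 (q ^ k), (1 : ℝ) / n +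
      (1 / (2 * C * Real.log q)) * ∑ m ∈ Icc 1 N, Real.log m *
        (if HasSmallFactors q m then (1 : ℝ) / m else 0) := by
    have h1 : ∀ m ∈ Icc 1 N, (if HasSmallFactors q m then (1 : ℝ) / m else 0) ≤
        (if m ≤ q ^ k then (1 : ℝ) / m else 0) + (1 / (2 * C * Real.log q)) * (Real.log m *
        (if HasSmallFactors q m then (1 : ℝ) / m else 0)) := by
      intro m hm
      rw [mem_Icc] at hm
      have hm0 : (1 : ℝ) ≤ m := by exact_mod_cast hm.1
      have hlm := Real.log_nonneg hm0
      by_cases hs : HasSmallFactors q m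
      · simp only [hs, if_true]
        by_cases hmk : m ≤ q ^ k
        · simp only [hmk, if_true]
          have : 0 ≤ 1 / (2 * C * Real.log q) * (Real.log m * (1 / (m : ℝ))) := by positivity
          linarith
        · simp only [hmk, if_false]
          have : 2 * C * Real.log q ≤ Real.log m := by
            refine (mul_le_mul_of_nonneg_right hk hlq0.le).trans ?_
            rw [← Real.log_pow]
            refine Real.log_le_log (by positivity) ?_
            push Not at hmk
            exact_mod_cast hmk.le
          have h2 : 1 ≤ 1 / (2 * C * Real.log q) * Real.log m := by
            rw [one_div_mul_eq_div, le_div_iff₀ (by positivity)]; linarith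
          rw [zero_add, ← mul_assoc]
          exact le_mul_of_one_le_left (by positivity) h2
      · simp only [hs, if_false, mul_zero, add_zero]
        split_ifs <;> positivity
    have h2 := Finset.sum_le_sum h1
    rw [Finset.sum_add_distrib, ← Finset.mul_sum] at h2
    refine h2.trans (add_le_add ?_ le_rfl)
    rw [← Finset.sum_filter]
    refine Finset.sum_le_sum_of_subset_of_nonneg ?_ fun d _ _ => by positivity
    intro d hd
    simp only [mem_filter, mem_Icc] at hd ⊢
    exact ⟨hd.1.1, hd.2⟩
  have h3 := sum_inv_le (q ^ k)
  push_cast at h3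
  rw [Real.log_pow] at h3
  have h4 : (1 / (2 * C * Real.log q)) * ∑ m ∈ Icc 1 N, Real.log m *
        (if HasSmallFactors q m then (1 : ℝ) / m else 0) ≤ A / 2 := by
    refine (mul_le_mul_of_nonneg_left hlog (by positivity)).trans (le_of_eq ?_)
    field_simp
  have h5 : 1 ≤ 1 / Real.log 2 * Real.log q := by
    rw [one_div_mul_eq_div, le_div_iff₀ hl2]; linarith
  linarith

lemma abs_card_residue_sub_le (K q : ℕ) (hq : 0 < q) (v : ZMod q) :
    |(((Icc 1 K).filter (fun m : ℕ => (m : ZMod q) = v)).card : ℝ) - K / q| ≤ 1 := by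
  have : NeZero q := ⟨hq.ne'⟩
  obtain ⟨w, rfl⟩ : ∃ w : ℕ, (w : ZMod q) = v := ⟨v.val, ZMod.natCast_zmod_val v⟩
  have h := Nat.Ioc_filter_modEq_card 0 K hq w
  have e : (Icc 1 K).filter (fun m : ℕ => (m : ZMod q) = (w : ZMod q)) =
      {x ∈ Ioc 0 K | x ≡ w [MOD q]} := by
    rw [Icc_one_eq_Ioc_zero]
    exact Finset.filter_congr fun x _ => ZMod.natCast_eq_natCast_iff x w q
  rw [e]
  have h' : ((#{x ∈ Ioc 0 K | x ≡ w [MOD q]} : ℤ) : ℝ) =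
    ((max (⌊((K : ℚ) - w) / q⌋ - ⌊(((0 : ℕ) : ℚ) - w) / q⌋) 0 : ℤ) : ℝ) := by rw [h]
  have hq' : (0 : ℚ) < q := by exact_mod_cast hq
  have hle : ⌊(((0 : ℕ) : ℚ) - w) / q⌋ ≤ ⌊((K : ℚ) - w) / q⌋ := by
    apply Int.floor_le_floor
    have : (((0 : ℕ) : ℚ)) ≤ K := by positivity
    gcongr
  rw [max_eq_left (by linarith)] at h'
  have a1 := Int.floor_le (((K : ℚ) - w) / q)
  have a2 := Int.lt_floor_add_one (((K : ℚ) - w) / q)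
  have a3 := Int.floor_le ((((0 : ℕ) : ℚ) - w) / q)
  have a4 := Int.lt_floor_add_one ((((0 : ℕ) : ℚ) - w) / q)
  set A := ⌊((K : ℚ) - w) / q⌋
  set B := ⌊(((0 : ℕ) : ℚ) - w) / q⌋
  have e2 : ((K : ℚ) - w) / q - (((0 : ℕ) : ℚ) - w) / q = K / q := by push_cast; ring
  have b1 : ((A - B : ℤ) : ℚ) - K / q ≤ 1 := by push_cast; linarith
  have b2 : -1 ≤ ((A - B : ℤ) : ℚ) - K / q := by push_cast; linarith
  have c1 := (Rat.cast_le (K := ℝ)).2 b1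
  have c2 := (Rat.cast_le (K := ℝ)).2 b2
  rw [abs_le]
  push_cast at h' c1 c2 ⊢
  rw [h']
  exact ⟨c2, c1⟩

lemma card_dvd_residue (N q d : ℕ) (hd : 0 < d) (hdq : d.Coprime q) (u : ZMod q) :
    ((Icc 1 N).filter (fun n : ℕ => (n : ZMod q) = u ∧ d ∣ n)).card =
      ((Icc 1 (N / d)).filter (fun m : ℕ =>
        (m : ZMod q) = ((ZMod.unitOfCoprime d hdq)⁻¹ : (ZMod q)ˣ) * u)).card := by
  symm
  refine Finset.card_nbij' (fun m => d * m) (fun n => n / d) ?_ ?_ ?_ ?_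
  · intro m hm
    simp only [coe_filter, mem_Icc, Set.mem_ofPred_eq] at hm ⊢
    obtain ⟨⟨h1, h2⟩, h3⟩ := hm
    refine ⟨⟨Nat.mul_pos hd h1, ?_⟩, ?_, Dvd.intro _ rfl⟩
    · rw [mul_comm]; exact (Nat.le_div_iff_mul_le hd).1 h2
    · rw [Nat.cast_mul, h3, ← ZMod.coe_unitOfCoprime d hdq, Units.mul_inv_cancel_left]
  · intro n hn
    simp only [coe_filter, mem_Icc, Set.mem_ofPred_eq] at hn ⊢
    obtain ⟨⟨h1, h2⟩, h3, h4⟩ := hn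
    refine ⟨⟨Nat.div_pos (Nat.le_of_dvd h1 h4) hd, Nat.div_le_div_right h2⟩, ?_⟩
    rw [← h3]
    conv_rhs => rw [← Nat.mul_div_cancel' h4, Nat.cast_mul, ← ZMod.coe_unitOfCoprime d hdq,
      Units.inv_mul_cancel_left]
  · intro m hm
    simp [Nat.mul_div_cancel_left m hd]
  · intro n hn
    simp only [coe_filter, mem_Icc, Set.mem_ofPred_eq] at hn ⊢
    exact Nat.mul_div_cancel' hn.2.2

lemma abs_card_dvd_residue_sub_le (N q d : ℕ) (hq : 0 < q) (hd : 0 < d) (hdq : d.Coprime q)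
    (u : ZMod q) :
    |(((Icc 1 N).filter (fun n : ℕ => (n : ZMod q) = u ∧ d ∣ n)).card : ℝ) - N / q * (1 / d)| ≤
      2 := by
  rw [card_dvd_residue N q d hd hdq u]
  have h := abs_card_residue_sub_le (N / d) q hq (((ZMod.unitOfCoprime d hdq)⁻¹ : (ZMod q)ˣ) * u)
  set c := (((Icc 1 (N / d)).filter (fun m : ℕ =>
        (m : ZMod q) = ((ZMod.unitOfCoprime d hdq)⁻¹ : (ZMod q)ˣ) * u)).card : ℝ)
  have hd' : (0 : ℝ) < d := by exact_mod_cast hd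
  have hq' : (1 : ℝ) ≤ q := by exact_mod_cast hq
  have h1 : ((N / d : ℕ) : ℝ) ≤ N / d := Nat.cast_div_le
  have h2 : (N : ℝ) / d ≤ (N / d : ℕ) + 1 := by
    rw [div_le_iff₀ hd']
    have := Nat.lt_div_mul_add hd (a := N)
    have h3 : (N : ℝ) ≤ (N / d : ℕ) * d + d := by exact_mod_cast this.le
    linarith
  have e : (N : ℝ) / q * (1 / d) = N / d / q := by field_simp
  rw [e]
  have h3 : ((N / d : ℕ) : ℝ) / q ≤ N / d / q := by gcongr
  have h4 : (N : ℝ) / d / q ≤ (N / d : ℕ) / q + 1 := by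
    have : (N : ℝ) / d / q ≤ ((N / d : ℕ) + 1) / q := by gcongr
    refine this.trans ?_
    rw [add_div]
    have : 1 / (q : ℝ) ≤ 1 := by rw [div_le_one (by linarith)]; exact hq'
    linarith
  rw [abs_le] at h ⊢
  constructor <;> linarith [h.1, h.2]

section Selberg

variable (D : Finset ℕ)

/-- The normalising factor of the Selberg weights supported on `D`. -/
noncomputable def selbergMass : ℝ := ∑ d ∈ D, 1 / (d.totient : ℝ)

/-- Selberg's weights supported on the finite set `D`. -/
noncomputable def selbergWeight (d : ℕ) : ℝ :=
  ArithmeticFunction.moebius d * d / selbergMass D *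
    ∑ k ∈ D with d ∣ k, 1 / (k.totient : ℝ)

variable {D}

lemma selbergMass_pos (h1 : 1 ∈ D) : 0 < selbergMass D := by
  have : (1 : ℝ) / (Nat.totient 1 : ℝ) ≤ selbergMass D :=
    Finset.single_le_sum (f := fun d : ℕ => 1 / (d.totient : ℝ)) (fun d _ => by positivity) h1
  simp only [Nat.totient_one, Nat.cast_one, div_one] at this
  linarith

lemma selbergWeight_one (h1 : 1 ∈ D) : selbergWeight D 1 = 1 := by
  have := selbergMass_pos h1
  simp only [selbergWeight, one_dvd, filter_true]
  simp only [ArithmeticFunction.moebius_apply_one, Int.cast_one, Nat.cast_one, one_mul]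
  rw [← selbergMass, one_div_mul_cancel this.ne']

lemma abs_selbergWeight_le (h1 : 1 ∈ D) (d : ℕ) : |selbergWeight D d| ≤ d := by
  have hL := selbergMass_pos h1
  have hs : ∑ k ∈ D with d ∣ k, 1 / (k.totient : ℝ) ≤ selbergMass D :=
    Finset.sum_le_sum_of_subset_of_nonneg (Finset.filter_subset _ _) fun _ _ _ => by positivity
  have hs0 : 0 ≤ ∑ k ∈ D with d ∣ k, 1 / (k.totient : ℝ) :=
    Finset.sum_nonneg fun _ _ => by positivity
  have hmu : |(ArithmeticFunction.moebius d : ℝ)| ≤ 1 := by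
    exact_mod_cast ArithmeticFunction.abs_moebius_le_one
  rw [selbergWeight, abs_mul, abs_div, abs_mul, abs_of_pos hL, abs_of_nonneg hs0, Nat.abs_cast,
    div_mul_eq_mul_div, div_le_iff₀ hL]
  exact mul_le_mul (mul_le_of_le_one_left (Nat.cast_nonneg _) hmu) hs hs0 (Nat.cast_nonneg _)

lemma sum_moebius_between {k j : ℕ} (hj : Squarefree j) :
    ∑ d ∈ j.divisors with k ∣ d, (ArithmeticFunction.moebius d : ℝ) =
      if k = j then (ArithmeticFunction.moebius k : ℝ) else 0 := by
  have hj0 : j ≠ 0 := hj.ne_zero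
  by_cases hk : k ∣ j
  · have hk0 : 0 < k := Nat.pos_of_dvd_of_pos hk (Nat.pos_of_ne_zero hj0)
    have e : ∑ d ∈ j.divisors with k ∣ d, (ArithmeticFunction.moebius d : ℝ) =
        ∑ e ∈ (j / k).divisors, (ArithmeticFunction.moebius (k * e) : ℝ) := by
      symm
      refine Finset.sum_nbij' (fun e => k * e) (fun d => d / k) ?_ ?_ ?_ ?_ ?_
      · intro e he
        simp only [mem_filter, Nat.mem_divisors] at he ⊢
        refine ⟨⟨?_, hj0⟩, Dvd.intro _ rfl⟩
        have := Nat.mul_dvd_mul_left k he.1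
        rwa [Nat.mul_div_cancel' hk] at this
      · intro d hd
        simp only [mem_filter, Nat.mem_divisors] at hd ⊢
        exact ⟨Nat.div_dvd_div hd.2 hd.1.1, (Nat.div_pos (Nat.le_of_dvd
          (Nat.pos_of_ne_zero hj0) hk) hk0).ne'⟩
      · intro e _
        exact Nat.mul_div_cancel_left e hk0
      · intro d hd
        simp only [mem_filter, Nat.mem_divisors] at hd ⊢
        exact Nat.mul_div_cancel' hd.2
      · intro e _
        rfl
    rw [e]
    have e2 : ∀ e ∈ (j / k).divisors, (ArithmeticFunction.moebius (k * e) : ℝ) =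
        ArithmeticFunction.moebius k * ArithmeticFunction.moebius e := by
      intro e he
      have hdvd : k * e ∣ j := by
        have := Nat.mul_dvd_mul_left k (Nat.dvd_of_mem_divisors he)
        rwa [Nat.mul_div_cancel' hk] at this
      have hcop : k.Coprime e := Nat.coprime_of_squarefree_mul (hj.squarefree_of_dvd hdvd)
      rw [ArithmeticFunction.isMultiplicative_moebius.map_mul_of_coprime hcop]
      push_cast; ring
    rw [Finset.sum_congr rfl e2, ← Finset.mul_sum]
    have h3 : ∑ e ∈ (j / k).divisors, (ArithmeticFunction.moebius e : ℝ) =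
        if j / k = 1 then 1 else 0 := by
      have := congrArg (fun f : ArithmeticFunction ℤ => f (j / k))
        ArithmeticFunction.coe_zeta_mul_moebius
      simp only [ArithmeticFunction.coe_zeta_mul_apply, ArithmeticFunction.one_apply] at this
      exact_mod_cast this
    rw [h3]
    have h4 : j / k = 1 ↔ k = j := by
      rw [Nat.div_eq_iff_eq_mul_left hk0 hk, one_mul, eq_comm]
    simp [h4]
  · rw [if_neg (by rintro rfl; exact hk dvd_rfl)]
    refine Finset.sum_eq_zero fun d hd => ?_
    simp only [mem_filter, Nat.mem_divisors] at hd
    exact absurd (hd.2.trans hd.1.1) hk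

lemma sum_selbergWeight_div (hD : ∀ d ∈ D, Squarefree d) (hdiv : ∀ d ∈ D, ∀ e, e ∣ d → e ∈ D)
    {k : ℕ} (hk : k ∈ D) :
    ∑ d ∈ D with k ∣ d, selbergWeight D d / d =
      ArithmeticFunction.moebius k / (selbergMass D * k.totient) := by
  have h1 : ∀ d ∈ D.filter (k ∣ ·), selbergWeight D d / d =
      ∑ j ∈ D, if d ∣ j then (ArithmeticFunction.moebius d : ℝ) *
        (1 / selbergMass D * (1 / (j.totient : ℝ))) else 0 := by
    intro d hd
    have hd0 : (d : ℝ) ≠ 0 := by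
      have := (hD d (mem_filter.1 hd).1).ne_zero
      exact_mod_cast this
    rw [selbergWeight, ← Finset.sum_filter, ← Finset.mul_sum, ← Finset.mul_sum]
    field_simp
  rw [Finset.sum_congr rfl h1, Finset.sum_comm]
  have h2 : ∀ j ∈ D, (∑ d ∈ D with k ∣ d, if d ∣ j then (ArithmeticFunction.moebius d : ℝ) *
        (1 / selbergMass D * (1 / (j.totient : ℝ))) else 0) =
      if k = j then (ArithmeticFunction.moebius k : ℝ) *
        (1 / selbergMass D * (1 / (j.totient : ℝ))) else 0 := by
    intro j hj
    have h3 := sum_moebius_between (k := k) (hD j hj)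
    rw [← Finset.sum_filter, ← Finset.sum_mul]
    have e : (D.filter (k ∣ ·)).filter (· ∣ j) = j.divisors.filter (k ∣ ·) := by
      ext d
      simp only [mem_filter, Nat.mem_divisors]
      exact ⟨fun h => ⟨⟨h.2, (hD j hj).ne_zero⟩, h.1.2⟩,
        fun h => ⟨⟨hdiv j hj d h.1.1, h.2⟩, h.1.1⟩⟩
    rw [e, h3]
    split_ifs <;> simp
  rw [Finset.sum_congr rfl h2, Finset.sum_ite_eq, if_pos hk]
  ring

lemma sum_sum_selbergWeight (h1 : 1 ∈ D) (hD : ∀ d ∈ D, Squarefree d)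
    (hdiv : ∀ d ∈ D, ∀ e, e ∣ d → e ∈ D) :
    ∑ d ∈ D, ∑ e ∈ D, selbergWeight D d * selbergWeight D e * (1 / (d.lcm e : ℝ)) =
      1 / selbergMass D := by
  have hL := selbergMass_pos h1
  have e1 : ∀ d ∈ D, ∀ e ∈ D, selbergWeight D d * selbergWeight D e * (1 / (d.lcm e : ℝ)) =
      ∑ k ∈ D, (k.totient : ℝ) * ((if k ∣ d then selbergWeight D d / d else 0) *
        (if k ∣ e then selbergWeight D e / e else 0)) := by
    intro d hd e he
    have hd0 : (d : ℝ) ≠ 0 := by exact_mod_cast (hD d hd).ne_zero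
    have he0 : (e : ℝ) ≠ 0 := by exact_mod_cast (hD e he).ne_zero
    have hg : ((d.gcd e : ℕ) : ℝ) = ∑ k ∈ D, if k ∣ d ∧ k ∣ e then (k.totient : ℝ) else 0 := by
      rw [← Finset.sum_filter]
      have : D.filter (fun k => k ∣ d ∧ k ∣ e) = (d.gcd e).divisors := by
        ext k
        simp only [mem_filter, Nat.mem_divisors, Nat.dvd_gcd_iff]
        exact ⟨fun h => ⟨h.2, Nat.gcd_ne_zero_left (hD d hd).ne_zero⟩,
          fun h => ⟨hdiv d hd k h.1.1, h.1⟩⟩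
      rw [this]
      exact_mod_cast (Nat.sum_totient (d.gcd e)).symm
    have hl0 : ((d.lcm e : ℕ) : ℝ) ≠ 0 := by
      exact_mod_cast Nat.lcm_ne_zero (hD d hd).ne_zero (hD e he).ne_zero
    have hgl : ((d.gcd e : ℕ) : ℝ) * (d.lcm e : ℕ) = d * e := by
      exact_mod_cast Nat.gcd_mul_lcm d e
    have e2 : (1 / (d.lcm e : ℝ)) = (d.gcd e : ℕ) / (d * e) := by
      rw [← hgl]
      have : ((d.gcd e : ℕ) : ℝ) ≠ 0 := by
        exact_mod_cast Nat.gcd_ne_zero_left (hD d hd).ne_zero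
      field_simp
    rw [e2, hg, Finset.sum_div, Finset.mul_sum]
    refine Finset.sum_congr rfl fun k _ => ?_
    by_cases a1 : k ∣ d <;> by_cases a2 : k ∣ e <;> simp [a1, a2]
    field_simp
  have e3 : ∑ d ∈ D, ∑ e ∈ D, selbergWeight D d * selbergWeight D e * (1 / (d.lcm e : ℝ)) =
      ∑ k ∈ D, (k.totient : ℝ) * (∑ d ∈ D with k ∣ d, selbergWeight D d / d) ^ 2 := by
    rw [Finset.sum_congr rfl fun d hd => Finset.sum_congr rfl (e1 d hd)]
    simp_rw [sq, Finset.sum_filter, Finset.sum_mul_sum, Finset.mul_sum]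
    rw [Finset.sum_congr rfl fun d _ => Finset.sum_comm]
    rw [Finset.sum_comm]
  rw [e3]
  have e4 : ∀ k ∈ D, (k.totient : ℝ) * (∑ d ∈ D with k ∣ d, selbergWeight D d / d) ^ 2 =
      1 / selbergMass D ^ 2 * (1 / (k.totient : ℝ)) := by
    intro k hk
    rw [sum_selbergWeight_div hD hdiv hk]
    have hk0 : (k.totient : ℝ) ≠ 0 := by
      have := Nat.totient_pos.2 (Nat.pos_of_ne_zero (hD k hk).ne_zero)
      exact_mod_cast this.ne'
    have hmu : (ArithmeticFunction.moebius k : ℝ) ^ 2 = 1 := by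
      exact_mod_cast ArithmeticFunction.moebius_sq_eq_one_of_squarefree (hD k hk)
    rw [div_pow, hmu]
    field_simp
  rw [Finset.sum_congr rfl e4, ← Finset.mul_sum, ← selbergMass]
  field_simp

end Selberg

/-- The squarefree integers in `[1, z]` all of whose prime factors exceed `q`. -/
noncomputable def roughSquarefree (q z : ℕ) : Finset ℕ :=
  (Icc 1 z).filter (fun d => Squarefree d ∧ ∀ p ∈ d.primeFactors, q < p)

lemma coprime_of_forall_primeFactors_lt {q d : ℕ} (hq : 0 < q) (h : ∀ p ∈ d.primeFactors, q < p)
    (hd : d ≠ 0) : d.Coprime q :=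
  Nat.Coprime.symm <| Nat.coprime_of_dvd fun p hp hpq hpd =>
    absurd (h p (Nat.mem_primeFactors.2 ⟨hp, hpd, hd⟩)) (not_lt.2 (Nat.le_of_dvd hq hpq))

lemma one_mem_roughSquarefree {q z : ℕ} (hz : 1 ≤ z) : 1 ∈ roughSquarefree q z := by
  simp only [roughSquarefree, mem_filter, mem_Icc, Nat.primeFactors_one, notMem_empty]
  exact ⟨⟨le_rfl, hz⟩, squarefree_one, fun _ h => h.elim⟩

lemma sum_abs_selbergWeight_le (q z : ℕ) (hz : 1 ≤ z) :
    ∑ d ∈ roughSquarefree q z, |selbergWeight (roughSquarefree q z) d| ≤ (z : ℝ) ^ 2 := by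
  have h1 := one_mem_roughSquarefree (q := q) hz
  calc _ ≤ ∑ d ∈ roughSquarefree q z, (z : ℝ) := Finset.sum_le_sum fun d hd => by
        refine (abs_selbergWeight_le h1 d).trans ?_
        simp only [roughSquarefree, mem_filter, mem_Icc] at hd
        exact_mod_cast hd.1.2
    _ ≤ ∑ d ∈ Icc 1 z, (z : ℝ) :=
        Finset.sum_le_sum_of_subset_of_nonneg (Finset.filter_subset _ _) fun _ _ _ => by positivity
    _ = (z : ℝ) ^ 2 := by simp [sq]

/-- Selberg's upper bound sieve for the primes in `(q, z]` in a residue class modulo `q`. -/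
lemma card_sifted_le (N q z : ℕ) (hq : 0 < q) (hz : 1 ≤ z) (u : ZMod q) :
    (((Icc 1 N).filter (fun n : ℕ => (n : ZMod q) = u ∧
      ∀ p, p.Prime → q < p → p ≤ z → ¬ p ∣ n)).card : ℝ) ≤
      N / q / selbergMass (roughSquarefree q z) + 2 * (z : ℝ) ^ 4 := by
  set D := roughSquarefree q z with hDdef
  have h1 : 1 ∈ D := one_mem_roughSquarefree hz
  have hmem : ∀ d ∈ D, 1 ≤ d ∧ d ≤ z ∧ Squarefree d ∧ ∀ p ∈ d.primeFactors, q < p := by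
    intro d hd
    simp only [hDdef, roughSquarefree, mem_filter, mem_Icc] at hd
    exact ⟨hd.1.1, hd.1.2, hd.2.1, hd.2.2⟩
  have hsq : ∀ d ∈ D, Squarefree d := fun d hd => (hmem d hd).2.2.1
  have hdiv : ∀ d ∈ D, ∀ e, e ∣ d → e ∈ D := by
    intro d hd e he
    obtain ⟨a1, a2, a3, a4⟩ := hmem d hd
    simp only [hDdef, roughSquarefree, mem_filter, mem_Icc]
    exact ⟨⟨Nat.pos_of_dvd_of_pos he a1, (Nat.le_of_dvd a1 he).trans a2⟩,
      a3.squarefree_of_dvd he, fun p hp => a4 p (Nat.primeFactors_mono he (by omega) hp)⟩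
  set lam := selbergWeight D
  set A := (Icc 1 N).filter (fun n : ℕ => (n : ZMod q) = u)
  have e1 : (((Icc 1 N).filter (fun n : ℕ => (n : ZMod q) = u ∧
      ∀ p, p.Prime → q < p → p ≤ z → ¬ p ∣ n)).card : ℝ) ≤
      ∑ n ∈ A, (∑ d ∈ D, if d ∣ n then lam d else 0) ^ 2 := by
    rw [← Finset.filter_filter, Finset.card_filter]
    push_cast
    refine Finset.sum_le_sum fun n _ => ?_
    split_ifs with h
    · have : ∀ d ∈ D, (if d ∣ n then lam d else 0) = if d = 1 then 1 else 0 := by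
        intro d hd
        by_cases hd1 : d = 1
        · simp [hd1, lam, selbergWeight_one h1]
        · rw [if_neg hd1, if_neg]
          intro hdn
          obtain ⟨p, hp, hpd⟩ := Nat.exists_prime_and_dvd hd1
          obtain ⟨a1, a2, a3, a4⟩ := hmem d hd
          exact h p hp (a4 p (Nat.mem_primeFactors.2 ⟨hp, hpd, by omega⟩))
            ((Nat.le_of_dvd a1 hpd).trans a2) (hpd.trans hdn)
      rw [Finset.sum_congr rfl this]
      simp [h1]
    · positivity
  have e2 : ∑ n ∈ A, (∑ d ∈ D, if d ∣ n then lam d else 0) ^ 2 =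
      ∑ d ∈ D, ∑ e ∈ D, lam d * lam e *
        (((Icc 1 N).filter (fun n : ℕ => (n : ZMod q) = u ∧ d.lcm e ∣ n)).card : ℝ) := by
    simp_rw [sq, Finset.sum_mul_sum]
    rw [Finset.sum_comm]
    refine Finset.sum_congr rfl fun d _ => ?_
    rw [Finset.sum_comm]
    refine Finset.sum_congr rfl fun e _ => ?_
    rw [← Finset.filter_filter, Finset.card_filter]
    push_cast
    rw [Finset.mul_sum]
    refine Finset.sum_congr rfl fun n _ => ?_
    by_cases a1 : d ∣ n <;> by_cases a2 : e ∣ n <;> simp [a1, a2, Nat.lcm_dvd_iff]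
  have e3 : ∀ d ∈ D, ∀ e ∈ D, lam d * lam e *
        (((Icc 1 N).filter (fun n : ℕ => (n : ZMod q) = u ∧ d.lcm e ∣ n)).card : ℝ) ≤
        N / q * (lam d * lam e * (1 / (d.lcm e : ℝ))) + 2 * (|lam d| * |lam e|) := by
    intro d hd e he
    have c1 := coprime_of_forall_primeFactors_lt hq (hmem d hd).2.2.2 (hsq d hd).ne_zero
    have c2 := coprime_of_forall_primeFactors_lt hq (hmem e he).2.2.2 (hsq e he).ne_zero
    have hl : (d.lcm e).Coprime q := Nat.Coprime.coprime_dvd_left (Nat.lcm_dvd_mul d e)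
      (Nat.Coprime.mul_left c1 c2)
    have h := abs_card_dvd_residue_sub_le N q (d.lcm e) hq
      (Nat.lcm_pos (hmem d hd).1 (hmem e he).1) hl u
    set c := (((Icc 1 N).filter (fun n : ℕ => (n : ZMod q) = u ∧ d.lcm e ∣ n)).card : ℝ)
    have : lam d * lam e * (c - N / q * (1 / (d.lcm e : ℝ))) ≤ |lam d| * |lam e| * 2 := by
      refine (le_abs_self _).trans ?_
      rw [abs_mul, abs_mul]
      gcongr
    linarith
  refine e1.trans (e2.le.trans ((Finset.sum_le_sum fun d hd => Finset.sum_le_sum (e3 d hd)).trans ?_))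
  simp_rw [Finset.sum_add_distrib, ← Finset.mul_sum]
  rw [sum_sum_selbergWeight h1 hsq hdiv]
  have hz2 := sum_abs_selbergWeight_le q z hz
  rw [← Finset.sum_mul]
  have h0 : 0 ≤ ∑ d ∈ D, |lam d| := Finset.sum_nonneg fun _ _ => abs_nonneg _
  have : (∑ d ∈ D, |lam d|) * (∑ d ∈ D, |lam d|) ≤ (z : ℝ) ^ 2 * (z : ℝ) ^ 2 := by gcongr
  have e5 : (N : ℝ) / q * (1 / selbergMass D) = N / q / selbergMass D := by ring
  rw [e5]
  nlinarith

lemma exists_smooth_mul_rough (q n : ℕ) (hn : n ≠ 0) :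
    ∃ m r, n = m * r ∧ HasSmallFactors q m ∧ ∀ p ∈ r.primeFactors, q < p := by
  induction n using induction_on_primes with
  | zero => exact absurd rfl hn
  | one => exact ⟨1, 1, rfl, by simp [HasSmallFactors], by simp⟩
  | prime_mul p n hp ih =>
    have hn0 : n ≠ 0 := right_ne_zero_of_mul hn
    obtain ⟨m, r, rfl, h1, h2⟩ := ih hn0
    have hm0 : m ≠ 0 := left_ne_zero_of_mul hn0
    have hr0 : r ≠ 0 := right_ne_zero_of_mul hn0
    by_cases hpq : p ≤ q
    · refine ⟨p * m, r, by ring, (hasSmallFactors_mul hp.ne_zero hm0).2 ⟨?_, h1⟩, h2⟩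
      simpa [HasSmallFactors, hp.primeFactors] using hpq
    · refine ⟨m, p * r, by ring, h1, ?_⟩
      rw [Nat.primeFactors_mul hp.ne_zero hr0, hp.primeFactors]
      intro l hl
      rcases mem_union.1 hl with hl | hl
      · rw [mem_singleton.1 hl]; omega
      · exact h2 l hl

lemma exists_smooth_mul_squarefree_mul_sq (q z n : ℕ) (hn : n ∈ Icc 1 z) :
    ∃ t ∈ ((Icc 1 z).filter (HasSmallFactors q)) ×ˢ (roughSquarefree q z ×ˢ Icc 1 z),
      t.1 * (t.2.1 * t.2.2 ^ 2) = n := by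
  rw [mem_Icc] at hn
  obtain ⟨m, r, rfl, h1, h2⟩ := exists_smooth_mul_rough q n (by omega)
  obtain ⟨d, s, rfl, hd⟩ := Nat.sq_mul_squarefree r
  have hpos : 0 < m * (s ^ 2 * d) := hn.1
  have hm : 0 < m := Nat.pos_of_mul_pos_right hpos
  have hr : 0 < s ^ 2 * d := Nat.pos_of_mul_pos_left hpos
  have hd0 : 0 < d := Nat.pos_of_mul_pos_left hr
  have hs : 0 < s := Nat.pos_of_ne_zero (by rintro rfl; simp at hr)
  have le1 : m ≤ z := (Nat.le_of_dvd hpos (Dvd.intro _ rfl)).trans hn.2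
  have le2 : d ≤ z := (Nat.le_of_dvd hpos ⟨m * s ^ 2, by ring⟩).trans hn.2
  have le3 : s ≤ z := (Nat.le_of_dvd hpos ⟨m * s * d, by ring⟩).trans hn.2
  refine ⟨(m, d, s), ?_, by ring⟩
  simp only [roughSquarefree, mem_product, mem_filter, mem_Icc]
  exact ⟨⟨⟨hm, le1⟩, h1⟩, ⟨⟨hd0, le2⟩, hd, fun p hp => h2 p
    (Nat.primeFactors_mono (Dvd.intro_left _ rfl) hr.ne' hp)⟩, hs, le3⟩

lemma sum_inv_le_prod_sum_inv (q z : ℕ) :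
    ∑ n ∈ Icc 1 z, (1 : ℝ) / n ≤
      (∑ m ∈ Icc 1 z, if HasSmallFactors q m then (1 : ℝ) / m else 0) *
        ((∑ d ∈ roughSquarefree q z, (1 : ℝ) / d) * ∑ s ∈ Icc 1 z, (1 : ℝ) / (s : ℝ) ^ 2) := by
  choose! g hg using fun n => exists_smooth_mul_squarefree_mul_sq q z n
  rw [← Finset.sum_filter, Finset.sum_mul_sum, ← Finset.sum_product', Finset.sum_mul_sum,
    ← Finset.sum_product']
  have hinj : Set.InjOn g (Icc 1 z) := fun a ha b hb hab => by
    rw [← (hg a ha).2, ← (hg b hb).2, hab]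
  calc ∑ n ∈ Icc 1 z, (1 : ℝ) / n = ∑ n ∈ Icc 1 z,
        (1 : ℝ) / (g n).1 * (1 / (g n).2.1 * (1 / ((g n).2.2 : ℝ) ^ 2)) := by
        refine Finset.sum_congr rfl fun n hn => ?_
        conv_lhs => rw [← (hg n hn).2]
        push_cast
        rw [one_div_mul_one_div, one_div_mul_one_div]
    _ = ∑ t ∈ (Icc 1 z).image g, (1 : ℝ) / t.1 * (1 / t.2.1 * (1 / (t.2.2 : ℝ) ^ 2)) := by
        rw [Finset.sum_image hinj]
    _ ≤ _ := Finset.sum_le_sum_of_subset_of_nonneg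
        (fun t ht => by
          obtain ⟨n, hn, rfl⟩ := mem_image.1 ht
          exact (hg n hn).1) fun _ _ _ => by positivity

lemma exists_mul_log_le_selbergMass :
    ∃ c : ℝ, 0 < c ∧ ∀ q z : ℕ, 2 ≤ q →
      c * (Real.log z / Real.log q) ≤ selbergMass (roughSquarefree q z) := by
  obtain ⟨C, hC, h⟩ := exists_sum_smooth_inv_le
  have hsum : Summable fun n : ℕ => 1 / (n : ℝ) ^ 2 :=
    Real.summable_one_div_nat_pow.2 (by norm_num)
  set S := ∑' n : ℕ, 1 / (n : ℝ) ^ 2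
  have hS0 : 0 < S := hsum.tsum_pos (fun _ => by positivity) 1 (by norm_num)
  refine ⟨1 / (C * S), by positivity, fun q z hq => ?_⟩
  have hlq : 0 < Real.log q := Real.log_pos (by exact_mod_cast hq)
  have h1 := (log_le_sum_inv z).trans (sum_inv_le_prod_sum_inv q z)
  have h2 : ∑ d ∈ roughSquarefree q z, (1 : ℝ) / d ≤ selbergMass (roughSquarefree q z) := by
    refine Finset.sum_le_sum fun d hd => ?_
    have hd1 : 0 < d := by
      simp only [roughSquarefree, mem_filter, mem_Icc] at hd
      exact hd.1.1
    have := Nat.totient_pos.2 hd1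
    have h3 := Nat.totient_le d
    gcongr
  have h3 : ∑ s ∈ Icc 1 z, (1 : ℝ) / (s : ℝ) ^ 2 ≤ S :=
    hsum.sum_le_tsum _ fun _ _ => by positivity
  have h4 : 0 ≤ selbergMass (roughSquarefree q z) :=
    Finset.sum_nonneg fun _ _ => by positivity
  have h5 : Real.log z ≤ C * Real.log q * (selbergMass (roughSquarefree q z) * S) := by
    refine h1.trans (mul_le_mul (h q z hq) (mul_le_mul h2 h3 ?_ h4) ?_ (by positivity))
    · exact Finset.sum_nonneg fun _ _ => by positivity
    · exact mul_nonneg (Finset.sum_nonneg fun _ _ => by positivity)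
        (Finset.sum_nonneg fun _ _ => by positivity)
  rw [div_mul_div_comm, one_mul, div_le_iff₀ (by positivity)]
  linarith

/-- Upper bound sieve with the explicit saving `log q / log z`. -/
lemma exists_card_sifted_le :
    ∃ C : ℝ, 0 < C ∧ ∀ N q z : ℕ, 2 ≤ q → 2 ≤ z → ∀ u : ZMod q,
      (((Icc 1 N).filter (fun n : ℕ => (n : ZMod q) = u ∧
        ∀ p, p.Prime → q < p → p ≤ z → ¬ p ∣ n)).card : ℝ) ≤
        C * (Real.log q / Real.log z) * (N / q) + 2 * (z : ℝ) ^ 4 := by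
  obtain ⟨c, hc, h⟩ := exists_mul_log_le_selbergMass
  refine ⟨1 / c, by positivity, fun N q z hq hz u => ?_⟩
  refine (card_sifted_le N q z (by omega) (by omega) u).trans ?_
  have hlq : 0 < Real.log q := Real.log_pos (by exact_mod_cast hq)
  have hlz : 0 < Real.log z := Real.log_pos (by exact_mod_cast hz)
  have h1 := h q z hq
  gcongr
  calc (N : ℝ) / q / selbergMass (roughSquarefree q z)
      ≤ N / q / (c * (Real.log z / Real.log q)) := by gcongr
    _ = _ := by field_simp

lemma card_primePow_le (S : Finset ℕ) (N : ℕ) :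
    ((Icc 1 N).filter (fun d => IsPrimePow d ∧ d.minFac ∈ S)).card ≤ S.card * Nat.log 2 N := by
  have : S.card * Nat.log 2 N = (S ×ˢ Icc 1 (Nat.log 2 N)).card := by simp
  rw [this]
  refine Finset.card_le_card_of_injOn (fun d => (d.minFac, d.factorization d.minFac)) ?_ ?_
  · intro d hd
    simp only [coe_filter, mem_Icc, Set.mem_ofPred_eq, coe_product, Set.mem_prod, mem_coe]
      at hd ⊢
    obtain ⟨⟨h1, h2⟩, h3, h4⟩ := hd
    have hp := Nat.minFac_prime h3.ne_one
    refine ⟨h4, (hp.dvd_iff_one_le_factorization (by omega)).1 (Nat.minFac_dvd d), ?_⟩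
    refine Nat.le_log_of_pow_le (by norm_num) (le_trans ?_ h2)
    calc 2 ^ d.factorization d.minFac ≤ d.minFac ^ d.factorization d.minFac :=
          Nat.pow_le_pow_left hp.two_le _
      _ = d := h3.minFac_pow_factorization_eq
  · intro d hd e he hde
    simp only [coe_filter, mem_Icc, Set.mem_ofPred_eq] at hd he
    simp only [Prod.mk.injEq] at hde
    rw [← hd.2.1.minFac_pow_factorization_eq, ← he.2.1.minFac_pow_factorization_eq, hde.2, hde.1]

lemma card_primeFactors_le_log (q : ℕ) (hq : q ≠ 0) : q.primeFactors.card ≤ Nat.log 2 q := by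
  refine Nat.le_log_of_pow_le (by norm_num) ?_
  calc 2 ^ q.primeFactors.card ≤ ∏ p ∈ q.primeFactors, p :=
        Finset.pow_card_le_prod _ _ _ fun p hp => (Nat.prime_of_mem_primeFactors hp).two_le
    _ ≤ q := Nat.le_of_dvd (Nat.pos_of_ne_zero hq) (Nat.prod_primeFactors_dvd q)

lemma sum_vonMangoldt_not_coprime_le (q M : ℕ) (hq : q ≠ 0) :
    ∑ d ∈ Icc 1 M, (if d.Coprime q then 0 else Λ d) ≤
      Nat.log 2 q * Nat.log 2 M * Real.log M := by
  calc ∑ d ∈ Icc 1 M, (if d.Coprime q then 0 else Λ d)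
      ≤ ∑ d ∈ (Icc 1 M).filter (fun d => IsPrimePow d ∧ d.minFac ∈ q.primeFactors),
          Real.log M := by
        rw [Finset.sum_filter]
        refine Finset.sum_le_sum fun d hd => ?_
        rw [mem_Icc] at hd
        have hM : 0 ≤ Real.log M := Real.log_natCast_nonneg M
        by_cases hc : d.Coprime q
        · rw [if_pos hc]; split_ifs <;> first | exact hM | rfl
        rw [if_neg hc]
        by_cases hp : IsPrimePow d
        · have hmem : d.minFac ∈ q.primeFactors := by
            have hmp := Nat.minFac_prime hp.ne_one
            rw [Nat.mem_primeFactors]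
            refine ⟨hmp, ?_, hq⟩
            by_contra h
            apply hc
            rw [← hp.minFac_pow_factorization_eq]
            exact Nat.Coprime.pow_left _ ((Nat.Prime.coprime_iff_not_dvd hmp).2 h)
          rw [if_pos ⟨hp, hmem⟩]
          exact ArithmeticFunction.vonMangoldt_le_log.trans
            (Real.log_le_log (by exact_mod_cast hd.1) (by exact_mod_cast hd.2))
        · rw [ArithmeticFunction.vonMangoldt_eq_zero_iff.2 hp]
          split_ifs <;> first | exact hM | rfl
    _ ≤ _ := by
        rw [Finset.sum_const, nsmul_eq_mul]
        refine mul_le_mul_of_nonneg_right ?_ (Real.log_natCast_nonneg M)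
        have := (card_primePow_le q.primeFactors M).trans
          (Nat.mul_le_mul_right _ (card_primeFactors_le_log q hq))
        exact_mod_cast this

lemma natLog_two_le_of_le_pow {n t b : ℕ} (hn : n ≠ 0) (h : n ≤ t ^ b) :
    (Nat.log 2 n : ℝ) ≤ b * (2 * Real.log t) := by
  have h1 : (2 : ℝ) ^ Nat.log 2 n ≤ (t : ℝ) ^ b := by
    exact_mod_cast (Nat.pow_log_le_self 2 hn).trans h
  have h2 := Real.log_le_log (by positivity) h1
  rw [Real.log_pow, Real.log_pow] at h2
  have h3 := Real.log_two_gt_d9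
  have h4 : (0 : ℝ) ≤ Nat.log 2 n := Nat.cast_nonneg _
  nlinarith

lemma exists_sum_vonMangoldt_not_coprime_le (b : ℕ) :
    ∃ t₀ : ℕ, ∀ t q M : ℕ, t₀ ≤ t → 1 ≤ q → q ≤ t ^ b → 1 ≤ M → M ≤ t ^ b →
      ∑ d ∈ Icc 1 M, (if d.Coprime q then 0 else Λ d) ≤ (t : ℝ) / 8 := by
  have h : ∀ᶠ t : ℕ in Filter.atTop, 4 * (b : ℝ) ^ 3 * Real.log t ^ 3 ≤ (t : ℝ) / 8 := by
    have h1 := (isLittleO_log_rpow_atTop (r := 1 / 3) (by norm_num)).pow (n := 3) (by norm_num)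
    have h2 := (h1.comp_tendsto tendsto_natCast_atTop_atTop).bound
      (c := 1 / (32 * ((b : ℝ) ^ 3 + 1))) (by positivity)
    filter_upwards [h2] with t ht
    simp only [Function.comp_apply, Real.norm_eq_abs] at ht
    have e : ((t : ℝ) ^ (1 / 3 : ℝ)) ^ 3 = t := by
      rw [← Real.rpow_natCast, ← Real.rpow_mul (by positivity)]; norm_num
    rw [e, Nat.abs_cast] at ht
    have h3 := (le_abs_self _).trans ht
    have h5 : 0 ≤ Real.log t ^ 3 := by have := Real.log_natCast_nonneg t; positivity
    have h6 : (32 * ((b : ℝ) ^ 3 + 1)) * (Real.log t ^ 3) ≤ t := by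
      rw [div_mul_eq_mul_div, one_mul, le_div_iff₀ (by positivity)] at h3
      linarith
    nlinarith
  obtain ⟨t₀, ht₀⟩ := Filter.eventually_atTop.1 h
  refine ⟨t₀, fun t q M ht hq hqb hM hMb => ?_⟩
  refine (sum_vonMangoldt_not_coprime_le q M (by omega)).trans (le_trans ?_ (ht₀ t ht))
  have h0 := Real.log_natCast_nonneg t
  have h1 := natLog_two_le_of_le_pow (by omega) hqb
  have h2 := natLog_two_le_of_le_pow (by omega) hMb
  have h3 : Real.log M ≤ b * Real.log t := by
    rw [← Real.log_pow]
    exact Real.log_le_log (by exact_mod_cast hM) (by exact_mod_cast hMb)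
  calc (Nat.log 2 q : ℝ) * Nat.log 2 M * Real.log M
      ≤ (b * (2 * Real.log t)) * (b * (2 * Real.log t)) * (b * Real.log t) := by
        have := Real.log_natCast_nonneg M
        gcongr
    _ = _ := by ring

lemma exists_le_sum_vonMangoldt_coprime (b : ℕ) :
    ∃ t₀ : ℕ, ∀ t q : ℕ, t₀ ≤ t → 1 ≤ q → q ≤ t ^ b →
      (t : ℝ) / 8 ≤ ∑ d ∈ Icc 1 t, (if d.Coprime q then Λ d else 0) := by
  obtain ⟨t₀, h⟩ := exists_sum_vonMangoldt_not_coprime_le (b + 1)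
  refine ⟨t₀ + 20, fun t q ht hq hqb => ?_⟩
  have ht1 : 1 ≤ t := by omega
  have h1 := h t q t (by omega) hq (hqb.trans (Nat.pow_le_pow_right ht1 (by omega))) ht1
    (Nat.le_self_pow (by omega) t)
  have h2 := le_sum_vonMangoldt (N := t) (by omega)
  have h3 : ∑ d ∈ Icc 1 t, Λ d = ∑ d ∈ Icc 1 t, (if d.Coprime q then Λ d else 0) +
      ∑ d ∈ Icc 1 t, (if d.Coprime q then 0 else Λ d) := by
    rw [← Finset.sum_add_distrib]
    refine Finset.sum_congr rfl fun d _ => ?_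
    split_ifs <;> simp
  linarith

lemma sum_inv_avoiding_ge (S : Finset ℕ) (hS : ∀ p ∈ S, p.Prime) (z : ℕ) :
    (∏ p ∈ S, (1 - 1 / (p : ℝ))) * ∑ m ∈ Icc 1 z, (1 : ℝ) / m ≤
      ∑ m ∈ Icc 1 z, if ∀ p ∈ S, ¬ p ∣ m then (1 : ℝ) / m else 0 := by
  induction S using Finset.induction_on with
  | empty => simp
  | insert p S hpS ih =>
    have hp := hS p (mem_insert_self p S)
    have hp1 : (1 : ℝ) ≤ p := by exact_mod_cast hp.one_lt.le
    have hp1' : 1 / (p : ℝ) ≤ 1 := by rw [div_le_one (by linarith)]; exact hp1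
    have ih := ih fun l hl => hS l (mem_insert_of_mem hl)
    rw [Finset.prod_insert hpS, mul_assoc]
    refine (mul_le_mul_of_nonneg_left ih (by linarith)).trans ?_
    set F := fun m : ℕ => if ∀ l ∈ S, ¬ l ∣ m then (1 : ℝ) / m else 0 with hF
    have hF0 : ∀ m, 0 ≤ F m := fun m => by simp only [hF]; split_ifs <;> positivity
    have hFp : ∀ m, F (p * m) = 1 / p * F m := by
      intro m
      have : (∀ l ∈ S, ¬ l ∣ p * m) ↔ ∀ l ∈ S, ¬ l ∣ m := by
        refine forall₂_congr fun l hl => not_congr ?_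
        have hl' := hS l (mem_insert_of_mem hl)
        rw [hl'.dvd_mul]
        refine or_iff_right fun h => hpS ?_
        rwa [← (Nat.prime_dvd_prime_iff_eq hl' hp).1 h]
      simp only [hF, this]
      split_ifs
      · push_cast; rw [one_div_mul_one_div]
      · simp
    have e : ∑ m ∈ Icc 1 z, F m = (∑ m ∈ Icc 1 z,
        if ∀ l ∈ insert p S, ¬ l ∣ m then (1 : ℝ) / m else 0) +
        ∑ m ∈ (Icc 1 z).filter (p ∣ ·), F m := by
      rw [Finset.sum_filter, ← Finset.sum_add_distrib]
      refine Finset.sum_congr rfl fun m _ => ?_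
      simp only [mem_insert, forall_eq_or_imp, hF]
      by_cases h1 : p ∣ m <;> by_cases h2 : ∀ l ∈ S, ¬ l ∣ m <;> simp [h1, h2]
    have e2 : ∑ m ∈ (Icc 1 z).filter (p ∣ ·), F m ≤ 1 / p * ∑ m ∈ Icc 1 z, F m := by
      rw [Finset.mul_sum]
      have : (Icc 1 z).filter (p ∣ ·) ⊆ (Icc 1 z).image (p * ·) := by
        intro m hm
        simp only [mem_filter, mem_Icc, mem_image] at hm ⊢
        obtain ⟨⟨h1, h2⟩, k, rfl⟩ := hm
        exact ⟨k, ⟨Nat.pos_of_mul_pos_left h1,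
          (Nat.le_mul_of_pos_left k hp.pos).trans h2⟩, rfl⟩
      refine (Finset.sum_le_sum_of_subset_of_nonneg this fun _ _ _ => hF0 _).trans ?_
      rw [Finset.sum_image fun a _ c _ h => Nat.eq_of_mul_eq_mul_left hp.pos h]
      simp only [hFp]
      rfl
    linarith

lemma sum_inv_coprime_ge (q z : ℕ) (hq : q ≠ 0) :
    (q.totient : ℝ) / q * Real.log z ≤
      ∑ m ∈ Icc 1 z, if m.Coprime q then (1 : ℝ) / m else 0 := by
  have h := sum_inv_avoiding_ge q.primeFactors (fun p hp => Nat.prime_of_mem_primeFactors hp) z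
  have e : (q.totient : ℝ) / q = ∏ p ∈ q.primeFactors, (1 - 1 / (p : ℝ)) := by
    have hq0 : (q : ℝ) ≠ 0 := by exact_mod_cast hq
    rw [div_eq_iff hq0, mul_comm]
    have := congrArg (Rat.cast : ℚ → ℝ) (Nat.totient_eq_mul_prod_factors q)
    push_cast at this
    simpa [one_div] using this
  have e2 : ∀ m : ℕ, (∀ p ∈ q.primeFactors, ¬ p ∣ m) ↔ m.Coprime q := by
    intro m
    rw [Nat.coprime_comm]
    refine ⟨fun h => Nat.coprime_of_dvd fun p hp hpq hpm =>
      h p (Nat.mem_primeFactors.2 ⟨hp, hpq, hq⟩) hpm, fun h p hp hpm => ?_⟩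
    exact Nat.not_coprime_of_dvd_of_dvd (Nat.prime_of_mem_primeFactors hp).one_lt
      (Nat.dvd_of_mem_primeFactors hp) hpm h
  simp only [e2, ← e] at h
  exact (mul_le_mul_of_nonneg_left (log_le_sum_inv z) (by positivity)).trans h

/-- The indicator function of the `Y`-smooth integers coprime to `q`. -/
noncomputable def smoothInd (Y q n : ℕ) : ℝ :=
  if HasSmallFactors Y n ∧ n.Coprime q then 1 else 0

/-- The number of `Y`-smooth integers in `[1, N]` coprime to `q`. -/
noncomputable def smoothCount (Y q N : ℕ) : ℝ := ∑ n ∈ Icc 1 N, smoothInd Y q n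

lemma smoothInd_nonneg (Y q n : ℕ) : 0 ≤ smoothInd Y q n := by
  unfold smoothInd; split_ifs <;> norm_num

lemma smoothInd_le_one (Y q n : ℕ) : smoothInd Y q n ≤ 1 := by
  unfold smoothInd; split_ifs <;> norm_num

lemma smoothInd_mul {Y q m n : ℕ} (hm : m ≠ 0) (hn : n ≠ 0) :
    smoothInd Y q (m * n) = smoothInd Y q m * smoothInd Y q n := by
  simp only [smoothInd, hasSmallFactors_mul hm hn, Nat.coprime_mul_iff_left, ite_and]
  split_ifs <;> simp

lemma smoothInd_of_le {Y q n : ℕ} (h : n ≤ Y) :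
    smoothInd Y q n = if n.Coprime q then 1 else 0 := by
  simp [smoothInd, hasSmallFactors_of_le h]

lemma smoothCount_nonneg (Y q N : ℕ) : 0 ≤ smoothCount Y q N :=
  Finset.sum_nonneg fun _ _ => smoothInd_nonneg _ _ _

lemma smoothCount_mono (Y q : ℕ) {M N : ℕ} (h : M ≤ N) : smoothCount Y q M ≤ smoothCount Y q N :=
  Finset.sum_le_sum_of_subset_of_nonneg (Finset.Icc_subset_Icc_right h)
    fun _ _ _ => smoothInd_nonneg _ _ _

lemma sum_log_mul_smoothInd (Y q N : ℕ) :
    ∑ n ∈ Icc 1 N, Real.log n * smoothInd Y q n =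
      ∑ d ∈ Icc 1 N, Λ d * (smoothInd Y q d * smoothCount Y q (N / d)) := by
  rw [sum_log_mul_eq]
  refine Finset.sum_congr rfl fun d hd => ?_
  rw [mem_Icc] at hd
  congr 1
  rw [smoothCount, Finset.mul_sum]
  refine Finset.sum_congr rfl fun m hm => smoothInd_mul (by omega) ?_
  rw [mem_Icc] at hm
  omega

lemma sum_log_mul_smoothInd_le (Y q N : ℕ) :
    ∑ n ∈ Icc 1 N, Real.log n * smoothInd Y q n ≤ Real.log N * smoothCount Y q N := by
  rw [smoothCount, Finset.mul_sum]
  refine Finset.sum_le_sum fun n hn => ?_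
  rw [mem_Icc] at hn
  exact mul_le_mul_of_nonneg_right (Real.log_le_log (by exact_mod_cast hn.1)
    (by exact_mod_cast hn.2)) (smoothInd_nonneg _ _ _)

lemma sum_Icc_div_comm (G : ℕ → ℕ → ℝ) (N : ℕ) :
    ∑ d ∈ Icc 1 N, ∑ m ∈ Icc 1 (N / d), G d m = ∑ m ∈ Icc 1 N, ∑ d ∈ Icc 1 (N / m), G d m := by
  have key : ∀ d m : ℕ, d ∈ Icc 1 N ∧ m ∈ Icc 1 (N / d) → d ∈ Icc 1 (N / m) ∧ m ∈ Icc 1 N := by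
    intro d m
    simp only [mem_Icc]
    rintro ⟨⟨h1, h2⟩, h3, h4⟩
    have h5 := (Nat.le_div_iff_mul_le (by omega)).1 h4
    exact ⟨⟨h1, (Nat.le_div_iff_mul_le (by omega)).2 (by linarith)⟩, h3,
      h4.trans (Nat.div_le_self _ _)⟩
  exact Finset.sum_comm' fun d m => ⟨key d m, fun h => (key m d h.symm).symm⟩

lemma half_le_natCast_div {N d : ℕ} (hd : 0 < d) (h : d ≤ N) :
    (N : ℝ) / (2 * d) ≤ (N / d : ℕ) := by
  have h1 : 1 ≤ N / d := Nat.div_pos h hd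
  have h2 := Nat.lt_div_mul_add hd (a := N)
  have h3 : N ≤ N / d * (2 * d) := by nlinarith
  rw [div_le_iff₀ (by positivity)]
  exact_mod_cast h3

lemma le_sqrt_pow {N : ℕ} (h : 9 ≤ N) : N ≤ Nat.sqrt N ^ 3 := by
  have h1 : 3 ≤ Nat.sqrt N := Nat.le_sqrt.2 (by omega)
  have h2 := Nat.lt_succ_sqrt N
  set s := Nat.sqrt N
  simp only [Nat.succ_eq_add_one] at h2
  nlinarith [Nat.mul_le_mul h1 h1, Nat.mul_le_mul h1 (le_refl (s * s))]

/-- A lower bound for the number of integers up to `N` coprime to `q`. -/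
lemma exists_smoothCount_ge_of_le (b : ℕ) :
    ∃ N₀ : ℕ, ∀ N Y q : ℕ, N₀ ≤ N → N ≤ Y → 1 ≤ q → q ≤ N ^ b →
      1 / 48 * (N * (q.totient / q : ℝ)) ≤ smoothCount Y q N := by
  obtain ⟨t₀, ht₀⟩ := exists_le_sum_vonMangoldt_coprime (3 * b)
  refine ⟨t₀ * t₀ + 9, fun N Y q hN hNY hq hqb => ?_⟩
  set s := Nat.sqrt N with hs
  have hts : t₀ ≤ s := Nat.le_sqrt.2 (by omega)
  have hs3 : 3 ≤ s := Nat.le_sqrt.2 (by omega)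
  have hNs := le_sqrt_pow (N := N) (by omega)
  have hss : s * s ≤ N := Nat.sqrt_le N
  have hsN : s ≤ N := (Nat.le_mul_self s).trans hss
  have hlN : 0 < Real.log N := Real.log_pos (by exact_mod_cast (by omega : 1 < N))
  have hls : Real.log N ≤ 3 * Real.log s := by
    have := Real.log_le_log (by exact_mod_cast (by omega : 0 < N))
      (by exact_mod_cast hNs : (N : ℝ) ≤ (s : ℝ) ^ 3)
    rwa [Real.log_pow] at this
  have h1 : ∑ n ∈ Icc 1 N, Real.log n * smoothInd Y q n =
      ∑ m ∈ Icc 1 N, smoothInd Y q m * ∑ d ∈ Icc 1 (N / m), Λ d * smoothInd Y q d := by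
    rw [sum_log_mul_smoothInd]
    simp only [smoothCount, Finset.mul_sum]
    rw [sum_Icc_div_comm]
    exact Finset.sum_congr rfl fun m _ => Finset.sum_congr rfl fun d _ => by ring
  have h2 : (N : ℝ) / 16 * (q.totient / q * Real.log s) ≤
      ∑ n ∈ Icc 1 N, Real.log n * smoothInd Y q n := by
    rw [h1]
    calc (N : ℝ) / 16 * (q.totient / q * Real.log s)
        ≤ N / 16 * ∑ m ∈ Icc 1 s, (if m.Coprime q then (1 : ℝ) / m else 0) := by
          gcongr
          exact sum_inv_coprime_ge q s (by omega)
      _ ≤ ∑ m ∈ Icc 1 s, smoothInd Y q m * ∑ d ∈ Icc 1 (N / m), Λ d * smoothInd Y q d := by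
          rw [Finset.mul_sum]
          refine Finset.sum_le_sum fun m hm => ?_
          rw [mem_Icc] at hm
          have hmN : m ≤ N := hm.2.trans hsN
          rw [smoothInd_of_le (hmN.trans hNY)]
          split_ifs with hc
          · have hst : s ≤ N / m := (Nat.le_div_iff_mul_le (by omega)).2
              ((Nat.mul_le_mul_left s hm.2).trans hss)
            have := ht₀ (N / m) q (hts.trans hst) hq (by
              rw [pow_mul]
              exact hqb.trans (Nat.pow_le_pow_left (hNs.trans (Nat.pow_le_pow_left hst 3)) b))
            have e : ∑ d ∈ Icc 1 (N / m), Λ d * smoothInd Y q d =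
                ∑ d ∈ Icc 1 (N / m), if d.Coprime q then Λ d else 0 := by
              refine Finset.sum_congr rfl fun d hd => ?_
              rw [smoothInd_of_le (((mem_Icc.1 hd).2.trans (Nat.div_le_self _ _)).trans hNY)]
              split_ifs <;> simp
            rw [e, one_mul]
            refine le_trans ?_ this
            have h3 := half_le_natCast_div (by omega) hmN
            have h4 : (N : ℝ) / 16 * (1 / m) = N / (2 * m) / 8 := by ring
            rw [h4]
            gcongr
          · simp
      _ ≤ _ := Finset.sum_le_sum_of_subset_of_nonneg (Finset.Icc_subset_Icc_right hsN)
          fun m _ _ => mul_nonneg (smoothInd_nonneg _ _ _) (Finset.sum_nonneg fun d _ =>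
            mul_nonneg ArithmeticFunction.vonMangoldt_nonneg (smoothInd_nonneg _ _ _))
  have h3 := h2.trans (sum_log_mul_smoothInd_le Y q N)
  have h4 : (N : ℝ) / 16 * (q.totient / q * (Real.log N / 3)) ≤
      (N : ℝ) / 16 * (q.totient / q * Real.log s) := by
    gcongr
    linarith
  have h5 : Real.log N * (1 / 48 * (N * (q.totient / q : ℝ))) ≤
      Real.log N * smoothCount Y q N := by linarith
  exact le_of_mul_le_mul_left h5 hlN

lemma le_sum_vonMangoldt_div (N : ℕ) : Real.log N / 4 - 1 ≤ ∑ d ∈ Icc 1 N, Λ d / d := by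
  set h : ℕ → ℝ := fun m => if m < 20 then 0 else 1 / 4 with hh
  have key := sum_mul_le_sum_mul_of_antitone (a := h) (h := fun d => Λ d)
    (f := fun d => (1 : ℝ) / d) (M := N) (fun k _ _ => by
      by_cases hk : k < 20
      · have : ∑ m ∈ Icc 1 k, h m = 0 := Finset.sum_eq_zero fun m hm => by
          rw [mem_Icc] at hm
          simp only [hh]
          rw [if_pos (by omega)]
        rw [this]
        exact Finset.sum_nonneg fun _ _ => ArithmeticFunction.vonMangoldt_nonneg
      · refine le_trans ?_ (le_sum_vonMangoldt (by omega : 20 ≤ k))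
        calc ∑ m ∈ Icc 1 k, h m ≤ ∑ m ∈ Icc 1 k, (1 / 4 : ℝ) :=
              Finset.sum_le_sum fun m _ => by simp only [hh]; split_ifs <;> norm_num
          _ = k / 4 := by simp; ring) (fun m _ _ => by positivity) (fun m h _ => by
      have : (0 : ℝ) < m := by exact_mod_cast h
      push_cast
      exact one_div_le_one_div_of_le this (by linarith))
  simp only [mul_one_div] at key
  refine le_trans ?_ key
  have h1 : ∑ m ∈ Icc 1 N, (1 / 4 : ℝ) * (1 / (m : ℕ)) - ∑ m ∈ Icc 1 19, (1 / 4 : ℝ) * (1 / (m : ℕ)) ≤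
      ∑ m ∈ Icc 1 N, h m / m := by
    have e : ∀ m, h m / m = 1 / 4 * (1 / m) - if m < 20 then (1 / 4 : ℝ) * (1 / m) else 0 := by
      intro m
      simp only [hh]
      split_ifs <;> ring
    simp only [e, Finset.sum_sub_distrib]
    refine sub_le_sub_left ?_ _
    rw [← Finset.sum_filter]
    refine Finset.sum_le_sum_of_subset_of_nonneg (fun m hm => ?_) fun _ _ _ => by positivity
    simp only [mem_filter, mem_Icc] at hm ⊢
    omega
  rw [← Finset.mul_sum, ← Finset.mul_sum] at h1
  have h2 := log_le_sum_inv N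
  have h3 : ∑ m ∈ Icc 1 19, (1 : ℝ) / (m : ℕ) ≤ 4 := by
    simp only [Finset.sum_Icc_succ_top, Nat.le_add_left]
    norm_num [Finset.sum_Icc_succ_top]
  linarith

lemma exists_le_sum_Ioc_vonMangoldt_div (b : ℕ) :
    ∃ z₀ : ℕ, ∀ z R q : ℕ, z₀ ≤ z → z ^ 48 ≤ R → R ≤ z ^ b → 1 ≤ q → q ≤ z ^ b →
      Real.log R / 16 ≤ ∑ d ∈ Ioc z R, (if d.Coprime q then Λ d / d else 0) := by
  obtain ⟨t₀, ht₀⟩ := exists_sum_vonMangoldt_not_coprime_le b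
  refine ⟨t₀ + 21, fun z R q hz hzR hRb hq hqb => ?_⟩
  have hz0 : (0 : ℝ) < z := by exact_mod_cast (by omega : 0 < z)
  have hzR' : z ≤ R := (Nat.le_self_pow (by norm_num) z).trans hzR
  have hlog : 48 * Real.log z ≤ Real.log R := by
    have := Real.log_le_log (by positivity) (by exact_mod_cast hzR : (z : ℝ) ^ 48 ≤ R)
    rwa [Real.log_pow] at this
  have hz3 : 3 ≤ Real.log z := by
    rw [Real.le_log_iff_exp_le hz0]
    have h1 := Real.exp_one_lt_d9
    have h2 : Real.exp 3 = Real.exp 1 ^ 3 := by rw [← Real.exp_nat_mul]; norm_num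
    have h3 : Real.exp 1 ^ 3 ≤ 2.7182818286 ^ 3 := by gcongr
    have h4 : (21 : ℝ) ≤ z := by exact_mod_cast (by omega : 21 ≤ z)
    rw [h2]
    norm_num at h3
    linarith
  have e1 : ∑ d ∈ Icc 1 R, Λ d / d = ∑ d ∈ Icc 1 z, Λ d / d + ∑ d ∈ Ioc z R, Λ d / d := by
    rw [Icc_one_eq_Ioc_zero, Icc_one_eq_Ioc_zero, Finset.sum_Ioc_consecutive _ (Nat.zero_le _) hzR']
  have e2 : ∑ d ∈ Ioc z R, Λ d / d = ∑ d ∈ Ioc z R, (if d.Coprime q then Λ d / d else 0) +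
      ∑ d ∈ Ioc z R, (if d.Coprime q then 0 else Λ d / d) := by
    rw [← Finset.sum_add_distrib]
    refine Finset.sum_congr rfl fun d _ => ?_
    split_ifs <;> simp
  have h3 : ∑ d ∈ Ioc z R, (if d.Coprime q then 0 else Λ d / d) ≤ 1 := by
    calc ∑ d ∈ Ioc z R, (if d.Coprime q then 0 else Λ d / d)
        ≤ ∑ d ∈ Ioc z R, 1 / z * (if d.Coprime q then 0 else Λ d) := by
          refine Finset.sum_le_sum fun d hd => ?_
          have hd' : (z : ℝ) ≤ d := by exact_mod_cast (mem_Ioc.1 hd).1.le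
          split_ifs
          · simp
          · rw [div_mul_eq_mul_div, one_mul]
            have : 0 ≤ Λ d := ArithmeticFunction.vonMangoldt_nonneg
            gcongr
      _ ≤ 1 / z * ∑ d ∈ Icc 1 R, (if d.Coprime q then 0 else Λ d) := by
          rw [← Finset.mul_sum]
          refine mul_le_mul_of_nonneg_left ?_ (by positivity)
          refine Finset.sum_le_sum_of_subset_of_nonneg (fun d hd => ?_) fun d _ _ => ?_
          · rw [mem_Ioc] at hd; rw [mem_Icc]; omega
          · split_ifs
            · rfl
            · exact ArithmeticFunction.vonMangoldt_nonneg
      _ ≤ 1 / z * (z / 8) := by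
          gcongr
          exact ht₀ z q R (by omega) hq hqb (by omega) hRb
      _ ≤ 1 := by field_simp; norm_num
  have h4 := sum_vonMangoldt_div_le z
  have h5 := le_sum_vonMangoldt_div R
  linarith

lemma exists_pow_le_lt_pow (R k : ℕ) (hk : k ≠ 0) : ∃ z, z ^ k ≤ R ∧ R < (z + 1) ^ k := by
  refine ⟨Nat.findGreatest (fun z => z ^ k ≤ R) R, Nat.findGreatest_spec (P := fun z => z ^ k ≤ R)
    (Nat.zero_le R) (by simp [hk]), ?_⟩
  by_contra! h
  have h1 : Nat.findGreatest (fun z => z ^ k ≤ R) R + 1 ≤ R := (Nat.le_self_pow hk _).trans h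
  have := Nat.le_findGreatest (P := fun z => z ^ k ≤ R) h1 h
  omega

lemma exists_pow_le_le_pow_two_mul {z₀ R k : ℕ} (hk : k ≠ 0) (h : (z₀ + 3) ^ k ≤ R) :
    ∃ z, z₀ + 2 ≤ z ∧ z ^ k ≤ R ∧ R ≤ z ^ (2 * k) := by
  obtain ⟨z, hzR, hRz⟩ := exists_pow_le_lt_pow R k hk
  have hzz : z₀ + 2 ≤ z := by
    by_contra! h'
    have := Nat.pow_le_pow_left (by omega : z + 1 ≤ z₀ + 3) k
    omega
  have h1 : z + 1 ≤ z ^ 2 := by nlinarith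
  refine ⟨z, hzz, hzR, ?_⟩
  rw [pow_mul]
  exact hRz.le.trans (Nat.pow_le_pow_left h1 k)

lemma exists_smoothCount_ge (b B : ℕ) (hB : 1 ≤ B) :
    ∃ c : ℝ, 0 < c ∧ ∃ Y₀ : ℕ, ∀ Y q N : ℕ, Y₀ ≤ Y → 1 ≤ q → q ≤ Y ^ b → Nat.sqrt Y ≤ N →
      N ≤ Y ^ B → c * (N * (q.totient / q : ℝ)) ≤ smoothCount Y q N := by
  obtain ⟨N₀, hN₀⟩ := exists_smoothCount_ge_of_le (3 * b)
  obtain ⟨z₀, hz₀⟩ := exists_le_sum_Ioc_vonMangoldt_div (288 * b + 96)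
  have hB' : (1 : ℝ) ≤ B := by exact_mod_cast hB
  refine ⟨1 / 48 / (96 * B : ℝ) ^ (288 * B), by positivity,
    (N₀ + (z₀ + 3) ^ 48 + z₀ + 3) ^ 2, fun Y q N hY hq hqb hN hNB => ?_⟩
  set R := Nat.sqrt Y with hR
  have hR1 : N₀ + (z₀ + 3) ^ 48 + z₀ + 3 ≤ R := Nat.le_sqrt'.2 hY
  obtain ⟨z, hzz, hzR, hRz'⟩ : ∃ z, z₀ + 2 ≤ z ∧ z ^ 48 ≤ R ∧ R ≤ z ^ 96 :=
    exists_pow_le_le_pow_two_mul (by norm_num) (le_trans (by omega) hR1)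
  have hR2 : N₀ + 3 ≤ R := le_trans (by omega) hR1
  clear hR1 hY
  have hYR : Y ≤ R ^ 3 := le_sqrt_pow <|
    (Nat.mul_self_le_mul_self (by omega : 3 ≤ R)).trans (Nat.sqrt_le Y)
  have hRY : R * R ≤ Y := Nat.sqrt_le Y
  have hYz : Y ≤ z ^ 288 := by
    calc Y ≤ (z ^ 96) ^ 3 := hYR.trans (Nat.pow_le_pow_left hRz' 3)
      _ = z ^ 288 := by rw [← pow_mul]
  have hz1 : 1 ≤ z := by omega
  have hqz : q ≤ z ^ (288 * b + 96) := by
    calc q ≤ (z ^ 288) ^ b := hqb.trans (Nat.pow_le_pow_left hYz b)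
      _ = z ^ (288 * b) := by rw [← pow_mul]
      _ ≤ _ := Nat.pow_le_pow_right hz1 (by omega)
  have hL := hz₀ z R q (by omega) hzR
    (hRz'.trans (Nat.pow_le_pow_right hz1 (by omega))) hq hqz
  have hlR : 0 < Real.log R := Real.log_pos (by exact_mod_cast (by omega : 1 < R))
  have hρ : 0 ≤ (q.totient / q : ℝ) := by positivity
  have key : ∀ j : ℕ, ∀ N, R ≤ N → N ≤ Y ^ B → N ≤ Y * z ^ j →
      1 / 48 / (96 * B : ℝ) ^ j * (N * (q.totient / q : ℝ)) ≤ smoothCount Y q N := by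
    intro j
    induction j with
    | zero =>
      intro N h1 _ h3
      rw [pow_zero, div_one]
      refine hN₀ N Y q (by omega) (by simpa using h3) hq (hqb.trans ?_)
      rw [pow_mul]
      exact Nat.pow_le_pow_left (hYR.trans (Nat.pow_le_pow_left h1 3)) b
    | succ j ih =>
      intro N h1 h2 h3
      by_cases h4 : N ≤ Y * z ^ j
      · refine le_trans ?_ (ih N h1 h2 h4)
        gcongr
        · nlinarith
        · omega
      have hYN : Y ≤ N := (Nat.le_mul_of_pos_right Y (pow_pos hz1 j)).trans (by omega)
      have hRN : R ≤ N := h1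
      have h5 : ∑ d ∈ Ioc z R, 1 / 48 / (96 * B : ℝ) ^ j * (N / 2 * (q.totient / q : ℝ)) *
          (if d.Coprime q then Λ d / d else 0) ≤ Real.log N * smoothCount Y q N := by
        refine le_trans ?_ (sum_log_mul_smoothInd_le Y q N)
        rw [sum_log_mul_smoothInd]
        calc _ ≤ ∑ d ∈ Ioc z R, Λ d * (smoothInd Y q d * smoothCount Y q (N / d)) := by
              refine Finset.sum_le_sum fun d hd => ?_
              obtain ⟨hd1, hd2⟩ := mem_Ioc.1 hd
              have hdR : d * R ≤ N := (Nat.mul_le_mul_right R hd2).trans (hRY.trans hYN)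
              rw [smoothInd_of_le (hd2.trans ((Nat.le_mul_self R).trans hRY))]
              split_ifs
              · have h6 := ih (N / d) ((Nat.le_div_iff_mul_le (by omega)).2 (by linarith))
                  ((Nat.div_le_self _ _).trans h2) (by
                    refine Nat.div_le_of_le_mul (h3.trans ?_)
                    calc Y * z ^ (j + 1) = z * (Y * z ^ j) := by ring
                      _ ≤ d * (Y * z ^ j) := Nat.mul_le_mul_right _ hd1.le)
                have h7 := half_le_natCast_div (by omega : 0 < d) (hd2.trans hRN)
                have hΛ : 0 ≤ Λ d := ArithmeticFunction.vonMangoldt_nonneg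
                rw [one_mul]
                calc _ = Λ d * (1 / 48 / (96 * B : ℝ) ^ j *
                      ((N / (2 * d)) * (q.totient / q : ℝ))) := by ring
                  _ ≤ Λ d * (1 / 48 / (96 * B : ℝ) ^ j *
                      ((N / d : ℕ) * (q.totient / q : ℝ))) := by gcongr
                  _ ≤ _ := mul_le_mul_of_nonneg_left h6 hΛ
              · simp
          _ ≤ _ := Finset.sum_le_sum_of_subset_of_nonneg
              (fun d hd => by rw [mem_Ioc] at hd; rw [mem_Icc]; omega)
              fun d _ _ => mul_nonneg ArithmeticFunction.vonMangoldt_nonneg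
                (mul_nonneg (smoothInd_nonneg _ _ _) (smoothCount_nonneg _ _ _))
      rw [← Finset.mul_sum] at h5
      have hlN : Real.log N ≤ 3 * B * Real.log R := by
        have h8 : (N : ℝ) ≤ (R : ℝ) ^ (3 * B) := by
          rw [pow_mul]
          exact_mod_cast h2.trans (Nat.pow_le_pow_left hYR B)
        have h9 := Real.log_le_log (by exact_mod_cast (by omega : 0 < N)) h8
        rw [Real.log_pow] at h9
        push_cast at h9
        exact h9
      have hP := smoothCount_nonneg Y q N
      have h10 : 1 / 48 / (96 * B : ℝ) ^ j * (N / 2 * (q.totient / q : ℝ)) * (Real.log R / 16) ≤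
          3 * B * Real.log R * smoothCount Y q N := by
        refine le_trans ?_ (h5.trans (mul_le_mul_of_nonneg_right hlN hP))
        gcongr
      refine le_of_mul_le_mul_left (le_trans (le_of_eq ?_) h10)
        (by positivity : 0 < 3 * B * Real.log R)
      rw [pow_succ]
      field_simp
      ring
  refine key (288 * B) N hN hNB (hNB.trans ?_)
  calc Y ^ B ≤ (z ^ 288) ^ B := Nat.pow_le_pow_left hYz B
    _ = z ^ (288 * B) := by rw [← pow_mul]
    _ ≤ Y * z ^ (288 * B) := Nat.le_mul_of_pos_left _ (by nlinarith)

/-- The indicator of the `Y`-smooth integers in the class `u` modulo `q`, minus its average over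
the reduced classes. -/
noncomputable def smoothDisc (Y : ℕ) {q : ℕ} (u : (ZMod q)ˣ) (n : ℕ) : ℝ :=
  smoothInd Y q n * ((if (n : ZMod q) = u then 1 else 0) - 1 / (q.totient : ℝ))

/-- The class of `d` in `(ZMod q)ˣ`, or `1` when `d` is not coprime to `q`. -/
noncomputable def residueUnit (q d : ℕ) : (ZMod q)ˣ :=
  if h : d.Coprime q then ZMod.unitOfCoprime d h else 1

lemma smoothDisc_mul {Y q d m : ℕ} (hd : d ≠ 0) (hm : m ≠ 0) (u : (ZMod q)ˣ) :
    smoothDisc Y u (d * m) = smoothInd Y q d * smoothDisc Y ((residueUnit q d)⁻¹ * u) m := by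
  rw [smoothDisc, smoothDisc, smoothInd_mul hd hm, mul_assoc]
  by_cases hc : d.Coprime q
  · have : ((d * m : ℕ) : ZMod q) = u ↔
        (m : ZMod q) = (((residueUnit q d)⁻¹ * u : (ZMod q)ˣ) : ZMod q) := by
      rw [residueUnit, dif_pos hc, Nat.cast_mul, ← ZMod.coe_unitOfCoprime d hc, Units.val_mul,
        Units.eq_inv_mul_iff_mul_eq]
    simp only [this]
  · simp [smoothInd, hc]

lemma sum_units_smoothInd (Y q n : ℕ) [NeZero q] :
    ∑ v : (ZMod q)ˣ, (if (n : ZMod q) = v then smoothInd Y q n else 0) = smoothInd Y q n := by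
  by_cases hc : n.Coprime q
  · have : ∀ v : (ZMod q)ˣ, (n : ZMod q) = v ↔ ZMod.unitOfCoprime n hc = v := by
      intro v
      rw [← ZMod.coe_unitOfCoprime n hc, Units.val_inj]
    simp only [this, Finset.sum_ite_eq, mem_univ, if_true]
  · simp [smoothInd, hc]

lemma sum_units_sum_smoothInd (Y q : ℕ) [NeZero q] (s : Finset ℕ) (g : ℕ → ℝ) :
    ∑ v : (ZMod q)ˣ, ∑ n ∈ s, (if (n : ZMod q) = v then smoothInd Y q n * g n else 0) =
      ∑ n ∈ s, smoothInd Y q n * g n := by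
  rw [Finset.sum_comm]
  refine Finset.sum_congr rfl fun n _ => ?_
  conv_rhs => rw [← sum_units_smoothInd Y q n, Finset.sum_mul]
  exact Finset.sum_congr rfl fun v _ => by split_ifs <;> simp

lemma sum_smoothDisc_mul (Y : ℕ) {q : ℕ} (u : (ZMod q)ˣ) (s : Finset ℕ) (g : ℕ → ℝ) :
    ∑ n ∈ s, smoothDisc Y u n * g n =
      ∑ n ∈ s, (if (n : ZMod q) = u then smoothInd Y q n * g n else 0) -
        (∑ n ∈ s, smoothInd Y q n * g n) / q.totient := by
  rw [Finset.sum_div, ← Finset.sum_sub_distrib]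
  refine Finset.sum_congr rfl fun n _ => ?_
  rw [smoothDisc]
  split_ifs <;> ring

lemma abs_sum_smoothDisc_mul_le {Y q : ℕ} [NeZero q] (u : (ZMod q)ˣ) {s : Finset ℕ} {g : ℕ → ℝ}
    {M : ℝ} (hg : ∀ n ∈ s, 0 ≤ g n)
    (h : ∀ v : (ZMod q)ˣ,
      ∑ n ∈ s, (if (n : ZMod q) = v then smoothInd Y q n * g n else 0) ≤ M) :
    |∑ n ∈ s, smoothDisc Y u n * g n| ≤ M := by
  have hφ : (0 : ℝ) < q.totient := by
    exact_mod_cast Nat.totient_pos.2 (Nat.pos_of_ne_zero (NeZero.ne q))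
  have h1 : (∑ n ∈ s, smoothInd Y q n * g n) / q.totient ≤ M := by
    rw [div_le_iff₀ hφ, ← sum_units_sum_smoothInd]
    calc _ ≤ ∑ v : (ZMod q)ˣ, M := Finset.sum_le_sum fun v _ => h v
      _ = M * q.totient := by
        rw [Finset.sum_const, Finset.card_univ, ZMod.card_units_eq_totient, nsmul_eq_mul, mul_comm]
  have h2 : 0 ≤ (∑ n ∈ s, smoothInd Y q n * g n) / q.totient :=
    div_nonneg (Finset.sum_nonneg fun n hn => mul_nonneg (smoothInd_nonneg _ _ _) (hg n hn)) hφ.le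
  have h3 : 0 ≤ ∑ n ∈ s, (if (n : ZMod q) = u then smoothInd Y q n * g n else 0) :=
    Finset.sum_nonneg fun n hn => by
      split_ifs
      · exact mul_nonneg (smoothInd_nonneg _ _ _) (hg n hn)
      · rfl
  rw [sum_smoothDisc_mul, abs_le]
  constructor <;> linarith [h u]

/-- The discrepancy `Ψ(N, Y; q, u) - Ψ_q(N, Y) / φ(q)`. -/
noncomputable def discrepancy (Y : ℕ) {q : ℕ} (u : (ZMod q)ˣ) (N : ℕ) : ℝ :=
  ∑ n ∈ Icc 1 N, smoothDisc Y u n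

lemma discrepancy_eq (Y : ℕ) {q : ℕ} (u : (ZMod q)ˣ) (N : ℕ) :
    discrepancy Y u N = ∑ n ∈ Icc 1 N, (if (n : ZMod q) = u then smoothInd Y q n else 0) -
      smoothCount Y q N / q.totient := by
  have := sum_smoothDisc_mul Y u (Icc 1 N) fun _ => 1
  simp only [mul_one] at this
  exact this

lemma sum_smoothDisc_mul_left (Y : ℕ) {q d : ℕ} (hd : d ≠ 0) (u : (ZMod q)ˣ) (M : ℕ) :
    ∑ m ∈ Icc 1 M, smoothDisc Y u (d * m) =
      smoothInd Y q d * discrepancy Y ((residueUnit q d)⁻¹ * u) M := by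
  rw [discrepancy, Finset.mul_sum]
  refine Finset.sum_congr rfl fun m hm => smoothDisc_mul hd ?_ u
  rw [mem_Icc] at hm
  omega

lemma abs_discrepancy_le_two {Y q N : ℕ} [NeZero q] (h : N ≤ Y) (u : (ZMod q)ˣ) :
    |discrepancy Y u N| ≤ 2 := by
  have hq := Nat.pos_of_ne_zero (NeZero.ne q)
  have hφ : (0 : ℝ) < q.totient := by exact_mod_cast Nat.totient_pos.2 hq
  set A : (ZMod q)ˣ → ℝ := fun v =>
    ∑ n ∈ Icc 1 N, (if (n : ZMod q) = v then smoothInd Y q n else 0) with hA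
  have hA1 : ∀ v, |A v - N / q| ≤ 1 := by
    intro v
    have e : A v = (((Icc 1 N).filter (fun m : ℕ => (m : ZMod q) = (v : ZMod q))).card : ℝ) := by
      rw [Finset.card_filter]
      push_cast
      refine Finset.sum_congr rfl fun n hn => ?_
      rw [mem_Icc] at hn
      split_ifs with h1
      · have hc : n.Coprime q := (ZMod.isUnit_iff_coprime n q).1 (h1 ▸ v.isUnit)
        rw [smoothInd_of_le (hn.2.trans h), if_pos hc]
      · rfl
    rw [e]
    exact abs_card_residue_sub_le N q hq v
  have hA2 : smoothCount Y q N = ∑ v : (ZMod q)ˣ, A v := by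
    have := sum_units_sum_smoothInd Y q (Icc 1 N) fun _ => 1
    simp only [mul_one] at this
    exact this.symm
  have hcard : (Finset.univ : Finset (ZMod q)ˣ).card = q.totient := by
    rw [Finset.card_univ, ZMod.card_units_eq_totient]
  have h1 : ∑ v : (ZMod q)ˣ, A v ≤ (N / q + 1) * q.totient := by
    calc _ ≤ ∑ v : (ZMod q)ˣ, ((N : ℝ) / q + 1) :=
          Finset.sum_le_sum fun v _ => by linarith [(abs_le.1 (hA1 v)).2]
      _ = _ := by rw [Finset.sum_const, hcard, nsmul_eq_mul, mul_comm]
  have h2 : (N / q - 1) * q.totient ≤ ∑ v : (ZMod q)ˣ, A v := by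
    calc _ = ∑ v : (ZMod q)ˣ, ((N : ℝ) / q - 1) := by
          rw [Finset.sum_const, hcard, nsmul_eq_mul, mul_comm]
      _ ≤ _ := Finset.sum_le_sum fun v _ => by linarith [(abs_le.1 (hA1 v)).1]
  rw [← div_le_iff₀ hφ] at h1
  rw [← le_div_iff₀ hφ] at h2
  rw [discrepancy_eq, hA2, abs_le]
  have h3 := abs_le.1 (hA1 u)
  simp only [hA] at h1 h2 h3 ⊢
  constructor <;> linarith [h3.1, h3.2]

lemma sum_log_sub_log_le (N : ℕ) : ∑ n ∈ Icc 1 N, (Real.log N - Real.log n) ≤ N := by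
  rcases Nat.eq_zero_or_pos N with rfl | hN
  · simp
  have hN' : (0 : ℝ) < N := by exact_mod_cast hN
  have h1 := Real.pow_div_factorial_le_exp (N : ℝ) hN'.le N
  have h2 := Real.log_le_log (by positivity) h1
  rw [Real.log_exp, Real.log_div (by positivity) (by positivity), Real.log_pow] at h2
  have h3 : Real.log (N.factorial : ℝ) = ∑ n ∈ Icc 1 N, Real.log n := by
    rw [← Finset.prod_Ico_id_eq_factorial, Nat.cast_prod, Real.log_prod fun n hn => ?_]
    · rfl
    · rw [mem_Ico] at hn
      exact_mod_cast (by omega : n ≠ 0)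
  rw [Finset.sum_sub_distrib, ← h3]
  simpa using h2

lemma sum_residue_log_sub_log_le {N q : ℕ} (hN : 1 ≤ N) (hq : 0 < q) (v : ZMod q) :
    ∑ n ∈ Icc 1 N, (if (n : ZMod q) = v then Real.log N - Real.log n else 0) ≤
      N / q + Real.log N := by
  have hlog : ∀ m, 1 ≤ m → m ≤ N → 0 ≤ Real.log N - Real.log m := fun m h1 h2 =>
    sub_nonneg.2 (Real.log_le_log (by exact_mod_cast h1) (by exact_mod_cast h2))
  have key := sum_mul_le_sum_mul_of_antitone (M := N)
    (a := fun n => if (n : ZMod q) = v then 1 else 0)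
    (h := fun n => 1 / (q : ℝ) + if n = 1 then 1 else 0) (f := fun n => Real.log N - Real.log n)
    (fun k h1 _ => by
      have h2 := (abs_le.1 (abs_card_residue_sub_le k q hq v)).2
      rw [Finset.card_filter] at h2
      push_cast at h2
      rw [Finset.sum_add_distrib, Finset.sum_ite_eq', if_pos (by simp [h1])]
      simp only [sum_const, Nat.card_Icc, nsmul_eq_mul, Nat.add_sub_cancel]
      have e : (k : ℝ) * (1 / q) = k / q := by ring
      linarith) hlog
    (fun m h1 _ => sub_le_sub_left (Real.log_le_log (by exact_mod_cast h1)
      (by exact_mod_cast Nat.le_succ m)) _)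
  simp only [ite_mul, one_mul, zero_mul, add_mul, Finset.sum_add_distrib, ← Finset.mul_sum,
    Finset.sum_ite_eq'] at key
  rw [if_pos (by simp [hN])] at key
  refine key.trans ?_
  have h1 := sum_log_sub_log_le N
  have h2 : 1 / (q : ℝ) * ∑ n ∈ Icc 1 N, (Real.log N - Real.log n) ≤ 1 / q * N := by gcongr
  have e : 1 / (q : ℝ) * N = N / q := by ring
  simp only [Nat.cast_one, Real.log_one, sub_zero]
  linarith

lemma sum_inv_rpow_le {σ : ℝ} (hσ : 0 < σ) (M : ℕ) :
    ∑ d ∈ Icc 1 M, 1 / (d : ℝ) ^ (1 + σ) ≤ 1 + 1 / σ := by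
  have key : ∀ M : ℕ, 1 ≤ M →
      ∑ d ∈ Icc 1 M, 1 / (d : ℝ) ^ (1 + σ) ≤ 1 + 1 / σ - 1 / σ * (M : ℝ) ^ (-σ) := by
    intro M hM
    induction M, hM using Nat.le_induction with
    | base => simp
    | succ M hM ih =>
      rw [Finset.sum_Icc_succ_top (by omega)]
      have hM0 : (0 : ℝ) < M := by exact_mod_cast hM
      set D : ℝ := ((M + 1 : ℕ) : ℝ) with hD
      have hDM : D = M + 1 := by rw [hD]; push_cast; ring
      have hD0 : 0 < D := by linarith
      have h1 : D ^ (-σ) * (1 + σ / D) ≤ (M : ℝ) ^ (-σ) := by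
        have e : (M : ℝ) ^ (-σ) = D ^ (-σ) * ((M : ℝ) / D) ^ (-σ) := by
          rw [← Real.mul_rpow hD0.le (by positivity), mul_div_cancel₀ _ hD0.ne']
        rw [e]
        refine mul_le_mul_of_nonneg_left ?_ (by positivity)
        rw [Real.rpow_def_of_pos (by positivity)]
        refine le_trans ?_ (Real.add_one_le_exp _)
        have h2 := Real.log_le_sub_one_of_pos (by positivity : 0 < (M : ℝ) / D)
        have h3 : (M : ℝ) / D - 1 = -(1 / D) := by
          rw [hDM]; field_simp; ring
        have h4 : σ / D = 1 / D * σ := by ring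
        nlinarith
      have h2 : 1 / D ^ (1 + σ) = D ^ (-σ) / D := by
        rw [Real.rpow_add hD0, Real.rpow_one, Real.rpow_neg hD0.le]; field_simp
      rw [h2]
      have h3 : D ^ (-σ) / D = 1 / σ * (D ^ (-σ) * (1 + σ / D) - D ^ (-σ)) := by
        field_simp; ring
      have h4 : 1 / σ * (D ^ (-σ) * (1 + σ / D) - D ^ (-σ)) ≤
          1 / σ * ((M : ℝ) ^ (-σ) - D ^ (-σ)) := by gcongr
      rw [h3]
      linarith
  rcases Nat.eq_zero_or_pos M with rfl | hM
  · simp; positivity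
  · refine (key M hM).trans ?_
    have : 0 ≤ 1 / σ * (M : ℝ) ^ (-σ) := by positivity
    linarith

lemma sum_vonMangoldt_div_rpow_le {σ : ℝ} (hσ : 0 < σ) (M : ℕ) :
    ∑ d ∈ Icc 1 M, Λ d * (1 / (d : ℝ) ^ (1 + σ)) ≤ 6 * (1 + 1 / σ) := by
  refine (sum_vonMangoldt_mul_le (fun m _ _ => by positivity) fun m h _ => ?_).trans
    (mul_le_mul_of_nonneg_left (sum_inv_rpow_le hσ M) (by norm_num))
  have : (0 : ℝ) < m := by exact_mod_cast h
  push_cast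
  gcongr
  linarith

/-- The integers in `[1, N]` in the class `v` modulo `q` divisible by a prime power exceeding
`N / q`. -/
noncomputable def largePrimePowMultiples (N : ℕ) {q : ℕ} (v : (ZMod q)ˣ) : Finset ℕ :=
  (Icc 1 N).filter (fun n : ℕ => (n : ZMod q) = v ∧ ∃ d, d ∣ n ∧ IsPrimePow d ∧ N < d * q)

lemma exists_card_largePrimePowMultiples_le :
    ∃ C : ℝ, 0 < C ∧ ∀ N q z : ℕ, 2 ≤ q → 2 ≤ z → ∀ v : (ZMod q)ˣ,
      ((largePrimePowMultiples N v).card : ℝ) ≤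
        C * (Real.log q / Real.log z) * (N / q) + 2 * (z : ℝ) ^ 4 + 3 * (z * Nat.log 2 N) := by
  obtain ⟨C, hC, h⟩ := exists_card_sifted_le
  refine ⟨C, hC, fun N q z hq hz v => ?_⟩
  have h1 := h N q z hq hz v
  set S := (Icc 1 N).filter (fun n : ℕ => (n : ZMod q) = v ∧
        ∀ p, p.Prime → q < p → p ≤ z → ¬ p ∣ n) with hS
  set P := ((Icc 1 N).filter (fun d => IsPrimePow d ∧ d.minFac ∈ Icc 1 z)) with hP
  set P' := P.filter (fun d => d.Coprime q ∧ N < d * q) with hP'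
  have hsub : largePrimePowMultiples N v ⊆ S ∪ P'.biUnion fun d =>
      (Icc 1 N).filter (fun n : ℕ => (n : ZMod q) = v ∧ d ∣ n) := by
    intro n hn
    simp only [largePrimePowMultiples, mem_filter, mem_Icc] at hn
    obtain ⟨⟨hn1, hnN⟩, hv, d, ⟨m, rfl⟩, hd, hdq⟩ := hn
    have hd0 : 0 < d := hd.pos
    have hm0 : 0 < m := Nat.pos_of_mul_pos_left hn1
    have hc : (d * m).Coprime q := (ZMod.isUnit_iff_coprime _ q).1 (hv ▸ v.isUnit)
    simp only [hS, hP, hP', mem_union, mem_biUnion, mem_filter, mem_Icc]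
    by_cases hpz : d.minFac ≤ z
    · exact .inr ⟨d, ⟨⟨⟨hd0, (Nat.le_mul_of_pos_right d hm0).trans hnN⟩, hd, Nat.minFac_pos d, hpz⟩,
        hc.coprime_dvd_left (Dvd.intro _ rfl), hdq⟩, ⟨hn1, hnN⟩, hv, Dvd.intro _ rfl⟩
    · refine .inl ⟨⟨hn1, hnN⟩, hv, fun l hl hql hlz hld => ?_⟩
      rcases hl.dvd_mul.1 hld with hld | hlm
      · rw [← hd.minFac_pow_factorization_eq] at hld
        have h2 := (Nat.prime_dvd_prime_iff_eq hl (Nat.minFac_prime hd.ne_one)).1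
          (hl.dvd_of_dvd_pow hld)
        omega
      · have h2 : q ≤ m := hql.le.trans (Nat.le_of_dvd hm0 hlm)
        have := Nat.mul_le_mul_left d h2
        omega
  have hcard : (largePrimePowMultiples N v).card ≤ S.card + ∑ d ∈ P',
      ((Icc 1 N).filter (fun n : ℕ => (n : ZMod q) = v ∧ d ∣ n)).card :=
    (Finset.card_le_card hsub).trans ((Finset.card_union_le _ _).trans
      (Nat.add_le_add_left Finset.card_biUnion_le _))
  have h2 : ∀ d ∈ P',
      (((Icc 1 N).filter (fun n : ℕ => (n : ZMod q) = v ∧ d ∣ n)).card : ℝ) ≤ 3 := by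
    intro d hd
    simp only [hP', hP, mem_filter, mem_Icc] at hd
    have hd0 : 0 < d := hd.1.1.1
    have h3 := (abs_le.1 (abs_card_dvd_residue_sub_le N q d (by omega) hd0 hd.2.1 v)).2
    have h4 : (N : ℝ) / q * (1 / d) ≤ 1 := by
      rw [div_mul_div_comm, mul_one, div_le_one (by positivity)]
      exact_mod_cast (hd.2.2.le.trans (mul_comm d q).le)
    linarith
  have h5 : (P'.card : ℝ) ≤ z * Nat.log 2 N := by
    have h6 := (Finset.card_filter_le P (fun d => d.Coprime q ∧ N < d * q)).trans
      (card_primePow_le (Icc 1 z) N)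
    rw [Nat.card_Icc, Nat.add_sub_cancel] at h6
    exact_mod_cast h6
  have h7 : ((largePrimePowMultiples N v).card : ℝ) ≤ S.card + ∑ d ∈ P',
      (((Icc 1 N).filter (fun n : ℕ => (n : ZMod q) = v ∧ d ∣ n)).card : ℝ) := by
    exact_mod_cast hcard
  have h8 := Finset.sum_le_sum h2
  rw [Finset.sum_const, nsmul_eq_mul] at h8
  linarith

lemma log_mul_le_of_pow_le {N q : ℕ} (hq : 2 ≤ q) (hqN : q ^ 40 ≤ N) :
    Real.log N ≤ 2 * (N / q) := by
  have hq0 : (0 : ℝ) < q := by positivity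
  have hN0 : (0 : ℝ) < N := by exact_mod_cast (pow_pos (by omega) 40).trans_le hqN
  have h1 := Real.log_le_log (by positivity) (by exact_mod_cast hqN : (q : ℝ) ^ 40 ≤ N)
  rw [Real.log_pow] at h1
  have h2 := Real.log_le_sub_one_of_pos (by positivity : 0 < (N : ℝ) / q)
  rw [Real.log_div hN0.ne' hq0.ne'] at h2
  push_cast at h1
  have h3 : 0 ≤ Real.log q := Real.log_natCast_nonneg q
  linarith

lemma exists_log_mul_card_largePrimePowMultiples_le :
    ∃ C : ℝ, 0 < C ∧ ∀ N q : ℕ, 2 ≤ q → q ^ 40 ≤ N → ∀ v : (ZMod q)ˣ,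
      Real.log N * (largePrimePowMultiples N v).card ≤ C * Real.log q * (N / q) := by
  obtain ⟨C, hC, h⟩ := exists_card_largePrimePowMultiples_le
  refine ⟨32 * C + 20000, by positivity, fun N q hq hqN v => ?_⟩
  have hN40 : 2 ^ 40 ≤ N := (Nat.pow_le_pow_left hq 40).trans hqN
  obtain ⟨z, hz2, hzN, hNz⟩ := exists_pow_le_le_pow_two_mul (z₀ := 0) (R := N) (k := 16)
    (by norm_num) (le_trans (by norm_num) hN40)
  norm_num at hNz hz2
  have hz2' : (2 : ℝ) ≤ z := by exact_mod_cast hz2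
  have hlz : 0 < Real.log z := Real.log_pos (by linarith)
  have hN0 : (0 : ℝ) < N := by exact_mod_cast (by norm_num : 0 < 2 ^ 40).trans_le hN40
  have hlN0 : 0 ≤ Real.log N := Real.log_natCast_nonneg N
  have hlN : Real.log N ≤ 32 * Real.log z := by
    have := Real.log_le_log hN0 (by exact_mod_cast hNz : (N : ℝ) ≤ (z : ℝ) ^ 32)
    rwa [Real.log_pow] at this
  have hlNz : Real.log N ≤ 32 * z := by
    have := Real.log_le_sub_one_of_pos (by linarith : (0 : ℝ) < z)
    linarith
  have hqz : q ≤ z := by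
    by_contra! hc
    have h1 : z ^ 40 < q ^ 40 := Nat.pow_lt_pow_left hc (by norm_num)
    have h2 : z ^ 32 ≤ z ^ 40 := Nat.pow_le_pow_right (by omega) (by norm_num)
    omega
  have hq0 : (0 : ℝ) < q := by positivity
  have hX : (z : ℝ) ^ 15 ≤ N / q := by
    rw [le_div_iff₀ hq0]
    calc (z : ℝ) ^ 15 * (q : ℝ) ≤ (z : ℝ) ^ 15 * (z : ℝ) := by gcongr
      _ = (z : ℝ) ^ 16 := by ring
      _ ≤ (N : ℝ) := by exact_mod_cast hzN
  have hlog2N : (Nat.log 2 N : ℝ) ≤ 2 * Real.log N := by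
    have := natLog_two_le_of_le_pow (n := N) (t := N) (b := 1) (by exact_mod_cast hN0.ne') (by simp)
    simpa using this
  have hlq : 1 / 2 ≤ Real.log q := by
    have h1 := Real.log_two_gt_d9
    have h2 := Real.log_le_log (by norm_num) (by exact_mod_cast hq : (2 : ℝ) ≤ q)
    linarith
  have h1 := h N q z hq hz2 v
  have h2 : Real.log N * (C * (Real.log q / Real.log z) * (N / q)) ≤
      32 * C * Real.log q * (N / q) := by
    calc _ ≤ 32 * Real.log z * (C * (Real.log q / Real.log z) * (N / q)) := by gcongr
      _ = _ := by field_simp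
  have h3 : Real.log N * (2 * (z : ℝ) ^ 4 + 3 * (z * Nat.log 2 N)) ≤ 10000 * (N / q) := by
    calc _ ≤ 32 * (z : ℝ) * (2 * (z : ℝ) ^ 4 + 3 * (z * (2 * (32 * z)))) := by
          gcongr
          linarith
      _ ≤ 10000 * (z : ℝ) ^ 15 := by
          have a1 : (z : ℝ) ^ 5 ≤ z ^ 15 := pow_le_pow_right₀ (by linarith) (by norm_num)
          have a2 : (z : ℝ) ^ 3 ≤ z ^ 15 := pow_le_pow_right₀ (by linarith) (by norm_num)
          nlinarith
      _ ≤ _ := by gcongr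
  have h4 : 10000 * ((N : ℝ) / q) ≤ 20000 * Real.log q * (N / q) := by
    have : 0 ≤ (N : ℝ) / q := by positivity
    nlinarith
  have h5 := mul_le_mul_of_nonneg_left h1 hlN0
  linarith

lemma exists_abs_sum_smoothDisc_large_le :
    ∃ C : ℝ, 0 < C ∧ ∀ Y q N : ℕ, 2 ≤ q → q ^ 40 ≤ N → ∀ u : (ZMod q)ˣ,
      |∑ d ∈ Icc 1 N, (if N < d * q then Λ d else 0) *
        ∑ m ∈ Icc 1 (N / d), smoothDisc Y u (d * m)| ≤ C * Real.log q * (N / q) := by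
  obtain ⟨C, hC, h⟩ := exists_log_mul_card_largePrimePowMultiples_le
  refine ⟨C, hC, fun Y q N hq hqN u => ?_⟩
  have : NeZero q := ⟨by omega⟩
  set g : ℕ → ℝ := fun n => ∑ d ∈ n.divisors, if N < d * q then Λ d else 0 with hg
  have hg0 : ∀ n, 0 ≤ g n := fun n => Finset.sum_nonneg fun d _ => by
    split_ifs
    · exact ArithmeticFunction.vonMangoldt_nonneg
    · rfl
  have e : ∑ d ∈ Icc 1 N, (if N < d * q then Λ d else 0) *
        ∑ m ∈ Icc 1 (N / d), smoothDisc Y u (d * m) = ∑ n ∈ Icc 1 N, smoothDisc Y u n * g n := by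
    have := sum_divisors_eq_sum_sum
      (fun d n => (if N < d * q then Λ d else 0) * smoothDisc Y u n) N
    simp only [← Finset.mul_sum, ← Finset.sum_mul] at this
    rw [← this]
    exact Finset.sum_congr rfl fun n _ => mul_comm _ _
  rw [e]
  refine abs_sum_smoothDisc_mul_le u (fun n _ => hg0 n) fun v => le_trans ?_ (h N q hq hqN v)
  rw [largePrimePowMultiples, Finset.card_filter, Nat.cast_sum, Finset.mul_sum]
  refine Finset.sum_le_sum fun n hn => ?_
  rw [mem_Icc] at hn
  by_cases hnv : (n : ZMod q) = v
  · by_cases hex : ∃ d, d ∣ n ∧ IsPrimePow d ∧ N < d * q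
    · rw [if_pos hnv, if_pos ⟨hnv, hex⟩, Nat.cast_one, mul_one]
      calc smoothInd Y q n * g n ≤ 1 * g n :=
            mul_le_mul_of_nonneg_right (smoothInd_le_one Y q n) (hg0 n)
        _ = g n := one_mul _
        _ ≤ ∑ d ∈ n.divisors, Λ d := Finset.sum_le_sum fun d _ => by
            split_ifs
            · rfl
            · exact ArithmeticFunction.vonMangoldt_nonneg
        _ = Real.log n := ArithmeticFunction.vonMangoldt_sum
        _ ≤ Real.log N := Real.log_le_log (by exact_mod_cast hn.1) (by exact_mod_cast hn.2)
    · have : g n = 0 := Finset.sum_eq_zero fun d hd => by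
        split_ifs with hd'
        · rw [ArithmeticFunction.vonMangoldt_eq_zero_iff]
          exact fun hp => hex ⟨d, Nat.dvd_of_mem_divisors hd, hp, hd'⟩
        · rfl
      rw [this, mul_zero, ite_self]
      exact mul_nonneg (Real.log_natCast_nonneg N) (Nat.cast_nonneg _)
  · rw [if_neg hnv]
    exact mul_nonneg (Real.log_natCast_nonneg N) (Nat.cast_nonneg _)

lemma exists_log_mul_abs_discrepancy_le :
    ∃ C : ℝ, 0 < C ∧ ∀ Y q N : ℕ, 2 ≤ q → q ^ 40 ≤ N → ∀ u : (ZMod q)ˣ,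
      Real.log N * |discrepancy Y u N| ≤ C * Real.log q * (N / q) +
        ∑ d ∈ Icc 1 (N / q), Λ d * |discrepancy Y ((residueUnit q d)⁻¹ * u) (N / d)| := by
  obtain ⟨C, hC, h⟩ := exists_abs_sum_smoothDisc_large_le
  refine ⟨C + 6, by positivity, fun Y q N hq hqN u => ?_⟩
  have : NeZero q := ⟨by omega⟩
  have hN : 1 ≤ N := (Nat.one_le_pow 40 q (by omega)).trans hqN
  have hlq : 1 / 2 ≤ Real.log q := by
    have h1 := Real.log_two_gt_d9
    have h2 := Real.log_le_log (by norm_num) (by exact_mod_cast hq : (2 : ℝ) ≤ q)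
    linarith
  have h1 : |∑ n ∈ Icc 1 N, smoothDisc Y u n * (Real.log N - Real.log n)| ≤
      N / q + Real.log N := by
    have hpos : ∀ n ∈ Icc 1 N, 0 ≤ Real.log N - Real.log n := fun n hn => by
      rw [mem_Icc] at hn
      exact sub_nonneg.2 (Real.log_le_log (by exact_mod_cast hn.1) (by exact_mod_cast hn.2))
    refine abs_sum_smoothDisc_mul_le u hpos fun v =>
      le_trans (Finset.sum_le_sum fun n hn => ?_)
        (sum_residue_log_sub_log_le hN (by omega : 0 < q) (v : ZMod q))
    split_ifs
    · exact mul_le_of_le_one_left (hpos n hn) (smoothInd_le_one Y q n)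
    · rfl
  have h2 := log_mul_le_of_pow_le hq hqN
  have e1 : Real.log N * discrepancy Y u N =
      ∑ n ∈ Icc 1 N, smoothDisc Y u n * (Real.log N - Real.log n) +
        ∑ n ∈ Icc 1 N, Real.log n * smoothDisc Y u n := by
    rw [discrepancy, Finset.mul_sum, ← Finset.sum_add_distrib]
    exact Finset.sum_congr rfl fun n _ => by ring
  have e2 : ∑ n ∈ Icc 1 N, Real.log n * smoothDisc Y u n =
      ∑ d ∈ Icc 1 N, (if N < d * q then Λ d else 0) *
        ∑ m ∈ Icc 1 (N / d), smoothDisc Y u (d * m) +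
      ∑ d ∈ Icc 1 (N / q), Λ d * ∑ m ∈ Icc 1 (N / d), smoothDisc Y u (d * m) := by
    have e3 : Icc 1 (N / q) = (Icc 1 N).filter (fun d => ¬ N < d * q) := by
      ext d
      simp only [mem_Icc, mem_filter, not_lt, Nat.le_div_iff_mul_le (by omega : 0 < q)]
      constructor
      · rintro ⟨h1, h2⟩
        exact ⟨⟨h1, (Nat.le_mul_of_pos_right d (by omega)).trans h2⟩, h2⟩
      · rintro ⟨⟨h1, _⟩, h2⟩
        exact ⟨h1, h2⟩
    rw [sum_log_mul_eq, e3, Finset.sum_filter, ← Finset.sum_add_distrib]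
    refine Finset.sum_congr rfl fun d _ => ?_
    by_cases hd : N < d * q <;> simp [hd]
  have h3 : |∑ d ∈ Icc 1 (N / q), Λ d * ∑ m ∈ Icc 1 (N / d), smoothDisc Y u (d * m)| ≤
      ∑ d ∈ Icc 1 (N / q), Λ d * |discrepancy Y ((residueUnit q d)⁻¹ * u) (N / d)| := by
    refine (Finset.abs_sum_le_sum_abs _ _).trans (Finset.sum_le_sum fun d hd => ?_)
    rw [mem_Icc] at hd
    rw [sum_smoothDisc_mul_left Y (by omega), abs_mul, abs_mul,
      abs_of_nonneg ArithmeticFunction.vonMangoldt_nonneg, abs_of_nonneg (smoothInd_nonneg Y q d)]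
    exact mul_le_mul_of_nonneg_left (mul_le_of_le_one_left (abs_nonneg _) (smoothInd_le_one Y q d))
      ArithmeticFunction.vonMangoldt_nonneg
  have h4 := h Y q N hq hqN u
  have h5 : 3 * ((N : ℝ) / q) ≤ 6 * Real.log q * (N / q) := by
    have : 0 ≤ (N : ℝ) / q := by positivity
    nlinarith
  calc Real.log N * |discrepancy Y u N| = |Real.log N * discrepancy Y u N| := by
        rw [abs_mul, abs_of_nonneg (Real.log_natCast_nonneg N)]
    _ ≤ _ := by
        rw [e1, e2]
        refine (abs_add_le _ _).trans ((add_le_add le_rfl (abs_add_le _ _)).trans ?_)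
        linarith

/-- A bound for the discrepancy that is useful when `N` is at most a fixed power of `Y`. -/
lemma exists_abs_discrepancy_le_mul_rpow :
    ∃ K : ℝ, 0 < K ∧ ∀ Y q : ℕ, 2 ≤ q → q ^ 40 ≤ Y → ∀ N : ℕ, ∀ u : (ZMod q)ˣ,
      |discrepancy Y u N| ≤ 2 +
        K * (Real.log q / Real.log Y) * (N / q) * (N : ℝ) ^ (24 / Real.log Y) := by
  obtain ⟨C, hC, h⟩ := exists_log_mul_abs_discrepancy_le
  refine ⟨2 * (C + 24), by positivity, fun Y q hq hqY N => ?_⟩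
  have : NeZero q := ⟨by omega⟩
  have hlq : 1 / 2 ≤ Real.log q := by
    have h1 := Real.log_two_gt_d9
    have h2 := Real.log_le_log (by norm_num) (by exact_mod_cast hq : (2 : ℝ) ≤ q)
    linarith
  have hq0 : (0 : ℝ) < q := by positivity
  have hlY : 24 ≤ Real.log Y := by
    have h1 := Real.log_two_gt_d9
    have h2 := Real.log_le_log (by norm_num)
      (by exact_mod_cast (Nat.pow_le_pow_left hq 40).trans hqY : (2 : ℝ) ^ 40 ≤ Y)
    rw [Real.log_pow] at h2
    push_cast at h2
    linarith
  set σ := 24 / Real.log Y with hσ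
  have hσ0 : 0 < σ := by positivity
  set δ := Real.log q / Real.log Y with hδ
  have hδ0 : 0 < δ := by positivity
  set K := 2 * (C + 24) with hK
  have hK0 : 0 < K := by positivity
  induction N using Nat.strong_induction_on with
  | _ N ih =>
    intro u
    rcases le_or_gt N Y with hNY | hNY
    · have := abs_discrepancy_le_two hNY u
      have h2 : 0 ≤ K * δ * (N / q) * (N : ℝ) ^ σ := by positivity
      linarith
    have hN0 : (0 : ℝ) < N := by exact_mod_cast (by omega : 0 < N)
    have hY0 : (0 : ℝ) < Y := by
      exact_mod_cast (pow_pos (by omega : 0 < q) 40).trans_le hqY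
    have hLY : Real.log Y ≤ Real.log N := Real.log_le_log hY0 (by exact_mod_cast hNY.le)
    set L := Real.log N with hL
    set X : ℝ := N / q with hX
    have hX0 : 0 < X := by positivity
    have h1 := h Y q N hq (hqY.trans hNY.le) u
    have h2 : ∀ d ∈ Icc 1 (N / q),
        Λ d * |discrepancy Y ((residueUnit q d)⁻¹ * u) (N / d)| ≤
          2 * Λ d + K * δ * X * (N : ℝ) ^ σ * (Λ d * (1 / (d : ℝ) ^ (1 + σ))) := by
      intro d hd
      rw [mem_Icc] at hd
      have hd0 : (0 : ℝ) < d := by exact_mod_cast hd.1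
      rcases hd.1.eq_or_lt with rfl | hd1
      · simp
      have h3 := ih (N / d) (Nat.div_lt_self (by omega) hd1) ((residueUnit q d)⁻¹ * u)
      have h4 : ((N / d : ℕ) : ℝ) ≤ N / d := Nat.cast_div_le
      have h5 : K * δ * ((N / d : ℕ) / q) * ((N / d : ℕ) : ℝ) ^ σ ≤
          K * δ * X * (N : ℝ) ^ σ * (1 / (d : ℝ) ^ (1 + σ)) := by
        calc _ ≤ K * δ * ((N : ℝ) / d / q) * ((N : ℝ) / d) ^ σ := by gcongr
          _ = _ := by
            rw [Real.div_rpow hN0.le hd0.le, Real.rpow_add hd0, Real.rpow_one, hX]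
            field_simp
      have h6 := mul_le_mul_of_nonneg_left (h3.trans (add_le_add_right h5 2))
        (ArithmeticFunction.vonMangoldt_nonneg (n := d))
      linarith
    have h3 := Finset.sum_le_sum h2
    rw [Finset.sum_add_distrib, ← Finset.mul_sum, ← Finset.mul_sum] at h3
    have h4 : ∑ d ∈ Icc 1 (N / q), Λ d ≤ 6 * X :=
      (sum_vonMangoldt_le _).trans (mul_le_mul_of_nonneg_left Nat.cast_div_le (by norm_num))
    have h5 : ∑ d ∈ Icc 1 (N / q), Λ d * (1 / (d : ℝ) ^ (1 + σ)) ≤ L / 2 := by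
      refine (sum_vonMangoldt_div_rpow_le hσ0 _).trans ?_
      have : 1 / σ = Real.log Y / 24 := by rw [hσ]; field_simp
      rw [this]
      linarith
    have h6 : K * δ * X * (N : ℝ) ^ σ * ∑ d ∈ Icc 1 (N / q), Λ d * (1 / (d : ℝ) ^ (1 + σ)) ≤
        K * δ * X * (N : ℝ) ^ σ * (L / 2) := by gcongr
    have h7 : (C * Real.log q + 12) * X ≤ K * δ * X * (N : ℝ) ^ σ * (L / 2) := by
      have h8 : Real.log q = δ * Real.log Y := by rw [hδ]; field_simp
      have h9 : 1 ≤ (N : ℝ) ^ σ := Real.one_le_rpow (by exact_mod_cast (by omega : 1 ≤ N)) hσ0.le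
      calc (C * Real.log q + 12) * X ≤ ((C + 24) * Real.log q) * X := by gcongr; linarith
        _ = (C + 24) * δ * Real.log Y * X := by rw [h8]; ring
        _ ≤ (C + 24) * δ * L * X * 1 := by rw [mul_one]; gcongr
        _ ≤ (C + 24) * δ * L * X * (N : ℝ) ^ σ := by
          have : 0 ≤ L := by linarith
          gcongr
        _ = _ := by rw [hK]; ring
    have hL0 : 0 < L := by linarith
    have h8 : L * |discrepancy Y u N| ≤ L * (K * δ * X * (N : ℝ) ^ σ) := by linarith
    have := le_of_mul_le_mul_left h8 hL0
    linarith

lemma abs_discrepancy_le_div_add_one {Y q : ℕ} [NeZero q] (u : (ZMod q)ˣ) (N : ℕ) :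
    |discrepancy Y u N| ≤ N / q + 1 := by
  have hq := Nat.pos_of_ne_zero (NeZero.ne q)
  have h := abs_sum_smoothDisc_mul_le (Y := Y) u (s := Icc 1 N) (g := fun _ => 1)
    (M := N / q + 1) (fun _ _ => zero_le_one) fun v => by
      refine le_trans ?_ (sub_le_iff_le_add'.1 (abs_le.1 (abs_card_residue_sub_le N q hq v)).2)
      rw [Finset.card_filter, Nat.cast_sum]
      refine Finset.sum_le_sum fun n _ => ?_
      rw [mul_one]
      split_ifs
      · exact_mod_cast smoothInd_le_one Y q n
      · simp
  simpa only [mul_one, discrepancy] using h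

lemma exists_abs_discrepancy_le_of_le_pow (b B : ℕ) (hB : 1 ≤ B) :
    ∃ C : ℝ, 0 < C ∧ ∃ Y₀ : ℕ, ∀ Y q N : ℕ, Y₀ ≤ Y → 2 ≤ q → q ≤ Y ^ b → q ≤ N → Y ≤ N →
      N ≤ Y ^ B → ∀ u : (ZMod q)ˣ, |discrepancy Y u N| ≤
        C * (Real.log q / Real.log Y) * (smoothCount Y q N / q.totient) := by
  obtain ⟨c, hc, Y₀, hS⟩ := exists_smoothCount_ge b B hB
  obtain ⟨K, hK, hD⟩ := exists_abs_discrepancy_le_mul_rpow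
  set D := 80 + K * Real.exp (24 * B) with hD'
  have hD0 : 0 < D := by positivity
  refine ⟨D / c, by positivity, Y₀ + 2, fun Y q N hY hq hqY hqN hYN hN u => ?_⟩
  have : NeZero q := ⟨by omega⟩
  have hq0 : (0 : ℝ) < q := by positivity
  have hN0 : (0 : ℝ) < N := by exact_mod_cast (by omega : 0 < N)
  have hY0 : (0 : ℝ) < Y := by exact_mod_cast (by omega : 0 < Y)
  have hφ : (0 : ℝ) < q.totient := by exact_mod_cast Nat.totient_pos.2 (by omega)
  have hlY : 0 < Real.log Y := Real.log_pos (by exact_mod_cast (by omega : 1 < Y))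
  have hlq : 1 / 2 ≤ Real.log q := by
    have h1 := Real.log_two_gt_d9
    have h2 := Real.log_le_log (by norm_num) (by exact_mod_cast hq : (2 : ℝ) ≤ q)
    linarith
  set δ := Real.log q / Real.log Y with hδ
  have hδ0 : 0 < δ := by positivity
  have hX : (N : ℝ) / q ≤ (smoothCount Y q N / q.totient) / c := by
    have h1 := hS Y q N (by omega) (by omega) hqY ((Nat.sqrt_le_self Y).trans hYN) hN
    rw [div_div, le_div_iff₀ (by positivity)]
    calc (N : ℝ) / q * (q.totient * c) = c * (N * (q.totient / q : ℝ)) := by ring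
      _ ≤ _ := h1
  suffices h : |discrepancy Y u N| ≤ D * δ * (N / q) by
    calc _ ≤ D * δ * (N / q) := h
      _ ≤ D * δ * ((smoothCount Y q N / q.totient) / c) := by gcongr
      _ = _ := by ring
  have hX0 : 0 < (N : ℝ) / q := by positivity
  rcases le_or_gt (q ^ 40) Y with hqY' | hqY'
  · have h1 := hD Y q hq hqY' N u
    have h2 := log_mul_le_of_pow_le hq (hqY'.trans hYN)
    have hLN := Real.log_le_log hY0 (by exact_mod_cast hYN : (Y : ℝ) ≤ N)
    have h3 : (2 : ℝ) ≤ 80 * δ * (N / q) := by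
      have : 1 / 2 ≤ δ * Real.log N := by
        rw [hδ, div_mul_eq_mul_div, le_div_iff₀ hlY]
        nlinarith
      have := mul_le_mul_of_nonneg_left h2 hδ0.le
      linarith
    have h4 : (N : ℝ) ^ (24 / Real.log Y) ≤ Real.exp (24 * B) := by
      rw [Real.rpow_def_of_pos hN0, Real.exp_le_exp, mul_div_assoc', div_le_iff₀ hlY]
      have := Real.log_le_log hN0 (by exact_mod_cast hN : (N : ℝ) ≤ (Y : ℝ) ^ B)
      rw [Real.log_pow] at this
      linarith
    calc _ ≤ _ := h1
      _ ≤ 80 * δ * (N / q) + K * δ * (N / q) * Real.exp (24 * B) := by gcongr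
      _ = _ := by rw [hD']; ring
  · have h1 : 1 / 40 ≤ δ := by
      rw [hδ, div_le_div_iff₀ (by norm_num) hlY, one_mul]
      have := Real.log_le_log hY0 (by exact_mod_cast hqY'.le : (Y : ℝ) ≤ (q : ℝ) ^ 40)
      rw [Real.log_pow] at this
      push_cast at this
      linarith
    have h2 : 1 ≤ (N : ℝ) / q := by
      rw [one_le_div hq0]
      exact_mod_cast hqN
    have h3 : (2 : ℝ) ≤ D * δ := by
      have : 80 ≤ D := by rw [hD']; linarith [mul_pos hK (Real.exp_pos (24 * (B : ℝ)))]
      nlinarith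
    calc _ ≤ (N : ℝ) / q + 1 := abs_discrepancy_le_div_add_one u N
      _ ≤ 2 * (N / q) := by linarith
      _ ≤ _ := by gcongr

lemma exists_card_prime_not_dvd_ge (b r : ℕ) :
    ∃ Y₀ : ℕ, ∀ Y q : ℕ, Y₀ ≤ Y → 1 ≤ q → q ≤ Y ^ b →
      r ≤ ((Icc 1 Y).filter (fun p => p.Prime ∧ ¬ p ∣ q)).card := by
  obtain ⟨t₀, h⟩ := exists_le_sum_vonMangoldt_coprime b
  have hev : ∀ᶠ t : ℕ in Filter.atTop, 2 * (r : ℝ) * Real.log t ^ 2 < (t : ℝ) / 8 := by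
    have h1 := (isLittleO_log_rpow_atTop (r := 1 / 2) (by norm_num)).pow (n := 2) (by norm_num)
    have h2 := (h1.comp_tendsto tendsto_natCast_atTop_atTop).def
      (by positivity : (0 : ℝ) < 1 / (16 * (r + 1)))
    filter_upwards [h2, Filter.eventually_ge_atTop 1] with t ht ht1
    have ht0 : (0 : ℝ) < t := by exact_mod_cast ht1
    simp only [Function.comp] at ht
    rw [← Real.rpow_natCast ((t : ℝ) ^ (1 / 2 : ℝ)), ← Real.rpow_mul ht0.le] at ht
    norm_num at ht
    have h3 : 2 * (r : ℝ) * Real.log t ^ 2 ≤ 2 * r * ((r + 1 : ℝ)⁻¹ * (1 / 16) * t) := by gcongr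
    have h4 : 2 * r * ((r + 1 : ℝ)⁻¹ * (1 / 16) * t) = (r / (r + 1)) * (t / 8) := by
      field_simp
      ring
    rw [h4] at h3
    refine h3.trans_lt (mul_lt_of_lt_one_left (by positivity) ?_)
    rw [div_lt_one (by positivity)]
    linarith
  obtain ⟨t₁, ht₁⟩ := Filter.eventually_atTop.1 hev
  refine ⟨t₀ + t₁ + 1, fun Y q hY hq hqb => ?_⟩
  set P := (Icc 1 Y).filter (fun p => p.Prime ∧ ¬ p ∣ q) with hP
  by_contra! hc
  have h1 := h Y q (by omega) hq hqb
  have h2 := ht₁ Y (by omega)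
  have hlY := Real.log_natCast_nonneg Y
  have h3 : ∑ d ∈ Icc 1 Y, (if d.Coprime q then Λ d else 0) ≤
      ∑ d ∈ (Icc 1 Y).filter (fun d => IsPrimePow d ∧ d.minFac ∈ P), Real.log Y := by
    rw [Finset.sum_filter]
    refine Finset.sum_le_sum fun d hd => ?_
    rw [mem_Icc] at hd
    by_cases hp : IsPrimePow d
    · by_cases hdq : d.Coprime q
      · have hpr := Nat.minFac_prime hp.ne_one
        have : d.minFac ∈ P := by
          simp only [hP, mem_filter, mem_Icc]
          exact ⟨⟨hpr.one_le, (Nat.minFac_le hd.1).trans hd.2⟩, hpr,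
            (hpr.coprime_iff_not_dvd).1 (hdq.coprime_dvd_left (Nat.minFac_dvd d))⟩
        rw [if_pos hdq, if_pos ⟨hp, this⟩]
        exact ArithmeticFunction.vonMangoldt_le_log.trans
          (Real.log_le_log (by exact_mod_cast hd.1) (by exact_mod_cast hd.2))
      · rw [if_neg hdq]
        split_ifs <;> simp [hlY]
    · rw [ArithmeticFunction.vonMangoldt_eq_zero_iff.2 hp]
      split_ifs <;> simp [hlY]
  rw [Finset.sum_const, nsmul_eq_mul] at h3
  have h4 : (((Icc 1 Y).filter (fun d => IsPrimePow d ∧ d.minFac ∈ P)).card : ℝ) ≤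
      r * (2 * Real.log Y) := by
    have h5 : (Nat.log 2 Y : ℝ) ≤ 2 * Real.log Y := by
      have := natLog_two_le_of_le_pow (n := Y) (t := Y) (b := 1) (by omega) (by simp)
      simpa using this
    calc _ ≤ (P.card : ℝ) * Nat.log 2 Y := by exact_mod_cast card_primePow_le P Y
      _ ≤ r * (2 * Real.log Y) := by gcongr
  have h5 := mul_le_mul_of_nonneg_right h4 hlY
  nlinarith

lemma pow_card_le_smoothCount {Y q k N : ℕ} {P : Finset ℕ}
    (hP : ∀ p ∈ P, p.Prime ∧ ¬ p ∣ q ∧ p ≤ Y) (hN : Y ^ (P.card * k) ≤ N) :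
    ((k : ℝ) + 1) ^ P.card ≤ smoothCount Y q N := by
  set F := P.finsupp (fun _ => Finset.range (k + 1)) with hF
  have hFm : ∀ f ∈ F, f.support ⊆ P ∧ ∀ p ∈ P, f p ≤ k := fun f hf => by
    rw [hF, Finset.mem_finsupp_iff] at hf
    exact ⟨hf.1, fun p hp => Nat.lt_succ_iff.1 (Finset.mem_range.1 (hf.2 p hp))⟩
  have hcard : F.card = (k + 1) ^ P.card := by
    rw [hF, Finset.card_finsupp, Finset.prod_const, Finset.card_range]
  have hfac : ∀ f ∈ F, (f.prod (· ^ ·)).factorization = f := fun f hf =>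
    Nat.prod_pow_factorization_eq_self fun p hp => (hP p ((hFm f hf).1 hp)).1
  have hle : F.card ≤
      ((Icc 1 N).filter (fun n => HasSmallFactors Y n ∧ n.Coprime q)).card := by
    refine Finset.card_le_card_of_injOn (fun f => f.prod (· ^ ·)) ?_ ?_
    · intro f hf
      have hf' := hFm f hf
      have hprod : f.prod (· ^ ·) = ∏ p ∈ P, p ^ f p :=
        Finsupp.prod_of_support_subset f hf'.1 _ (by simp)
      simp only [coe_filter, mem_Icc, Set.mem_ofPred_eq]
      refine ⟨⟨?_, ?_⟩, ?_, ?_⟩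
      · rw [hprod]
        exact Nat.one_le_iff_ne_zero.2
          (Finset.prod_ne_zero_iff.2 fun p hp => pow_ne_zero _ (hP p hp).1.ne_zero)
      · rw [hprod]
        refine le_trans ?_ hN
        rw [mul_comm, pow_mul, ← Finset.prod_const]
        refine Finset.prod_le_prod' fun p hp => ?_
        exact (Nat.pow_le_pow_left (hP p hp).2.2 _).trans
          (Nat.pow_le_pow_right ((hP p hp).1.pos.trans_le (hP p hp).2.2) (hf'.2 p hp))
      · intro p hp
        rw [← Nat.support_factorization, hfac f hf] at hp
        exact (hP p (hf'.1 hp)).2.2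
      · rw [hprod]
        exact Nat.Coprime.prod_left fun p hp =>
          Nat.Coprime.pow_left _ (((hP p hp).1.coprime_iff_not_dvd).2 (hP p hp).2.1)
    · intro f hf g hg hfg
      rw [← hfac f hf, ← hfac g hg]
      exact congrArg _ hfg
  rw [hcard, Finset.card_filter] at hle
  have : (((k + 1) ^ P.card : ℕ) : ℝ) ≤ smoothCount Y q N := by
    refine (Nat.cast_le.2 hle).trans (le_of_eq ?_)
    simp only [smoothCount, smoothInd, Nat.cast_sum, Nat.cast_ite, Nat.cast_one, Nat.cast_zero]
  exact_mod_cast this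

lemma exists_pow_mul_log_pow_le_smoothCount (b r : ℕ) :
    ∃ Y₀ : ℕ, ∀ Y q N : ℕ, Y₀ ≤ Y → 1 ≤ q → q ≤ Y ^ b → Y ^ (2 * r + b + 7) ≤ N →
      (Y : ℝ) ^ r * (Nat.log 2 N : ℝ) ^ 3 ≤ smoothCount Y q N := by
  obtain ⟨Y₁, h1⟩ := exists_card_prime_not_dvd_ge b 6
  obtain ⟨c, hc, Y₂, h2⟩ := exists_smoothCount_ge b (2 * r + b + 7) (by omega)
  obtain ⟨Y₃, h3⟩ := exists_nat_ge (6 ^ 6 / c)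
  refine ⟨Y₁ + Y₂ + Y₃ + 2, fun Y q N hY hq hqY hN => ?_⟩
  obtain ⟨P, hP, hP6⟩ := Finset.exists_subset_card_eq (h1 Y q (by omega) hq hqY)
  have hY0 : (0 : ℝ) < Y := by exact_mod_cast (by omega : 0 < Y)
  have hq0 : (0 : ℝ) < q := by exact_mod_cast hq
  have hN0 : N ≠ 0 := ((pow_pos (by omega : 0 < Y) _).trans_le hN).ne'
  set k := Nat.log Y N / 6 with hk
  have hk1 : Y ^ (6 * k) ≤ N := (Nat.pow_le_pow_right (by omega) (Nat.mul_div_le _ _)).trans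
    (Nat.pow_log_le_self Y hN0)
  have hk2 : N < Y ^ (6 * (k + 1)) :=
    (Nat.lt_pow_succ_log_self (by omega : 1 < Y) N).trans_le
      (Nat.pow_le_pow_right (by omega) (by omega))
  have hA : ((k : ℝ) + 1) ^ 6 ≤ smoothCount Y q N := by
    have := pow_card_le_smoothCount (Y := Y) (q := q) (k := k) (N := N) (P := P)
      (fun p hp => by
        have := hP hp
        rw [mem_filter, mem_Icc] at this
        exact ⟨this.2.1, this.2.2, this.1.2⟩) (by rwa [hP6])
    rwa [hP6] at this
  have hB : c * (Y : ℝ) ^ (2 * r + 7) ≤ smoothCount Y q N := by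
    have h4 := h2 Y q (Y ^ (2 * r + b + 7)) (by omega) hq hqY
      ((Nat.sqrt_le_self Y).trans (Nat.le_self_pow (by omega) Y)) le_rfl
    refine le_trans ?_ (h4.trans (smoothCount_mono Y q hN))
    refine mul_le_mul_of_nonneg_left ?_ hc.le
    have h5 : (1 : ℝ) ≤ q.totient := by exact_mod_cast Nat.totient_pos.2 hq
    have h6 : (q : ℝ) ≤ (Y : ℝ) ^ b := by exact_mod_cast hqY
    rw [mul_div_assoc', le_div_iff₀ hq0, Nat.cast_pow]
    calc (Y : ℝ) ^ (2 * r + 7) * q ≤ (Y : ℝ) ^ (2 * r + 7) * (Y : ℝ) ^ b := by gcongr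
      _ = (Y : ℝ) ^ (2 * r + b + 7) * 1 := by rw [← pow_add, mul_one]; congr 1; omega
      _ ≤ _ := by gcongr
  have hj : (Nat.log 2 N : ℝ) ≤ 6 * (k + 1) * Y := by
    have h4 : N < 2 ^ (Y * (6 * (k + 1))) := hk2.trans_le (by
      rw [pow_mul 2]
      exact Nat.pow_le_pow_left Nat.lt_two_pow_self.le _)
    have := Nat.log_lt_of_lt_pow hN0 h4
    have h5 : Nat.log 2 N ≤ 6 * (k + 1) * Y := by
      rw [mul_comm]; exact this.le
    exact_mod_cast h5
  have hY3 : 6 ^ 6 ≤ c * Y := by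
    have h4 : ((Y₃ : ℕ) : ℝ) ≤ Y := by exact_mod_cast (by omega : Y₃ ≤ Y)
    have := h3.trans h4
    rw [div_le_iff₀ hc] at this
    linarith
  refine (pow_le_pow_iff_left₀ (by positivity) (smoothCount_nonneg Y q N) two_ne_zero).1 ?_
  calc ((Y : ℝ) ^ r * (Nat.log 2 N : ℝ) ^ 3) ^ 2
      ≤ ((Y : ℝ) ^ r * (6 * (k + 1) * Y) ^ 3) ^ 2 := by gcongr
    _ = 6 ^ 6 * (Y : ℝ) ^ (2 * r + 6) * ((k : ℝ) + 1) ^ 6 := by ring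
    _ ≤ (c * Y) * (Y : ℝ) ^ (2 * r + 6) * ((k : ℝ) + 1) ^ 6 := by gcongr
    _ = (c * (Y : ℝ) ^ (2 * r + 7)) * ((k : ℝ) + 1) ^ 6 := by ring
    _ ≤ smoothCount Y q N * smoothCount Y q N :=
        mul_le_mul hB hA (by positivity) (smoothCount_nonneg Y q N)
    _ = _ := by ring

lemma abs_smoothDisc_le_one {Y q : ℕ} [NeZero q] (u : (ZMod q)ˣ) (n : ℕ) :
    |smoothDisc Y u n| ≤ 1 := by
  have hφ : (1 : ℝ) ≤ q.totient := by
    exact_mod_cast Nat.totient_pos.2 (Nat.pos_of_ne_zero (NeZero.ne q))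
  have h1 : 1 / (q.totient : ℝ) ≤ 1 := by rw [div_le_one (by linarith)]; exact hφ
  have h2 : 0 ≤ 1 / (q.totient : ℝ) := by positivity
  rw [smoothDisc, abs_mul, abs_of_nonneg (smoothInd_nonneg Y q n)]
  refine mul_le_one₀ (smoothInd_le_one Y q n) (abs_nonneg _) (abs_le.2 ?_)
  split_ifs <;> constructor <;> linarith

lemma sum_eq_add_sum_vonMangoldt_mul (g : ℕ → ℝ) {N : ℕ} (hN : 1 ≤ N) :
    ∑ n ∈ Icc 1 N, g n = g 1 + ∑ d ∈ Icc 1 N, Λ d *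
      ∑ m ∈ Icc 1 (N / d), g (d * m) / Real.log (d * m : ℕ) := by
  have h1 := sum_log_mul_eq (fun n => g n / Real.log n) N
  rw [← h1, ← Finset.sum_erase_add _ _ (mem_Icc.2 ⟨le_rfl, hN⟩ : 1 ∈ Icc 1 N),
    ← Finset.sum_erase_add (a := 1) (Icc 1 N) (fun n => Real.log n * (g n / Real.log n))
      (mem_Icc.2 ⟨le_rfl, hN⟩), add_comm]
  simp only [Nat.cast_one, Real.log_one, zero_mul, add_zero]
  congr 1
  refine Finset.sum_congr rfl fun n hn => ?_
  rw [mem_erase, mem_Icc] at hn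
  have : Real.log n ≠ 0 := (Real.log_pos (by exact_mod_cast (by omega : 1 < n))).ne'
  field_simp

/-- A relative bound for the discrepancy up to `N / 2` propagates to `N`. -/
lemma abs_discrepancy_le_of_forall_half {Y q N T : ℕ} [NeZero q] {E : ℝ} (hE : 0 ≤ E) (hN : 1 ≤ N)
    (h : ∀ k, T ≤ k → k ≤ N / 2 → ∀ u : (ZMod q)ˣ,
      |discrepancy Y u k| ≤ E * (smoothCount Y q k / q.totient)) (u : (ZMod q)ˣ) :
    |discrepancy Y u N| ≤
      E * (smoothCount Y q N / q.totient) + T * (Y * Nat.log 2 N) + 1 := by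
  have hφ : (0 : ℝ) < q.totient := by
    exact_mod_cast Nat.totient_pos.2 (Nat.pos_of_ne_zero (NeZero.ne q))
  have hd : ∀ d ∈ Icc 1 N, |Λ d * ∑ m ∈ Icc 1 (N / d),
        smoothDisc Y u (d * m) / Real.log (d * m : ℕ)| ≤
      E / q.totient * (Λ d * ∑ m ∈ Icc 1 (N / d), smoothInd Y q (d * m) / Real.log (d * m : ℕ)) +
        if IsPrimePow d ∧ d.minFac ∈ Icc 1 Y then (T : ℝ) else 0 := by
    intro d hd
    rw [mem_Icc] at hd
    by_cases hp : IsPrimePow d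
    swap
    · rw [ArithmeticFunction.vonMangoldt_eq_zero_iff.2 hp]
      simp [hp]
    have hd2 : 2 ≤ d := hp.two_le
    have hd0 : d ≠ 0 := by omega
    set u' := (residueUnit q d)⁻¹ * u with hu'
    set f : ℕ → ℝ := fun m => 1 / Real.log (d * m : ℕ) with hf
    have hlog : ∀ m, 1 ≤ m → 0 < Real.log (d * m : ℕ) := fun m hm => by
      refine Real.log_pos ?_
      have := Nat.mul_le_mul hd2 hm
      exact_mod_cast (by omega : 1 < d * m)
    set g : ℕ → ℝ := fun m => E / q.totient * smoothInd Y q m + if m ≤ T then 1 else 0 with hg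
    have h1 : |∑ m ∈ Icc 1 (N / d), smoothDisc Y u' m * f m| ≤
        ∑ m ∈ Icc 1 (N / d), g m * f m := by
      refine abs_sum_mul_le_of_antitone (fun k hk hkN => ?_)
        (fun m hm _ => (one_div_pos.2 (hlog m hm)).le) fun m hm _ => ?_
      · rw [hg, Finset.sum_add_distrib, ← Finset.mul_sum]
        rcases le_or_gt T k with hTk | hTk
        · have h2 := h k hTk (hkN.trans (Nat.div_le_div_left hd2 (by norm_num))) u'
          have h3 : 0 ≤ ∑ m ∈ Icc 1 k, (if m ≤ T then 1 else 0 : ℝ) :=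
            Finset.sum_nonneg fun m _ => by split_ifs <;> norm_num
          have h4 : E * (smoothCount Y q k / q.totient) =
            E / q.totient * ∑ m ∈ Icc 1 k, smoothInd Y q m := by rw [smoothCount]; ring
          rw [discrepancy, h4] at h2
          linarith
        · have h2 : |∑ m ∈ Icc 1 k, smoothDisc Y u' m| ≤
              ∑ m ∈ Icc 1 k, (if m ≤ T then 1 else 0 : ℝ) := by
            refine (Finset.abs_sum_le_sum_abs _ _).trans (Finset.sum_le_sum fun m hm => ?_)
            rw [mem_Icc] at hm
            rw [if_pos (by omega)]
            exact abs_smoothDisc_le_one u' m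
          have h3 : 0 ≤ E / q.totient * ∑ m ∈ Icc 1 k, smoothInd Y q m :=
            mul_nonneg (by positivity) (smoothCount_nonneg Y q k)
          linarith
      · refine one_div_le_one_div_of_le (hlog m hm) (Real.log_le_log ?_ ?_)
        · exact_mod_cast Nat.mul_pos (by omega : 0 < d) hm
        · exact_mod_cast Nat.mul_le_mul_left d (Nat.le_succ m)
    have e1 : ∑ m ∈ Icc 1 (N / d), smoothDisc Y u (d * m) / Real.log (d * m : ℕ) =
        smoothInd Y q d * ∑ m ∈ Icc 1 (N / d), smoothDisc Y u' m * f m := by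
      rw [Finset.mul_sum]
      refine Finset.sum_congr rfl fun m hm => ?_
      rw [mem_Icc] at hm
      rw [smoothDisc_mul hd0 (by omega), hf]
      ring
    have e2 : smoothInd Y q d * ∑ m ∈ Icc 1 (N / d), g m * f m =
        E / q.totient * ∑ m ∈ Icc 1 (N / d), smoothInd Y q (d * m) / Real.log (d * m : ℕ) +
          smoothInd Y q d * ∑ m ∈ Icc 1 (N / d), (if m ≤ T then f m else 0) := by
      rw [Finset.mul_sum, Finset.mul_sum, Finset.mul_sum, ← Finset.sum_add_distrib]
      refine Finset.sum_congr rfl fun m hm => ?_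
      rw [mem_Icc] at hm
      rw [smoothInd_mul hd0 (by omega)]
      simp only [hg, hf]
      split_ifs <;> ring
    have h2 : Λ d * (smoothInd Y q d * ∑ m ∈ Icc 1 (N / d), (if m ≤ T then f m else 0)) ≤
        if IsPrimePow d ∧ d.minFac ∈ Icc 1 Y then (T : ℝ) else 0 := by
      by_cases hs : d.minFac ∈ Icc 1 Y
      · rw [if_pos ⟨hp, hs⟩]
        calc _ = smoothInd Y q d * ∑ m ∈ Icc 1 (N / d), (if m ≤ T then Λ d * f m else 0) := by
              rw [mul_left_comm, Finset.mul_sum]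
              simp only [mul_ite, mul_zero]
          _ ≤ 1 * ∑ m ∈ Icc 1 T, (1 : ℝ) := by
              refine mul_le_mul (smoothInd_le_one Y q d) ?_ ?_ zero_le_one
              · rw [← Finset.sum_filter]
                refine (Finset.sum_le_sum (g := fun _ => (1 : ℝ)) fun m hm => ?_).trans
                  (Finset.sum_le_sum_of_subset_of_nonneg (fun m hm => ?_)
                    fun _ _ _ => zero_le_one)
                · rw [mem_filter, mem_Icc] at hm
                  rw [hf, mul_one_div, div_le_one (hlog m hm.1.1)]
                  exact ArithmeticFunction.vonMangoldt_le_log.trans (Real.log_le_log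
                    (by exact_mod_cast hd.1)
                    (by exact_mod_cast Nat.le_mul_of_pos_right d hm.1.1))
                · rw [mem_filter, mem_Icc] at hm
                  exact mem_Icc.2 ⟨hm.1.1, hm.2⟩
              · refine Finset.sum_nonneg fun m hm => ?_
                rw [mem_Icc] at hm
                split_ifs
                · exact mul_nonneg ArithmeticFunction.vonMangoldt_nonneg
                    (one_div_pos.2 (hlog m hm.1)).le
                · rfl
          _ = T := by simp
      · have : smoothInd Y q d = 0 := by
          rw [smoothInd, if_neg]
          rintro ⟨hsm, -⟩
          have hpr := Nat.minFac_prime hp.ne_one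
          exact hs (mem_Icc.2 ⟨hpr.one_le,
            hsm _ (Nat.mem_primeFactors.2 ⟨hpr, Nat.minFac_dvd d, hd0⟩)⟩)
        rw [this, if_neg fun hc => hs hc.2]
        simp
    have h3 := mul_le_mul_of_nonneg_left
      (mul_le_mul_of_nonneg_left h1 (smoothInd_nonneg Y q d))
      (ArithmeticFunction.vonMangoldt_nonneg (n := d))
    rw [e2] at h3
    rw [e1, abs_mul, abs_mul, abs_of_nonneg ArithmeticFunction.vonMangoldt_nonneg,
      abs_of_nonneg (smoothInd_nonneg Y q d)]
    linarith
  have h1 := (Finset.abs_sum_le_sum_abs _ _).trans (Finset.sum_le_sum hd)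
  rw [Finset.sum_add_distrib, ← Finset.mul_sum, ← Finset.sum_filter, Finset.sum_const,
    nsmul_eq_mul] at h1
  have h2 := sum_eq_add_sum_vonMangoldt_mul (smoothInd Y q) hN
  have h3 := sum_eq_add_sum_vonMangoldt_mul (smoothDisc Y u) hN
  have h4 : (((Icc 1 N).filter (fun d => IsPrimePow d ∧ d.minFac ∈ Icc 1 Y)).card : ℝ) * T ≤
      T * (Y * Nat.log 2 N) := by
    have := card_primePow_le (Icc 1 Y) N
    rw [Nat.card_Icc, Nat.add_sub_cancel] at this
    rw [mul_comm]
    exact mul_le_mul_of_nonneg_left (by exact_mod_cast this) (Nat.cast_nonneg T)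
  have h5 : E / q.totient * ∑ d ∈ Icc 1 N, Λ d *
        ∑ m ∈ Icc 1 (N / d), smoothInd Y q (d * m) / Real.log (d * m : ℕ) ≤
      E * (smoothCount Y q N / q.totient) := by
    rw [smoothCount, h2, mul_div_assoc', div_mul_eq_mul_div]
    gcongr
    linarith [smoothInd_nonneg Y q 1]
  rw [discrepancy, h3]
  refine (abs_add_le _ _).trans ?_
  linarith [abs_smoothDisc_le_one (Y := Y) u 1]

lemma exists_abs_discrepancy_le_of_pow_le (b : ℕ) :
    ∃ C : ℝ, 0 < C ∧ ∃ Y₀ : ℕ, ∀ Y q : ℕ, Y₀ ≤ Y → 2 ≤ q → q ≤ Y ^ b → ∀ N : ℕ,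
      Y ^ (b + 1) ≤ N → ∀ u : (ZMod q)ˣ, |discrepancy Y u N| ≤
        C * (Real.log q / Real.log Y) * (smoothCount Y q N / q.totient) := by
  obtain ⟨C, hC, Y₁, h1⟩ := exists_abs_discrepancy_le_of_le_pow b (2 * (2 * b + 4) + b + 7)
    (by omega)
  obtain ⟨Y₂, h2⟩ := exists_pow_mul_log_pow_le_smoothCount b (2 * b + 4)
  refine ⟨2 * (C + 1), by positivity, Y₁ + Y₂ + 8, fun Y q hY hq hqY => ?_⟩
  have : NeZero q := ⟨by omega⟩
  have hY8 : (8 : ℝ) ≤ Y := by exact_mod_cast (by omega : 8 ≤ Y)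
  have hφ : (0 : ℝ) < q.totient := by exact_mod_cast Nat.totient_pos.2 (by omega)
  have hφY : (q.totient : ℝ) ≤ (Y : ℝ) ^ b := by
    exact_mod_cast (Nat.totient_le q).trans hqY
  have hlY : 0 < Real.log Y := Real.log_pos (by linarith)
  have hlq : 1 / 2 ≤ Real.log q := by
    have h1 := Real.log_two_gt_d9
    have h2 := Real.log_le_log (by norm_num) (by exact_mod_cast hq : (2 : ℝ) ≤ q)
    linarith
  set δ := Real.log q / Real.log Y with hδ
  have hδ0 : 0 < δ := by positivity
  have hδY : 1 ≤ 2 * Y * δ := by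
    rw [hδ, mul_div_assoc', le_div_iff₀ hlY]
    have := Real.log_le_sub_one_of_pos (by linarith : (0 : ℝ) < Y)
    nlinarith
  suffices h : ∀ N : ℕ, Y ^ (b + 1) ≤ N → ∀ u : (ZMod q)ˣ, |discrepancy Y u N| ≤
      (C + 1) * δ * (2 - 1 / (Nat.log 2 N + 1)) * (smoothCount Y q N / q.totient) by
    intro N hN u
    refine (h N hN u).trans ?_
    have h3 : 0 ≤ smoothCount Y q N / q.totient := div_nonneg (smoothCount_nonneg Y q N) hφ.le
    have h4 : (0 : ℝ) ≤ 1 / (Nat.log 2 N + 1) := by positivity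
    calc _ ≤ (C + 1) * δ * 2 * (smoothCount Y q N / q.totient) := by gcongr; linarith
      _ = _ := by ring
  intro N
  induction N using Nat.strong_induction_on with
  | _ N ih =>
    intro hN u
    have hYN : Y ≤ N := (Nat.le_self_pow (by omega) Y).trans hN
    have hqN : q ≤ N := hqY.trans ((Nat.pow_le_pow_right (by omega) (by omega)).trans hN)
    have hS := div_nonneg (smoothCount_nonneg Y q N) hφ.le
    rcases le_or_gt N (Y ^ (2 * (2 * b + 4) + b + 7)) with hNB | hNB
    · refine (h1 Y q N (by omega) hq hqY hqN hYN hNB u).trans ?_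
      have h3 : 1 / ((Nat.log 2 N : ℝ) + 1) ≤ 1 := by
        rw [div_le_one (by positivity)]
        linarith [(Nat.cast_nonneg (Nat.log 2 N) : (0 : ℝ) ≤ _)]
      refine mul_le_mul_of_nonneg_right ?_ hS
      calc C * δ ≤ (C + 1) * δ * 1 := by rw [mul_one]; gcongr; linarith
        _ ≤ _ := by gcongr; linarith
    set j := Nat.log 2 N with hj
    have hj1 : 1 ≤ j := Nat.log_pos (by norm_num) (by omega)
    have hj1' : (1 : ℝ) ≤ j := by exact_mod_cast hj1
    have hj2 : 1 / (j : ℝ) ≤ 1 := by rw [div_le_one (by linarith)]; exact hj1'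
    have h3 := abs_discrepancy_le_of_forall_half (Y := Y) (q := q) (N := N) (T := Y ^ (b + 1))
      (E := (C + 1) * δ * (2 - 1 / j)) (mul_nonneg (by positivity) (by linarith)) (by omega)
      (fun k hTk hkN v => by
        refine (ih k (by omega) hTk v).trans ?_
        have h4 : Nat.log 2 k + 1 ≤ j := by
          have := Nat.log_mono_right (b := 2) hkN
          rw [Nat.log_div_base] at this
          omega
        have h5 : (Nat.log 2 k : ℝ) + 1 ≤ j := by exact_mod_cast h4
        refine mul_le_mul_of_nonneg_right ?_ (div_nonneg (smoothCount_nonneg Y q k) hφ.le)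
        gcongr) u
    refine h3.trans ?_
    have h4 := h2 Y q N (by omega) (by omega) hqY hNB.le
    have h5 : ((Y ^ (b + 1) : ℕ) : ℝ) * (Y * j) + 1 ≤
        (C + 1) * δ * (1 / j - 1 / (j + 1)) * (smoothCount Y q N / q.totient) := by
      have e : (C + 1) * δ * (1 / (j : ℝ) - 1 / (j + 1)) * (smoothCount Y q N / q.totient) =
          (C + 1) * (δ * smoothCount Y q N) / (j * (j + 1) * q.totient) := by
        field_simp
        ring
      rw [e, le_div_iff₀ (by positivity)]
      have a1 : (1 : ℝ) ≤ (Y : ℝ) ^ (b + 2) := one_le_pow₀ (by linarith)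
      calc (((Y ^ (b + 1) : ℕ) : ℝ) * (Y * j) + 1) * (j * (j + 1) * q.totient)
          ≤ ((Y : ℝ) ^ (b + 2) * j + (Y : ℝ) ^ (b + 2) * j) * (j * (j + j) * (Y : ℝ) ^ b) := by
            have a2 : ((Y ^ (b + 1) : ℕ) : ℝ) * (Y * j) = (Y : ℝ) ^ (b + 2) * j := by
              push_cast
              ring
            rw [a2]
            gcongr
            nlinarith
        _ = (Y : ℝ) ^ (2 * b + 2) * 4 * (j : ℝ) ^ 3 := by ring
        _ ≤ (Y : ℝ) ^ (2 * b + 2) * (Y * Y * δ) * (j : ℝ) ^ 3 := by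
            gcongr
            nlinarith
        _ = 1 * (δ * ((Y : ℝ) ^ (2 * b + 4) * (j : ℝ) ^ 3)) := by ring
        _ ≤ (C + 1) * (δ * smoothCount Y q N) := by gcongr; linarith
    linarith

lemma exists_abs_discrepancy_le (b : ℕ) :
    ∃ C : ℝ, 0 < C ∧ ∃ Y₀ : ℕ, ∀ Y q N : ℕ, Y₀ ≤ Y → 2 ≤ q → q ≤ Y ^ b → q ≤ N → Y ≤ N →
      ∀ u : (ZMod q)ˣ, |discrepancy Y u N| ≤
        C * (Real.log q / Real.log Y) * (smoothCount Y q N / q.totient) := by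
  obtain ⟨C₁, hC₁, Y₁, h1⟩ := exists_abs_discrepancy_le_of_le_pow b (b + 1) (by omega)
  obtain ⟨C₂, hC₂, Y₂, h2⟩ := exists_abs_discrepancy_le_of_pow_le b
  refine ⟨C₁ + C₂, by positivity, Y₁ + Y₂, fun Y q N hY hq hqY hqN hYN u => ?_⟩
  have hS : 0 ≤ Real.log q / Real.log Y * (smoothCount Y q N / q.totient) :=
    mul_nonneg (div_nonneg (Real.log_natCast_nonneg q) (Real.log_natCast_nonneg Y))
      (div_nonneg (smoothCount_nonneg Y q N) (Nat.cast_nonneg _))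
  have hS1 := mul_nonneg hC₁.le hS
  have hS2 := mul_nonneg hC₂.le hS
  rcases le_or_gt N (Y ^ (b + 1)) with hN | hN
  · linarith [h1 Y q N (by omega) hq hqY hqN hYN hN u]
  · linarith [h2 Y q (by omega) hq hqY N hN.le u]

lemma abs_discrepancy_le_smoothCount {Y q : ℕ} [NeZero q] (u : (ZMod q)ˣ) (N : ℕ) :
    |discrepancy Y u N| ≤ smoothCount Y q N := by
  have h := abs_sum_smoothDisc_mul_le (Y := Y) u (s := Icc 1 N) (g := fun _ => 1)
    (M := smoothCount Y q N) (fun _ _ => zero_le_one) fun v => Finset.sum_le_sum fun n _ => by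
      rw [mul_one]
      split_ifs
      · rfl
      · exact smoothInd_nonneg Y q n
  simpa only [mul_one, discrepancy] using h

lemma discrepancy_one (Y : ℕ) (u : (ZMod 1)ˣ) (N : ℕ) : discrepancy Y u N = 0 :=
  Finset.sum_eq_zero fun n _ => by
    rw [smoothDisc, if_pos (Subsingleton.elim _ _)]
    simp

lemma forall_primeFactors_cast_le_iff {y : ℝ} (hy : 0 ≤ y) (n : ℕ) :
    (∀ p ∈ n.primeFactors, (p : ℝ) ≤ y) ↔ HasSmallFactors ⌊y⌋₊ n := by
  simp only [HasSmallFactors, Nat.le_floor_iff hy]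

lemma psiCoprime_eq_smoothCount {x y : ℝ} (hy : 0 ≤ y) (q : ℕ) :
    (PsiCoprime x y q : ℝ) = smoothCount ⌊y⌋₊ q ⌊x⌋₊ := by
  simp only [PsiCoprime, smoothCount, smoothInd, forall_primeFactors_cast_le_iff hy,
    Finset.card_filter, Nat.cast_sum, Nat.cast_ite, Nat.cast_one, Nat.cast_zero]

lemma psiMod_eq_sum_smoothInd {x y : ℝ} (hy : 0 ≤ y) {q : ℕ} {a : ℤ} {u : (ZMod q)ˣ}
    (hu : (u : ZMod q) = a) :
    (PsiMod x y q a : ℝ) =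
      ∑ n ∈ Icc 1 ⌊x⌋₊, (if (n : ZMod q) = u then smoothInd ⌊y⌋₊ q n else 0) := by
  simp only [PsiMod, forall_primeFactors_cast_le_iff hy, Finset.card_filter, Nat.cast_sum,
    Nat.cast_ite, Nat.cast_one, Nat.cast_zero]
  refine Finset.sum_congr rfl fun n _ => ?_
  have h1 : (n : ℤ) % (q : ℤ) = a % (q : ℤ) ↔ (n : ZMod q) = u := by
    rw [hu, ← ZMod.intCast_eq_intCast_iff', Int.cast_natCast]
  simp only [h1, smoothInd]
  by_cases h2 : (n : ZMod q) = u
  · have hc : n.Coprime q := (ZMod.isUnit_iff_coprime n q).1 (h2 ▸ u.isUnit)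
    rw [if_pos h2]
    exact if_congr (and_congr_right fun _ => iff_of_true h2 hc) rfl rfl
  · simp [h2]

lemma psiMod_sub_eq_discrepancy {x y : ℝ} (hy : 0 ≤ y) {q : ℕ} {a : ℤ} {u : (ZMod q)ˣ}
    (hu : (u : ZMod q) = a) :
    (PsiMod x y q a : ℝ) - (PsiCoprime x y q : ℝ) / (q.totient : ℝ) =
      discrepancy ⌊y⌋₊ u ⌊x⌋₊ := by
  rw [discrepancy_eq, psiMod_eq_sum_smoothInd hy hu, psiCoprime_eq_smoothCount hy]

/-- Smooth numbers in arithmetic progressions (Granville). -/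
theorem smooth_in_arithmetic_progressions (β : ℝ) (hβ : 0 < β) :
    ∃ C : ℝ, 0 < C ∧ ∀ x y : ℝ, ∀ q : ℕ, ∀ a : ℤ,
      2 ≤ y → y ≤ x → 1 ≤ q → (q : ℝ) ≤ x → (q : ℝ) ≤ y ^ β → Int.gcd a (q : ℤ) = 1 →
      |(PsiMod x y q a : ℝ) - (PsiCoprime x y q : ℝ) / (Nat.totient q : ℝ)| ≤
        C * ((PsiCoprime x y q : ℝ) / (Nat.totient q : ℝ)) * (Real.log q / Real.log y) := by
  set b := ⌈2 * β⌉₊ with hb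
  obtain ⟨C, hC, Y₀, h⟩ := exists_abs_discrepancy_le b
  refine ⟨2 * C + 2 * Y₀ ^ b * Y₀, by positivity, fun x y q a hy hyx hq hqx hqy ha => ?_⟩
  have : NeZero q := ⟨by omega⟩
  have hy0 : 0 ≤ y := by linarith
  have hu := ZMod.coe_unitOfIsCoprime a (Int.isCoprime_iff_gcd_eq_one.2 ha)
  rw [psiMod_sub_eq_discrepancy hy0 hu, psiCoprime_eq_smoothCount hy0]
  generalize ZMod.unitOfIsCoprime a (Int.isCoprime_iff_gcd_eq_one.2 ha) = u
  rcases hq.eq_or_lt with rfl | hq2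
  · rw [discrepancy_one]
    simp
  set Y := ⌊y⌋₊ with hY
  set N := ⌊x⌋₊ with hN
  have hY2 : 2 ≤ Y := Nat.le_floor (by exact_mod_cast hy)
  have hY2' : (2 : ℝ) ≤ Y := by exact_mod_cast hY2
  have hYN : Y ≤ N := Nat.floor_mono hyx
  have hqN : q ≤ N := Nat.le_floor hqx
  have hyY : y < Y + 1 := Nat.lt_floor_add_one y
  have hyY2 : y ≤ (Y : ℝ) ^ 2 := by nlinarith
  have hqY : q ≤ Y ^ b := by
    have h1 : (q : ℝ) ≤ (Y : ℝ) ^ b := by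
      calc (q : ℝ) ≤ y ^ β := hqy
        _ ≤ ((Y : ℝ) ^ 2) ^ β := Real.rpow_le_rpow hy0 hyY2 hβ.le
        _ = (Y : ℝ) ^ (2 * β) := by
          rw [← Real.rpow_natCast, ← Real.rpow_mul (by linarith), Nat.cast_ofNat]
        _ ≤ (Y : ℝ) ^ (b : ℝ) := Real.rpow_le_rpow_of_exponent_le (by linarith) (Nat.le_ceil _)
        _ = (Y : ℝ) ^ b := Real.rpow_natCast _ _
    exact_mod_cast h1
  have hlY : 0 < Real.log Y := Real.log_pos (by linarith)
  have hly : 0 < Real.log y := Real.log_pos (by linarith)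
  have hlyY : Real.log y ≤ 2 * Real.log Y := by
    have := Real.log_le_log (by linarith) hyY2
    rwa [Real.log_pow] at this
  have hlq : 1 / 2 ≤ Real.log q := by
    have h1 := Real.log_two_gt_d9
    have h2 := Real.log_le_log (by norm_num) (by exact_mod_cast hq2 : (2 : ℝ) ≤ q)
    linarith
  have hφ : (0 : ℝ) < q.totient := by exact_mod_cast Nat.totient_pos.2 hq
  set R := smoothCount Y q N / q.totient with hR
  have hR0 : 0 ≤ R := div_nonneg (smoothCount_nonneg Y q N) hφ.le
  have hδ0 : 0 ≤ Real.log q / Real.log y := by positivity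
  rcases le_or_gt Y₀ Y with hYY | hYY
  · have h1 : Real.log q / Real.log Y ≤ 2 * (Real.log q / Real.log y) := by
      rw [mul_div_assoc', div_le_div_iff₀ hlY hly]
      nlinarith
    calc |discrepancy Y u N| ≤ C * (Real.log q / Real.log Y) * R := h Y q N hYY hq2 hqY hqN hYN u
      _ ≤ C * (2 * (Real.log q / Real.log y)) * R := by gcongr
      _ = 2 * C * R * (Real.log q / Real.log y) := by ring
      _ ≤ _ := by
        gcongr
        exact le_add_of_nonneg_right (by positivity)
  · have h1 : 1 ≤ 2 * Y₀ * (Real.log q / Real.log y) := by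
      rw [mul_div_assoc', le_div_iff₀ hly]
      have h2 := Real.log_le_sub_one_of_pos (by linarith : 0 < y)
      have h3 : (Y : ℝ) + 1 ≤ Y₀ := by exact_mod_cast hYY
      nlinarith
    have h2 : (q.totient : ℝ) ≤ (Y₀ : ℝ) ^ b := by
      exact_mod_cast (Nat.totient_le q).trans (hqY.trans (Nat.pow_le_pow_left hYY.le b))
    calc |discrepancy Y u N| ≤ smoothCount Y q N := abs_discrepancy_le_smoothCount u N
      _ = q.totient * R * 1 := by rw [hR]; field_simp
      _ ≤ (Y₀ : ℝ) ^ b * R * (2 * Y₀ * (Real.log q / Real.log y)) := by gcongr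
      _ = 2 * (Y₀ : ℝ) ^ b * Y₀ * R * (Real.log q / Real.log y) := by ring
      _ ≤ _ := by
        gcongr
        exact le_add_of_nonneg_left (by positivity)
end

section
/- Let w ≥ 2 be real, W := ∏_{p ≤ w, p prime} p, α ∈ (0, 1) real, b₂ an integer with gcd(b₂, W) = 1, q a positive integer, and a an integer with gcd(a, q) = 1. For each residue class r modulo q set d_r := gcd(Wr − b₂, Wq) and γ_{r,q} := ∏_{p | W} (1 − p^{−1})/(1 − p^{−α}) · ∏_{p | (Wq/d_r)} (1 − p^{−α})/(1 − p^{−1}), and define σ_{a,q} := Σ_{r mod q} e(ar/q) γ_{r,q}. Then: if gcd(q, W) = 1, one has σ_{a,q} = e(a b₂ W̄ / q) · ∏_{p | q} (p^{−α} − p^{−1})/(1 − p^{−1}), where W̄ denotes the inverse of W modulo q; and if gcd(q, W) > 1, one has σ_{a,q} = 0. -/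
open scoped Classical

/-- `e(x) = e^{2πix}`. -/
noncomputable def eC (x : ℝ) : ℂ := Complex.exp (2 * Real.pi * Complex.I * x)

/-- `∏_{p ≤ w, p prime} p`. -/
noncomputable def primorialBelow (w : ℝ) : ℕ :=
  ∏ p ∈ (Finset.range (⌊w⌋₊ + 1)).filter (fun (p : ℕ) => p.Prime ∧ (p : ℝ) ≤ w), p

theorem eC_add (x y : ℝ) : eC (x + y) = eC x * eC y := by
  unfold eC
  rw [← Complex.exp_add]
  congr 1
  push_cast
  ring

theorem eC_intCast (n : ℤ) : eC n = 1 := by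
  unfold eC
  rw [Complex.exp_eq_one_iff]
  exact ⟨n, by push_cast; ring⟩

theorem eC_intCast_div_eq_one_iff {q : ℕ} (hq : q ≠ 0) (n : ℤ) :
    eC ((n : ℝ) / q) = 1 ↔ (q : ℤ) ∣ n := by
  have hq' : (q : ℝ) ≠ 0 := by exact_mod_cast hq
  constructor
  · intro h
    unfold eC at h
    rw [Complex.exp_eq_one_iff] at h
    obtain ⟨m, hm⟩ := h
    have h1 : ((((n : ℝ) / q : ℝ)) : ℂ) = ((m : ℝ) : ℂ) := by
      apply mul_left_cancel₀ Complex.two_pi_I_ne_zero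
      rw [hm]
      push_cast
      ring
    have h2 : (n : ℝ) / q = m := by exact_mod_cast h1
    rw [div_eq_iff hq'] at h2
    exact ⟨m, by rw [mul_comm]; exact_mod_cast h2⟩
  · rintro ⟨m, rfl⟩
    rw [← eC_intCast m]
    congr 1
    push_cast
    field_simp

theorem eC_intCast_div_congr {q : ℕ} (hq : q ≠ 0) {m n : ℤ} (h : (q : ℤ) ∣ m - n) :
    eC ((m : ℝ) / q) = eC ((n : ℝ) / q) := by
  have h1 := (eC_intCast_div_eq_one_iff hq (m - n)).2 h
  have h2 : (m : ℝ) / q = ((m - n : ℤ) : ℝ) / q + (n : ℝ) / q := by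
    push_cast
    ring
  rw [h2, eC_add, h1, one_mul]

theorem sum_range_add_of_periodic {M : Type*} [AddCommGroup M] {q : ℕ} {F : ℕ → M}
    (hF : ∀ r, F (r + q) = F r) (D : ℕ) :
    ∑ r ∈ Finset.range q, F (r + D) = ∑ r ∈ Finset.range q, F r := by
  induction D with
  | zero => rfl
  | succ D ih =>
    rw [← ih]
    have h1 := Finset.sum_range_succ (fun r => F (r + D)) q
    have h2 := Finset.sum_range_succ' (fun r => F (r + D)) q
    have h3 : F (q + D) = F (0 + D) := by rw [add_comm q D, hF, zero_add]
    rw [h1, h3] at h2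
    simpa [add_assoc, add_comm 1 D] using (add_right_cancel h2).symm

/-- An additive character sum over an arithmetic condition modulo a proper divisor vanishes. -/
theorem sum_eC_ite_dvd_eq_zero {q D : ℕ} (hq : q ≠ 0) (hDq : D ∣ q) (hne : D ≠ q) {a : ℤ}
    (ha : Int.gcd a q = 1) (W b : ℤ) :
    ∑ r ∈ Finset.range q, eC (((a * (r : ℤ) : ℤ) : ℝ) / q) *
      (if (D : ℤ) ∣ W * r - b then 1 else 0) = 0 := by
  set F : ℕ → ℂ := fun r => eC (((a * (r : ℤ) : ℤ) : ℝ) / q) *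
      (if (D : ℤ) ∣ W * r - b then 1 else 0) with hFdef
  have shift : ∀ E : ℕ, D ∣ E → ∀ r, F (r + E) = eC (((a * (E : ℤ) : ℤ) : ℝ) / q) * F r := by
    intro E hE r
    have hE' : (D : ℤ) ∣ W * E := (Int.natCast_dvd_natCast.2 hE).mul_left W
    have hiff : (D : ℤ) ∣ W * ((r + E : ℕ) : ℤ) - b ↔ (D : ℤ) ∣ W * r - b := by
      have : W * ((r + E : ℕ) : ℤ) - b = (W * r - b) + W * E := by push_cast; ring
      rw [this]
      exact dvd_add_left hE'
    have hsplit : ((a * ((r + E : ℕ) : ℤ) : ℤ) : ℝ) / q =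
        ((a * (E : ℤ) : ℤ) : ℝ) / q + ((a * (r : ℤ) : ℤ) : ℝ) / q := by
      push_cast
      ring
    simp only [hFdef, hiff]
    rw [hsplit, eC_add, mul_assoc]
  have hper : ∀ r, F (r + q) = F r := by
    intro r
    rw [shift q hDq, (eC_intCast_div_eq_one_iff hq _).2 (dvd_mul_left _ _), one_mul]
  have hsum := sum_range_add_of_periodic hper D
  simp_rw [shift D dvd_rfl, ← Finset.mul_sum] at hsum
  have hc : eC (((a * (D : ℤ) : ℤ) : ℝ) / q) ≠ 1 := by
    intro h
    rw [eC_intCast_div_eq_one_iff hq] at h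
    have h2 : (q : ℤ) ∣ D :=
      (Int.isCoprime_iff_gcd_eq_one.2 ha).symm.dvd_of_dvd_mul_left h
    exact hne (Nat.dvd_antisymm hDq (Int.natCast_dvd_natCast.1 h2))
  by_contra hS
  exact hc ((mul_eq_right₀ hS).1 hsum)

theorem sum_eC_ite_dvd_self {q : ℕ} (hq : q ≠ 0) (a b : ℤ) {W V : ℤ}
    (hWV : (q : ℤ) ∣ W * V - 1) :
    ∑ r ∈ Finset.range q, eC (((a * (r : ℤ) : ℤ) : ℝ) / q) *
      (if (q : ℤ) ∣ W * r - b then 1 else 0) = eC (((a * b * V : ℤ) : ℝ) / q) := by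
  have hq0 : (q : ℤ) ≠ 0 := by exact_mod_cast hq
  have hqpos : (0 : ℤ) < q := by positivity
  have hnn := Int.emod_nonneg (b * V) hq0
  have hlt := Int.emod_lt_of_pos (b * V) hqpos
  obtain ⟨r₀, hr₀⟩ := Int.eq_ofNat_of_zero_le hnn
  have hr₀lt : r₀ < q := by rw [hr₀] at hlt; exact_mod_cast hlt
  have hmod : (q : ℤ) ∣ r₀ - b * V := by
    rw [← hr₀]
    exact ⟨-(b * V / q), by linarith [Int.emod_add_mul_ediv (b * V) q]⟩
  rw [Finset.sum_eq_single r₀]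
  · have hdvd : (q : ℤ) ∣ W * r₀ - b := by
      have : W * r₀ - b = W * (r₀ - b * V) + b * (W * V - 1) := by ring
      rw [this]
      exact dvd_add (hmod.mul_left _) (hWV.mul_left _)
    rw [if_pos hdvd, mul_one]
    apply eC_intCast_div_congr hq
    have : a * (r₀ : ℤ) - a * b * V = a * (r₀ - b * V) := by ring
    rw [this]
    exact hmod.mul_left _
  · intro r hr hne
    rw [if_neg, mul_zero]
    intro hdvd
    apply hne
    have h1 : (q : ℤ) ∣ (r : ℤ) - r₀ := by
      have : (r : ℤ) - r₀ = V * (W * r - b) - r * (W * V - 1) - (r₀ - b * V) := by ring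
      rw [this]
      exact dvd_sub (dvd_sub (hdvd.mul_left _) (hWV.mul_left _)) hmod
    have h2 : r₀ ≡ r [MOD q] := (Nat.modEq_iff_dvd).2 h1
    exact (h2.eq_of_lt_of_lt hr₀lt (Finset.mem_range.1 hr)).symm
  · intro h
    exact absurd (Finset.mem_range.2 hr₀lt) h

theorem dvd_div_iff_not_ordProj_dvd {p n d : ℕ} (hp : p.Prime) (hn : n ≠ 0) (hd : d ∣ n) :
    p ∣ n / d ↔ ¬ p ^ n.factorization p ∣ d := by
  have hd0 : d ≠ 0 := ne_zero_of_dvd_ne_zero hn hd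
  have hnd : n / d ≠ 0 := (Nat.div_pos (Nat.le_of_dvd (Nat.pos_of_ne_zero hn) hd)
    (Nat.pos_of_ne_zero hd0)).ne'
  rw [hp.dvd_iff_one_le_factorization hnd, Nat.factorization_div hd,
    hp.pow_dvd_iff_le_factorization hd0, Finsupp.coe_tsub, Pi.sub_apply]
  omega

theorem primeFactors_mul_div_gcd {W q : ℕ} (hW : W ≠ 0) (hq : q ≠ 0) {b : ℤ}
    (hb : Int.gcd b W = 1) (r : ℤ) :
    ((W * q) / Int.gcd ((W : ℤ) * r - b) ((W : ℤ) * (q : ℤ))).primeFactors =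
      W.primeFactors ∪ (q.primeFactors \ W.primeFactors).filter
        (fun p => ¬ ((p ^ q.factorization p : ℕ) : ℤ) ∣ (W : ℤ) * r - b) := by
  have hn : W * q ≠ 0 := mul_ne_zero hW hq
  set d := Int.gcd ((W : ℤ) * r - b) ((W : ℤ) * (q : ℤ)) with hd
  have hdn : d ∣ W * q := by
    have : (d : ℤ) ∣ (W : ℤ) * q := Int.gcd_dvd_right _ _
    exact_mod_cast this
  have hnd : W * q / d ≠ 0 := by
    intro h
    exact hn (by rw [← Nat.div_mul_cancel hdn, h, zero_mul])
  ext p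
  by_cases hp : p.Prime
  swap
  · simp [hp]
  have hdvd : p ^ (W * q).factorization p ∣ d ↔
      ((p ^ (W * q).factorization p : ℕ) : ℤ) ∣ (W : ℤ) * r - b := by
    rw [hd, Int.dvd_gcd_iff]
    constructor
    · exact fun h => h.1
    · refine fun h => ⟨h, ?_⟩
      have := Nat.ordProj_dvd (W * q) p
      exact_mod_cast this
  have hmem : p ∈ (W * q / d).primeFactors ↔
      ¬ ((p ^ (W * q).factorization p : ℕ) : ℤ) ∣ (W : ℤ) * r - b := by
    rw [← hdvd, ← dvd_div_iff_not_ordProj_dvd hp hn hdn]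
    simp [hp, hnd]
  rw [hmem, Nat.factorization_mul hW hq, Finsupp.add_apply]
  simp only [Finset.mem_union, Finset.mem_filter, Finset.mem_sdiff, Nat.mem_primeFactors, hp, hW,
    hq, true_and, ne_eq, not_false_eq_true, and_true]
  by_cases hpW : p ∣ W
  · simp only [hpW, true_or, iff_true]
    intro h
    have h1 : 1 ≤ W.factorization p := (hp.dvd_iff_one_le_factorization hW).1 hpW
    have h2 : (p : ℤ) ∣ (W : ℤ) * r - b :=
      (Int.natCast_dvd_natCast.2 (dvd_pow_self p (by omega))).trans h
    have hpW' : (p : ℤ) ∣ W := Int.natCast_dvd_natCast.2 hpW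
    have h3 : (p : ℤ) ∣ b := (dvd_sub_right (hpW'.mul_right r)).1 h2
    have h4 : p ∣ Int.gcd b W := Int.dvd_gcd_iff.2 ⟨h3, hpW'⟩
    rw [hb] at h4
    exact hp.one_lt.ne' (Nat.dvd_one.1 h4)
  · rw [Nat.factorization_eq_zero_of_not_dvd hpW, zero_add]
    simp only [hpW, false_or, not_false_eq_true, and_true]
    constructor
    · intro h
      refine ⟨?_, h⟩
      by_contra hpq
      rw [Nat.factorization_eq_zero_of_not_dvd hpq] at h
      simp at h
    · exact fun h => h.2

theorem prod_ordProj_intCast_dvd_iff {q : ℕ} {t : Finset ℕ} (ht : t ⊆ q.primeFactors) (x : ℤ) :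
    ((∏ p ∈ t, p ^ q.factorization p : ℕ) : ℤ) ∣ x ↔
      ∀ p ∈ t, ((p ^ q.factorization p : ℕ) : ℤ) ∣ x := by
  rw [Nat.cast_prod]
  refine ⟨fun h p hp => (Finset.dvd_prod_of_mem _ hp).trans h, fun h => ?_⟩
  refine Finset.prod_dvd_of_coprime (fun p hp p' hp' hne => ?_) h
  rw [Function.onFun, Nat.isCoprime_iff_coprime]
  exact Nat.Coprime.pow _ _ ((Nat.coprime_primes (Nat.prime_of_mem_primeFactors (ht hp))
    (Nat.prime_of_mem_primeFactors (ht hp'))).2 hne)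

theorem prod_ordProj_eq_self {q : ℕ} (hq : q ≠ 0) :
    ∏ p ∈ q.primeFactors, p ^ q.factorization p = q :=
  Nat.prod_factorization_pow_eq_self hq

theorem prod_ordProj_dvd {q : ℕ} (hq : q ≠ 0) {t : Finset ℕ} (ht : t ⊆ q.primeFactors) :
    ∏ p ∈ t, p ^ q.factorization p ∣ q := by
  conv_rhs => rw [← prod_ordProj_eq_self hq]
  exact Finset.prod_dvd_prod_of_subset _ _ _ ht

theorem eq_primeFactors_of_prod_ordProj_eq {q : ℕ} {t : Finset ℕ} (ht : t ⊆ q.primeFactors)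
    (h : ∏ p ∈ t, p ^ q.factorization p = q) : t = q.primeFactors := by
  refine ht.antisymm fun p hp => ?_
  have hpp := Nat.prime_of_mem_primeFactors hp
  have hdvd : p ∣ ∏ p ∈ t, p ^ q.factorization p := by
    rw [h]
    exact Nat.dvd_of_mem_primeFactors hp
  obtain ⟨p', hp', hdvd'⟩ := (hpp.prime.dvd_finsetProd_iff _).1 hdvd
  have := (Nat.prime_dvd_prime_iff_eq hpp (Nat.prime_of_mem_primeFactors (ht hp'))).1
    (hpp.dvd_of_dvd_pow hdvd')
  exact this ▸ hp'

/-- A character sum weighted by local factors at the primes of `T ⊆ q.primeFactors` expands over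
subsets of `T`; the only subset that can contribute is the set of all primes dividing `q`. -/
theorem sum_eC_mul_prod_ite {q : ℕ} {T : Finset ℕ} (hT : T ⊆ q.primeFactors)
    (g : ℕ → ℂ) (a W b : ℤ) :
    ∑ r ∈ Finset.range q, eC (((a * (r : ℤ) : ℤ) : ℝ) / q) *
      ∏ p ∈ T, (if ((p ^ q.factorization p : ℕ) : ℤ) ∣ W * r - b then 1 else g p) =
    ∑ t ∈ T.powerset, ((∏ p ∈ t, (1 - g p)) * ∏ p ∈ T \ t, g p) *
      ∑ r ∈ Finset.range q, eC (((a * (r : ℤ) : ℤ) : ℝ) / q) *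
        (if ((∏ p ∈ t, p ^ q.factorization p : ℕ) : ℤ) ∣ W * r - b then 1 else 0) := by
  simp_rw [Finset.mul_sum]
  rw [Finset.sum_comm]
  refine Finset.sum_congr rfl fun r _ => ?_
  have hsplit : ∀ p, (if ((p ^ q.factorization p : ℕ) : ℤ) ∣ W * r - b then 1 else g p) =
      (1 - g p) * (if ((p ^ q.factorization p : ℕ) : ℤ) ∣ W * r - b then 1 else 0) + g p := by
    intro p
    split_ifs <;> ring
  simp_rw [hsplit]
  rw [Finset.prod_add, Finset.mul_sum]
  refine Finset.sum_congr rfl fun t ht => ?_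
  have htq := (Finset.mem_powerset.1 ht).trans hT
  rw [Finset.prod_mul_distrib, Finset.prod_ite_zero, Finset.prod_const_one]
  simp_rw [prod_ordProj_intCast_dvd_iff htq]
  ring

theorem local_factor_num_pos {α : ℝ} (hα : 0 < α) {p : ℕ} (hp : p.Prime) :
    0 < 1 - (p : ℝ) ^ (-α) :=
  sub_pos.2 (Real.rpow_lt_one_of_one_lt_of_neg (by exact_mod_cast hp.one_lt) (neg_lt_zero.2 hα))

theorem local_factor_denom_pos {p : ℕ} (hp : p.Prime) : 0 < 1 - (p : ℝ)⁻¹ :=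
  sub_pos.2 (inv_lt_one_of_one_lt₀ (by exact_mod_cast hp.one_lt))

/-- The factors at primes dividing `W` cancel in the local density. -/
theorem local_density_eq_prod_ite {α : ℝ} (hα : 0 < α) {W q : ℕ} (hW : W ≠ 0) (hq : q ≠ 0) {b : ℤ}
    (hb : Int.gcd b W = 1) (r : ℤ) :
    (∏ p ∈ W.primeFactors, (1 - (p : ℝ)⁻¹) / (1 - (p : ℝ) ^ (-α))) *
      ∏ p ∈ ((W * q) / Int.gcd ((W : ℤ) * r - b) ((W : ℤ) * (q : ℤ))).primeFactors,
        (1 - (p : ℝ) ^ (-α)) / (1 - (p : ℝ)⁻¹) =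
    ∏ p ∈ q.primeFactors \ W.primeFactors,
      (if ((p ^ q.factorization p : ℕ) : ℤ) ∣ (W : ℤ) * r - b then 1
        else (1 - (p : ℝ) ^ (-α)) / (1 - (p : ℝ)⁻¹)) := by
  rw [primeFactors_mul_div_gcd hW hq hb, Finset.prod_union, ← mul_assoc,
    ← Finset.prod_mul_distrib, Finset.prod_eq_one, one_mul, Finset.prod_filter]
  · exact Finset.prod_congr rfl fun p _ => ite_not _ _ _
  · intro p hp
    have hpp := Nat.prime_of_mem_primeFactors hp
    have h1 := (local_factor_num_pos hα hpp).ne'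
    have h2 := (local_factor_denom_pos hpp).ne'
    rw [div_mul_div_cancel₀ h1, div_self h2]
  · exact Finset.disjoint_sdiff.mono_right (Finset.filter_subset _ _)

theorem primorialBelow_ne_zero (w : ℝ) : primorialBelow w ≠ 0 :=
  Finset.prod_ne_zero_iff.2 fun _ hp => (Finset.mem_filter.1 hp).2.1.ne_zero

/-- Evaluation of the Gauss-type sum `σ_{a,q} = Σ_{r mod q} e(ar/q) γ_{r,q}`. -/
theorem sigma_aq_evaluation (w : ℝ) (hw : 2 ≤ w) (α : ℝ) (hα : α ∈ Set.Ioo (0 : ℝ) 1)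
    (W : ℕ) (hW : W = primorialBelow w)
    (b₂ : ℤ) (hb₂ : Int.gcd b₂ (W : ℤ) = 1)
    (q : ℕ) (hq : 1 ≤ q) (a : ℤ) (ha : Int.gcd a (q : ℤ) = 1)
    (γ : ℕ → ℝ)
    (hγ : ∀ r : ℕ, γ r =
      (∏ p ∈ W.primeFactors, (1 - (p : ℝ)⁻¹) / (1 - (p : ℝ) ^ (-α))) *
        ∏ p ∈ ((W * q) / Int.gcd ((W : ℤ) * (r : ℤ) - b₂) ((W : ℤ) * (q : ℤ))).primeFactors,
          (1 - (p : ℝ) ^ (-α)) / (1 - (p : ℝ)⁻¹))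
    (σ : ℂ) (hσ : σ = ∑ r ∈ Finset.range q, eC (((a * (r : ℤ) : ℤ) : ℝ) / q) * ((γ r : ℝ) : ℂ)) :
    (Nat.gcd q W = 1 →
      ∀ Wbar : ℕ, (W * Wbar) % q = 1 % q →
        σ = eC (((a * b₂ * (Wbar : ℤ) : ℤ) : ℝ) / q) *
          ((∏ p ∈ q.primeFactors, ((p : ℝ) ^ (-α) - (p : ℝ)⁻¹) / (1 - (p : ℝ)⁻¹) : ℝ) : ℂ)) ∧
    (1 < Nat.gcd q W → σ = 0) := by
  have hq0 : q ≠ 0 := by omega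
  have hW0 : W ≠ 0 := hW ▸ primorialBelow_ne_zero w
  set T := q.primeFactors \ W.primeFactors with hT
  have hTq : T ⊆ q.primeFactors := Finset.sdiff_subset
  set g : ℕ → ℂ := fun p => (((1 - (p : ℝ) ^ (-α)) / (1 - (p : ℝ)⁻¹) : ℝ) : ℂ) with hg
  have hγ' : ∀ r : ℕ, ((γ r : ℝ) : ℂ) = ∏ p ∈ T,
      (if ((p ^ q.factorization p : ℕ) : ℤ) ∣ (W : ℤ) * r - b₂ then 1 else g p) := by
    intro r
    rw [hγ, local_density_eq_prod_ite hα.1 hW0 hq0 hb₂, Complex.ofReal_prod]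
    refine Finset.prod_congr rfl fun p _ => ?_
    rw [apply_ite Complex.ofReal, Complex.ofReal_one]
  simp_rw [hγ', sum_eC_mul_prod_ite hTq] at hσ
  have hvanish : ∀ t ∈ T.powerset, t ≠ q.primeFactors →
      ((∏ p ∈ t, (1 - g p)) * ∏ p ∈ T \ t, g p) *
        ∑ r ∈ Finset.range q, eC (((a * (r : ℤ) : ℤ) : ℝ) / q) *
          (if ((∏ p ∈ t, p ^ q.factorization p : ℕ) : ℤ) ∣ (W : ℤ) * r - b₂ then 1 else 0) = 0 := by
    intro t ht hne
    have htq := (Finset.mem_powerset.1 ht).trans hTq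
    rw [sum_eC_ite_dvd_eq_zero hq0 (prod_ordProj_dvd hq0 htq)
      (fun h => hne (eq_primeFactors_of_prod_ordProj_eq htq h)) ha, mul_zero]
  constructor
  · intro hcop V hV
    have hTeq : T = q.primeFactors :=
      Finset.sdiff_eq_self_of_disjoint (Nat.Coprime.disjoint_primeFactors hcop)
    have hWV : (q : ℤ) ∣ (W : ℤ) * (V : ℤ) - 1 := by
      have h : 1 ≡ W * V [MOD q] := hV.symm
      exact_mod_cast (Nat.modEq_iff_dvd).1 h
    rw [hσ, Finset.sum_eq_single q.primeFactors hvanish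
        (fun h => absurd (Finset.mem_powerset.2 hTeq.ge) h),
      prod_ordProj_eq_self hq0, sum_eC_ite_dvd_self hq0 a b₂ hWV, hTeq, Finset.sdiff_self,
      Finset.prod_empty, mul_one, mul_comm, Complex.ofReal_prod]
    congr 1
    refine Finset.prod_congr rfl fun p hp => ?_
    rw [hg, ← Complex.ofReal_one, ← Complex.ofReal_sub]
    congr 1
    have h := (local_factor_denom_pos (Nat.prime_of_mem_primeFactors hp)).ne'
    rw [eq_div_iff h, sub_mul, div_mul_cancel₀ _ h]
    ring
  · intro hgcd
    rw [hσ]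
    refine Finset.sum_eq_zero fun t ht => hvanish t ht ?_
    rintro rfl
    obtain ⟨p, hp, hpd⟩ := Nat.exists_prime_and_dvd hgcd.ne'
    have hpq : p ∈ q.primeFactors :=
      Nat.mem_primeFactors.2 ⟨hp, hpd.trans (Nat.gcd_dvd_left _ _), hq0⟩
    exact (Finset.mem_sdiff.1 (Finset.mem_powerset.1 ht hpq)).2
      (Nat.mem_primeFactors.2 ⟨hp, hpd.trans (Nat.gcd_dvd_right _ _), hW0⟩)
end

section
/- For all real α ∈ (0, 1), all real w ≥ 2 and all real T ≥ 1, one has Σ_{b ∈ ℕ, b w-smooth, b > T} 1/b ≤ T^{−α} · ∏_{p ≤ w, p prime} (1 − p^{α−1})^{−1}; in particular the sum on the left-hand side converges. -/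
open scoped Classical

/-- The Euler product over the primes below `N` of the function `n ↦ n ^ s`, for `s < 0`. -/
lemma hasSum_indicator_smoothNumbers_rpow {s : ℝ} (hs : s < 0) (N : ℕ) :
    HasSum ((N.smoothNumbers : Set ℕ).indicator fun n : ℕ => (n : ℝ) ^ s)
      (∏ p ∈ N.primesBelow, (1 - (p : ℝ) ^ s)⁻¹) := by
  let f : ℕ →* ℝ :=
    { toFun := fun n => (n : ℝ) ^ s
      map_one' := by simp
      map_mul' := fun m n => by
        simp only [Nat.cast_mul]
        exact Real.mul_rpow m.cast_nonneg n.cast_nonneg }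
  have hf {p : ℕ} (hp : p.Prime) : ‖f p‖ < 1 := by
    change ‖(p : ℝ) ^ s‖ < 1
    rw [Real.norm_of_nonneg (by positivity)]
    exact Real.rpow_lt_one_of_one_lt_of_neg (by exact_mod_cast hp.one_lt) hs
  exact hasSum_subtype_iff_indicator.mp
    (EulerProduct.summable_and_hasSum_smoothNumbers_prod_primesBelow_geometric hf N).2

/-- The pointwise bound behind Rankin's trick. -/
lemma one_div_le_rpow_neg_mul_rpow_sub_one {α T x : ℝ} (hα : 0 ≤ α) (hT : 0 < T) (hx : T ≤ x) :
    1 / x ≤ T ^ (-α) * x ^ (α - 1) := by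
  have hx0 : 0 < x := hT.trans_le hx
  calc 1 / x = x ^ (-α) * x ^ (α - 1) := by
        rw [← Real.rpow_add hx0, show -α + (α - 1) = -1 by ring, Real.rpow_neg_one, one_div]
    _ ≤ T ^ (-α) * x ^ (α - 1) := by
        gcongr ?_ * _
        exact Real.rpow_le_rpow_of_nonpos hT hx (neg_nonpos.mpr hα)

/-- Rankin's trick: the tail of the sum of reciprocals of `w`-smooth numbers. -/
theorem rankin_tail_smooth_reciprocals (α w T : ℝ)
    (hα : α ∈ Set.Ioo (0 : ℝ) 1) (hw : 2 ≤ w) (hT : 1 ≤ T) :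
    Summable (fun (b : ℕ) =>
      if (∀ p ∈ b.primeFactors, (p : ℝ) ≤ w) ∧ T < (b : ℝ) then 1 / (b : ℝ) else 0) ∧
    (∑' b : ℕ,
        (if (∀ p ∈ b.primeFactors, (p : ℝ) ≤ w) ∧ T < (b : ℝ) then 1 / (b : ℝ) else 0)) ≤
      T ^ (-α) *
        ∏ p ∈ (Finset.range (⌊w⌋₊ + 1)).filter (fun (p : ℕ) => p.Prime ∧ (p : ℝ) ≤ w),
          (1 - (p : ℝ) ^ (α - 1))⁻¹ := by
  have hw0 : 0 ≤ w := by linarith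
  have hT0 : 0 < T := by linarith
  have hlt (p : ℕ) : p < ⌊w⌋₊ + 1 ↔ (p : ℝ) ≤ w := by
    rw [Nat.lt_succ_iff, Nat.le_floor_iff hw0]
  have hprimes : (Finset.range (⌊w⌋₊ + 1)).filter (fun (p : ℕ) => p.Prime ∧ (p : ℝ) ≤ w) =
      (⌊w⌋₊ + 1).primesBelow := by
    ext p
    simp only [Finset.mem_filter, Finset.mem_range, Nat.mem_primesBelow, hlt]
    tauto
  have hsum := (hasSum_indicator_smoothNumbers_rpow (sub_neg.mpr hα.2) (⌊w⌋₊ + 1)).mul_left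
    (T ^ (-α))
  have hle (b : ℕ) :
      (if (∀ p ∈ b.primeFactors, (p : ℝ) ≤ w) ∧ T < (b : ℝ) then 1 / (b : ℝ) else 0) ≤
        T ^ (-α) * ((⌊w⌋₊ + 1).smoothNumbers : Set ℕ).indicator
          (fun n : ℕ => (n : ℝ) ^ (α - 1)) b := by
    split_ifs with h
    · have hb : b ≠ 0 := by
        rintro rfl
        exact absurd h.2 (by simpa using hT0.le)
      have hmem : b ∈ (⌊w⌋₊ + 1).smoothNumbers :=
        ⟨hb, fun p hp => (hlt p).mpr (h.1 p (List.mem_toFinset.mpr hp))⟩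
      rw [Set.indicator_of_mem hmem]
      exact one_div_le_rpow_neg_mul_rpow_sub_one hα.1.le hT0 h.2.le
    · exact mul_nonneg (by positivity) (Set.indicator_nonneg (fun n _ => by positivity) b)
  have hsummable := Summable.of_nonneg_of_le (fun b => by split_ifs <;> positivity) hle
    hsum.summable
  rw [hprimes]
  exact ⟨hsummable, hasSum_le hle hsummable.hasSum hsum⟩
end
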